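/- arXiv:2411.07908 — 2 statements merged into one kernel-verified Lean document; each statement's English description precedes it below -/
import Mathlib

section
/- Let t ≥ 2 and k ≥ 2 be integers. For every ε > 0 there exists n_0 = n_0(t, k, ε) such that for all n ≥ n_0, there is an n-vertex (t+1)-union-free tk-graph with at least (1−ε) · C(n, k)/C(tk−1, k−1) edges, i.e., U_{t+1}(n, tk) ≥ (1−ε) · C(n, k)/C(tk−1, k−1), where C(a,b) denotes the binomial coefficient. -/
open Finset

variable {α : Type*} {β : Type*}

/-- An `r`-graph `H` is `t`-cancellative if for any subfamily `𝒜 ⊆ H` of at most `t` edges and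
any two further distinct edges `B, C ∈ H` not in `𝒜`, the symmetric difference of `B` and `C`
is not contained in the union of the edges of `𝒜`. -/
def IsCancellative [DecidableEq α] (t : ℕ) (H : Finset (Finset α)) : Prop :=
  ∀ 𝒜 ⊆ H, 𝒜.card ≤ t → ∀ B ∈ H, ∀ C ∈ H, B ∉ 𝒜 → C ∉ 𝒜 → B ≠ C →
    ¬((B \ C) ∪ (C \ B) ⊆ 𝒜.sup id)

/-- An `r`-graph `H` is `t`-union-free if any two distinct nonempty subfamilies of `H`, each
consisting of at most `t` edges, have distinct unions. -/
def IsUnionFree [DecidableEq α] (t : ℕ) (H : Finset (Finset α)) : Prop :=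
  ∀ 𝒜 ⊆ H, ∀ ℬ ⊆ H, 𝒜.Nonempty → ℬ.Nonempty → 𝒜.card ≤ t → ℬ.card ≤ t → 𝒜 ≠ ℬ →
    𝒜.sup id ≠ ℬ.sup id

/-- An `r`-graph `H` is `t`-cover-free if no edge of `H` is contained in the union of at most
`t` other edges of `H`. -/
def IsCoverFree [DecidableEq α] (t : ℕ) (H : Finset (Finset α)) : Prop :=
  ∀ 𝒜 ⊆ H, 𝒜.card ≤ t → ∀ B ∈ H, B ∉ 𝒜 → ¬(B ⊆ 𝒜.sup id)

/-- `H` is `(v, e)`-free if any `e` distinct edges of `H` have union of size at least `v + 1`. -/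
def IsVEFree [DecidableEq α] (v e : ℕ) (H : Finset (Finset α)) : Prop :=
  ∀ 𝒜 ⊆ H, 𝒜.card = e → v + 1 ≤ (𝒜.sup id).card

/-- The `k`-shadow of `F`: all `k`-subsets of the vertex set contained in some edge of `F`. -/
def kShadow [DecidableEq α] (k : ℕ) (F : Finset (Finset α)) : Finset (Finset α) :=
  F.sup fun A => Finset.powersetCard k A

/-- `J'` is a copy of `J`: the image of `J` under a map injective on the vertex set of `J`. -/
def IsCopyOf [DecidableEq α] [DecidableEq β] (J' : Finset (Finset β))
    (J : Finset (Finset α)) : Prop :=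
  ∃ f : α → β, Set.InjOn f ↑(J.sup id) ∧ J' = J.image fun A => A.image f

/-- The matching number of `H` is at most `b`: every subfamily of pairwise disjoint edges
has at most `b` members. -/
def MatchingNumberLE [DecidableEq α] (H : Finset (Finset α)) (b : ℕ) : Prop :=
  ∀ M ⊆ H, (∀ A ∈ M, ∀ B ∈ M, A ≠ B → Disjoint A B) → M.card ≤ b

/-- `C_t(n, r)`: the maximum number of edges in an `n`-vertex `t`-cancellative `r`-graph. -/
noncomputable def maxCancellative (t n r : ℕ) : ℕ :=
  sSup {N | ∃ H : Finset (Finset (Fin n)),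
    (∀ e ∈ H, e.card = r) ∧ IsCancellative t H ∧ H.card = N}

/-- `U_t(n, r)`: the maximum number of edges in an `n`-vertex `t`-union-free `r`-graph. -/
noncomputable def maxUnionFree (t n r : ℕ) : ℕ :=
  sSup {N | ∃ H : Finset (Finset (Fin n)),
    (∀ e ∈ H, e.card = r) ∧ IsUnionFree t H ∧ H.card = N}

/-- `F_t(n, r)`: the maximum number of edges in an `n`-vertex `t`-cover-free `r`-graph. -/
noncomputable def maxCoverFree (t n r : ℕ) : ℕ :=
  sSup {N | ∃ H : Finset (Finset (Fin n)),
    (∀ e ∈ H, e.card = r) ∧ IsCoverFree t H ∧ H.card = N}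

section Bernoulli

variable {ι : Type*} [DecidableEq ι]

/-- Expectation of `X T`, where `T` is a random subset of `s` containing each `i ∈ s`
independently with probability `p i`. -/
noncomputable def bernoulliExp (p : ι → ℝ) (s : Finset ι) (X : Finset ι → ℝ) : ℝ :=
  ∑ T ∈ s.powerset, ((∏ i ∈ T, p i) * ∏ i ∈ s \ T, (1 - p i)) * X T

variable {p : ι → ℝ} {s : Finset ι}

lemma bernoulliExp_add (X Y : Finset ι → ℝ) :
    bernoulliExp p s (fun T => X T + Y T) = bernoulliExp p s X + bernoulliExp p s Y := by
  simp only [bernoulliExp, mul_add, sum_add_distrib]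

lemma bernoulliExp_const_mul (c : ℝ) (X : Finset ι → ℝ) :
    bernoulliExp p s (fun T => c * X T) = c * bernoulliExp p s X := by
  simp only [bernoulliExp, mul_sum]
  exact sum_congr rfl fun _ _ => by ring

lemma bernoulliExp_sub (X Y : Finset ι → ℝ) :
    bernoulliExp p s (fun T => X T - Y T) = bernoulliExp p s X - bernoulliExp p s Y := by
  simp only [bernoulliExp, mul_sub, sum_sub_distrib]

lemma bernoulliExp_sum {κ : Type*} (K : Finset κ) (X : κ → Finset ι → ℝ) :
    bernoulliExp p s (fun T => ∑ j ∈ K, X j T) = ∑ j ∈ K, bernoulliExp p s (X j) := by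
  simp only [bernoulliExp, mul_sum]
  exact sum_comm

lemma bernoulliExp_one : bernoulliExp p s (fun _ => 1) = 1 := by
  simp only [bernoulliExp, mul_one]
  rw [← prod_add]
  simp

lemma bernoulliExp_const (c : ℝ) : bernoulliExp p s (fun _ => c) = c := by
  simpa [bernoulliExp_one] using bernoulliExp_const_mul (p := p) (s := s) c (fun _ => 1)

lemma bernoulliWeight_nonneg (h0 : ∀ i ∈ s, 0 ≤ p i) (h1 : ∀ i ∈ s, p i ≤ 1) {T : Finset ι}
    (hT : T ⊆ s) : 0 ≤ (∏ i ∈ T, p i) * ∏ i ∈ s \ T, (1 - p i) :=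
  mul_nonneg (prod_nonneg fun i hi => h0 i (hT hi))
    (prod_nonneg fun i hi => sub_nonneg.2 (h1 i (mem_sdiff.1 hi).1))

lemma bernoulliExp_mono (h0 : ∀ i ∈ s, 0 ≤ p i) (h1 : ∀ i ∈ s, p i ≤ 1)
    {X Y : Finset ι → ℝ} (h : ∀ T ⊆ s, X T ≤ Y T) :
    bernoulliExp p s X ≤ bernoulliExp p s Y :=
  sum_le_sum fun T hT => mul_le_mul_of_nonneg_left (h T (mem_powerset.1 hT))
    (bernoulliWeight_nonneg h0 h1 (mem_powerset.1 hT))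

lemma exists_le_bernoulliExp (h0 : ∀ i ∈ s, 0 ≤ p i) (h1 : ∀ i ∈ s, p i ≤ 1)
    (X : Finset ι → ℝ) : ∃ T ⊆ s, X T ≤ bernoulliExp p s X := by
  by_contra! h
  obtain ⟨T₀, hT₀, hmin⟩ := exists_min_image s.powerset X ⟨∅, by simp⟩
  have h₁ := h T₀ (mem_powerset.1 hT₀)
  have h₂ := bernoulliExp_mono h0 h1 (X := fun _ => X T₀) (Y := X)
    fun T hT => hmin T (mem_powerset.2 hT)
  rw [bernoulliExp_const] at h₂
  linarith

/-- Probability of a cylinder event. -/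
lemma bernoulliExp_cylinder {A B : Finset ι} (hA : A ⊆ s) (hB : B ⊆ s) (hAB : Disjoint A B) :
    bernoulliExp p s (fun T => if A ⊆ T ∧ Disjoint B T then 1 else 0) =
      (∏ i ∈ A, p i) * ∏ i ∈ B, (1 - p i) := by
  have key : ∀ T ∈ s.powerset,
      ((∏ i ∈ T, p i) * ∏ i ∈ s \ T, (1 - p i)) *
        (if A ⊆ T ∧ Disjoint B T then (1 : ℝ) else 0) =
      (∏ i ∈ T, if i ∈ B then 0 else p i) * ∏ i ∈ s \ T, if i ∈ A then 0 else 1 - p i := by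
    intro T hT
    split_ifs with h
    · rw [mul_one]
      congr 1
      · refine prod_congr rfl fun i hi => ?_
        rw [if_neg fun hb => disjoint_left.1 h.2 hb hi]
      · refine prod_congr rfl fun i hi => ?_
        rw [if_neg fun ha => (mem_sdiff.1 hi).2 (h.1 ha)]
    · rw [mul_zero]
      by_cases hAT : A ⊆ T
      · obtain ⟨i, hi, hi'⟩ := not_disjoint_iff.1 fun hd => h ⟨hAT, hd⟩
        rw [prod_eq_zero hi' (by simp [hi]), zero_mul]
      · obtain ⟨i, hi, hi'⟩ := not_subset.1 hAT
        rw [prod_eq_zero (i := i) (mem_sdiff.2 ⟨hA hi, hi'⟩) (by simp [hi]), mul_zero]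
  rw [bernoulliExp, sum_congr rfl key, ← prod_add]
  have hU : A ∪ B ⊆ s := union_subset hA hB
  rw [← prod_subset hU, prod_union hAB]
  · congr 1
    · refine prod_congr rfl fun i hi => ?_
      simp [hi, disjoint_left.1 hAB hi]
    · refine prod_congr rfl fun i hi => ?_
      simp [hi, disjoint_right.1 hAB hi]
  · intro i _ hi
    rw [mem_union, not_or] at hi
    simp [hi.1, hi.2]

end Bernoulli

section Nibble

variable {ι V : Type*} [DecidableEq ι] [DecidableEq V]

/-- Degree of the vertex `v` in the hypergraph with edges `f i`, `i ∈ E`. -/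
def hyperDeg (f : ι → Finset V) (E : Finset ι) (v : V) : ℕ := #{i ∈ E | v ∈ f i}

/-- The indices of the edges meeting `Z`. -/
def meeting (f : ι → Finset V) (E : Finset ι) (Z : Finset V) : Finset ι :=
  {i ∈ E | ¬ Disjoint (f i) Z}

/-- Two distinct edges share at most one vertex. -/
def IsLinearHypergraph (f : ι → Finset V) (E : Finset ι) : Prop :=
  ∀ i ∈ E, ∀ j ∈ E, i ≠ j → #(f i ∩ f j) ≤ 1

variable {f : ι → Finset V} {E : Finset ι}

omit [DecidableEq ι] in
lemma hyperDeg_mono {E' : Finset ι} (h : E' ⊆ E) (v : V) : hyperDeg f E' v ≤ hyperDeg f E v :=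
  card_le_card (filter_subset_filter _ h)

omit [DecidableEq ι] in
lemma sum_sum_mem_eq {V₀ : Finset V} (hsub : ∀ i ∈ E, f i ⊆ V₀) (g : V → ι → ℝ) :
    ∑ v ∈ V₀, ∑ i ∈ E with v ∈ f i, g v i = ∑ i ∈ E, ∑ v ∈ f i, g v i := by
  refine sum_comm' fun v i => ?_
  simp only [mem_filter]
  exact ⟨fun h => ⟨h.2.2, h.2.1⟩, fun h => ⟨hsub i h.2 h.1, h.2, h.1⟩⟩

omit [DecidableEq ι] in
lemma sum_sum_edge_eq {V₀ : Finset V} (hsub : ∀ i ∈ E, f i ⊆ V₀) (g : V → ℝ) :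
    ∑ i ∈ E, ∑ v ∈ f i, g v = ∑ v ∈ V₀, hyperDeg f E v * g v := by
  rw [← sum_sum_mem_eq hsub fun v _ => g v]
  simp [hyperDeg]

omit [DecidableEq ι] in
lemma sum_hyperDeg_eq (Z : Finset V) :
    ∑ u ∈ Z, hyperDeg f E u = ∑ i ∈ E, #(f i ∩ Z) := by
  simp only [hyperDeg, card_filter]
  rw [sum_comm]
  refine sum_congr rfl fun i _ => ?_
  rw [← card_filter, inter_comm, filter_mem_eq_inter]

omit [DecidableEq ι] in
lemma card_meeting_eq (Z : Finset V) :
    #(meeting f E Z) = ∑ i ∈ E, if Disjoint (f i) Z then 0 else 1 := by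
  rw [meeting, card_filter]
  exact sum_congr rfl fun i _ => by split_ifs <;> simp_all

omit [DecidableEq ι] in
lemma card_meeting_le (Z : Finset V) : #(meeting f E Z) ≤ ∑ u ∈ Z, hyperDeg f E u := by
  rw [sum_hyperDeg_eq, card_meeting_eq]
  refine sum_le_sum fun i _ => ?_
  split_ifs with h
  · simp
  · rw [not_disjoint_iff_nonempty_inter] at h
    exact h.card_pos

omit [DecidableEq ι] in
lemma sum_hyperDeg_le (hlin : IsLinearHypergraph f E) (Z : Finset V) :
    ∑ u ∈ Z, hyperDeg f E u ≤ #(meeting f E Z) + #Z ^ 2 := by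
  have hpair : ∑ i ∈ E, #(f i ∩ Z).offDiag ≤ #Z ^ 2 := by
    have : ∑ i ∈ E, #(f i ∩ Z).offDiag ≤ #(Z ×ˢ Z) := by
      rw [← card_biUnion]
      · refine card_le_card ?_
        intro x hx
        simp only [mem_biUnion, mem_offDiag, mem_inter] at hx
        obtain ⟨i, _, h1, h2, _⟩ := hx
        exact mem_product.2 ⟨h1.2, h2.2⟩
      · intro i hi j hj hij
        rw [Function.onFun, disjoint_left]
        rintro ⟨a, b⟩ h1 h2
        simp only [mem_offDiag, mem_inter] at h1 h2
        have := card_le_one.1 (hlin i hi j hj hij) a (mem_inter.2 ⟨h1.1.1, h2.1.1⟩) b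
          (mem_inter.2 ⟨h1.2.1.1, h2.2.1.1⟩)
        exact h1.2.2 this
    simpa [sq] using this
  refine le_trans ?_ (Nat.add_le_add_left hpair _)
  rw [sum_hyperDeg_eq, card_meeting_eq, ← sum_add_distrib]
  refine sum_le_sum fun i _ => ?_
  rw [offDiag_card]
  split_ifs with h
  · rw [disjoint_iff_inter_eq_empty] at h
    simp [h]
  · rw [not_disjoint_iff_nonempty_inter] at h
    have := h.card_pos
    generalize #(f i ∩ Z) = m at *
    obtain ⟨m, rfl⟩ : ∃ l, m = l + 1 := ⟨m - 1, by omega⟩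
    have : (m + 1) * (m + 1) - (m + 1) = m * m + m := by
      rw [Nat.sub_eq_iff_eq_add (by nlinarith)]; ring
    rw [this]
    nlinarith [Nat.zero_le (m * m)]

lemma exp_neg_le_exp_neg_add {x y z : ℝ} (hx : 0 ≤ x) (hz : 0 ≤ z) (h : y ≤ x + z) :
    Real.exp (-x) ≤ Real.exp (-y) + z := by
  have h1 : Real.exp (-x) ≤ 1 := Real.exp_le_one_iff.2 (by linarith)
  have h2 : Real.exp (-x) * Real.exp (-z) ≤ Real.exp (-y) := by
    rw [← Real.exp_add]
    exact Real.exp_le_exp.2 (by linarith)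
  have h3 : Real.exp (-x) * (1 - z) ≤ Real.exp (-x) * Real.exp (-z) :=
    mul_le_mul_of_nonneg_left (by linarith [Real.add_one_le_exp (-z)]) (Real.exp_pos _).le
  nlinarith

lemma one_sub_pow_le {a : ℝ} (ha1 : a ≤ 1) (d : ℕ) :
    (1 - a) ^ d ≤ Real.exp (-(a * d)) := by
  calc (1 - a) ^ d ≤ Real.exp (-a) ^ d :=
        pow_le_pow_left₀ (by linarith) (by linarith [Real.add_one_le_exp (-a)]) d
    _ = Real.exp (-(a * d)) := by rw [← Real.exp_nat_mul]; congr 1; ring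

lemma exp_le_one_sub_pow {a : ℝ} (ha1 : a ≤ 1 / 2) (d : ℕ) :
    Real.exp (-((a + 2 * a ^ 2) * d)) ≤ (1 - a) ^ d := by
  have h1 : Real.exp (-(a + 2 * a ^ 2)) ≤ 1 - a := by
    rw [Real.exp_neg]
    refine inv_le_of_inv_le₀ (by linarith) ?_
    refine le_trans ?_ (Real.add_one_le_exp _)
    rw [inv_le_iff_one_le_mul₀ (by linarith)]
    nlinarith [mul_nonneg (sq_nonneg a) (by linarith : 0 ≤ 1 - 2 * a)]
  calc Real.exp (-((a + 2 * a ^ 2) * d)) = Real.exp (-(a + 2 * a ^ 2)) ^ d := by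
        rw [← Real.exp_nat_mul]; congr 1; ring
    _ ≤ (1 - a) ^ d := pow_le_pow_left₀ (Real.exp_pos _).le h1 d

omit [DecidableEq ι] in
lemma one_sub_pow_meeting_le (hlin : IsLinearHypergraph f E) {a D : ℝ} (ha0 : 0 ≤ a)
    (ha1 : a ≤ 1) (Z : Finset V) :
    (1 - a) ^ #(meeting f E Z) ≤
      Real.exp (-(a * D * #Z)) + (a * ∑ u ∈ Z, |(hyperDeg f E u : ℝ) - D| + a * #Z ^ 2) := by
  refine (one_sub_pow_le ha1 _).trans (exp_neg_le_exp_neg_add (by positivity) (by positivity) ?_)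
  have h1 : (∑ u ∈ Z, (hyperDeg f E u : ℝ)) ≤ #(meeting f E Z) + (#Z : ℝ) ^ 2 := by
    exact_mod_cast sum_hyperDeg_le hlin Z
  have h2 : (#Z : ℝ) * D ≤ ∑ u ∈ Z, (hyperDeg f E u : ℝ) +
      ∑ u ∈ Z, |(hyperDeg f E u : ℝ) - D| := by
    rw [← sum_add_distrib, ← nsmul_eq_mul]
    exact card_nsmul_le_sum _ _ _ fun u _ => by
      linarith [neg_abs_le ((hyperDeg f E u : ℝ) - D)]
  have h3 := mul_le_mul_of_nonneg_left (h2.trans (add_le_add_left h1 _)) ha0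
  linarith

omit [DecidableEq ι] in
lemma le_one_sub_pow_meeting {a D : ℝ} (ha0 : 0 ≤ a) (ha1 : a ≤ 1 / 2) (hD : 0 ≤ D)
    (Z : Finset V) :
    Real.exp (-(a * D * #Z)) - (a * ∑ u ∈ Z, |(hyperDeg f E u : ℝ) - D| +
      2 * a ^ 2 * ∑ u ∈ Z, (hyperDeg f E u : ℝ)) ≤ (1 - a) ^ #(meeting f E Z) := by
  rw [sub_le_iff_le_add]
  refine le_trans (exp_neg_le_exp_neg_add (y := (a + 2 * a ^ 2) * #(meeting f E Z))
    (by positivity) (by positivity) ?_) (add_le_add_left (exp_le_one_sub_pow ha1 _) _)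
  have h1 : (#(meeting f E Z) : ℝ) ≤ ∑ u ∈ Z, (hyperDeg f E u : ℝ) := by
    exact_mod_cast card_meeting_le (f := f) (E := E) Z
  have h2 : ∑ u ∈ Z, (hyperDeg f E u : ℝ) ≤ (#Z : ℝ) * D +
      ∑ u ∈ Z, |(hyperDeg f E u : ℝ) - D| := by
    rw [← nsmul_eq_mul, ← sum_const, ← sum_add_distrib]
    exact sum_le_sum fun u _ => by linarith [le_abs_self ((hyperDeg f E u : ℝ) - D)]
  have h3 := mul_le_mul_of_nonneg_left h1 (show 0 ≤ a + 2 * a ^ 2 by positivity)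
  have h4 := mul_le_mul_of_nonneg_left h2 ha0
  linarith

/-- The vertices of `V₀` avoided by the edges indexed by `T`. -/
def avoided (f : ι → Finset V) (V₀ : Finset V) (T : Finset ι) : Finset V :=
  {v ∈ V₀ | ∀ i ∈ T, v ∉ f i}

/-- The indices of the edges contained in `V'`. -/
def inside (f : ι → Finset V) (E : Finset ι) (V' : Finset V) : Finset ι := {i ∈ E | f i ⊆ V'}

lemma bernoulliExp_congr {κ : Type*} [DecidableEq κ] {p : κ → ℝ} {s : Finset κ}
    {X Y : Finset κ → ℝ} (h : ∀ T ⊆ s, X T = Y T) : bernoulliExp p s X = bernoulliExp p s Y :=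
  sum_congr rfl fun T hT => by rw [h T (mem_powerset.1 hT)]

lemma bernoulliExp_avoided {V₀ Z : Finset V} (hZ : Z ⊆ V₀) (a : ℝ) :
    bernoulliExp (fun _ => a) E (fun T => if Z ⊆ avoided f V₀ T then 1 else 0) =
      (1 - a) ^ #(meeting f E Z) := by
  have h := bernoulliExp_cylinder (p := fun _ => a) (s := E) (A := ∅) (B := meeting f E Z)
    (empty_subset _) (filter_subset _ _) (disjoint_empty_left _)
  simp only [prod_const, card_empty, pow_zero, one_mul] at h
  rw [← h]
  refine bernoulliExp_congr fun T hT => if_congr ?_ rfl rfl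
  simp only [empty_subset, true_and]
  constructor
  · intro h
    rw [disjoint_left]
    intro i hi hiT
    obtain ⟨v, hv, hvZ⟩ := not_disjoint_iff.1 (mem_filter.1 hi).2
    exact (mem_filter.1 (h hvZ)).2 i hiT hv
  · intro h v hv
    refine mem_filter.2 ⟨hZ hv, fun i hi hvi => disjoint_right.1 h hi ?_⟩
    exact mem_filter.2 ⟨hT hi, not_disjoint_iff.2 ⟨v, hvi, hv⟩⟩

omit [DecidableEq ι] in
lemma sum_sq_avoided_eq {V₀ : Finset V} (T : Finset ι) (D' : ℝ) :
    ∑ v ∈ avoided f V₀ T, ((hyperDeg f (inside f E (avoided f V₀ T)) v : ℝ) - D') ^ 2 =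
      ∑ v ∈ V₀, ((∑ i ∈ E with v ∈ f i, ∑ j ∈ E with v ∈ f j,
          if f i ∪ f j ⊆ avoided f V₀ T then (1 : ℝ) else 0)
        - 2 * D' * (∑ i ∈ E with v ∈ f i, if f i ⊆ avoided f V₀ T then (1 : ℝ) else 0)
        + D' ^ 2 * (if {v} ⊆ avoided f V₀ T then (1 : ℝ) else 0)) := by
  have hsub : avoided f V₀ T ⊆ V₀ := filter_subset _ _
  set V' := avoided f V₀ T
  have hdeg : ∀ v, (hyperDeg f (inside f E V') v : ℝ) =
      ∑ i ∈ E with v ∈ f i, if f i ⊆ V' then (1 : ℝ) else 0 := by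
    intro v
    rw [hyperDeg, inside, filter_filter, sum_boole, filter_filter]
    simp only [and_comm]
  have hdouble : ∀ v, (∑ i ∈ E with v ∈ f i, ∑ j ∈ E with v ∈ f j,
      if f i ∪ f j ⊆ V' then (1 : ℝ) else 0) = (hyperDeg f (inside f E V') v : ℝ) ^ 2 := by
    intro v
    rw [hdeg, sq, sum_mul_sum]
    refine sum_congr rfl fun i _ => sum_congr rfl fun j _ => ?_
    simp only [ite_zero_mul_ite_zero, union_subset_iff, mul_one]
  have hterm : ∀ v ∈ V₀, ((∑ i ∈ E with v ∈ f i, ∑ j ∈ E with v ∈ f j,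
          if f i ∪ f j ⊆ V' then (1 : ℝ) else 0)
        - 2 * D' * (∑ i ∈ E with v ∈ f i, if f i ⊆ V' then (1 : ℝ) else 0)
        + D' ^ 2 * (if {v} ⊆ V' then (1 : ℝ) else 0)) =
        if v ∈ V' then ((hyperDeg f (inside f E V') v : ℝ) - D') ^ 2 else 0 := by
    intro v _
    simp only [hdouble, ← hdeg, singleton_subset_iff]
    split_ifs with hv
    · ring
    · have : hyperDeg f (inside f E V') v = 0 := by
        rw [hyperDeg, card_eq_zero, filter_eq_empty_iff]
        intro i hi hvi
        exact hv ((mem_filter.1 hi).2 hvi)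
      simp [this]
  rw [sum_congr rfl hterm, ← sum_filter, filter_mem_eq_inter, inter_eq_right.2 hsub]

end Nibble

section Nibble

variable {ι V : Type*} [DecidableEq ι] [DecidableEq V]
variable {f : ι → Finset V} {E : Finset ι}

omit [DecidableEq ι] in
lemma sum_abs_dev_le {V₀ : Finset V} {D η N : ℝ} (hD : 0 < D) (hη : 0 < η)
    (hN : (#V₀ : ℝ) ≤ N)
    (hL2 : ∑ v ∈ V₀, ((hyperDeg f E v : ℝ) - D) ^ 2 ≤ η ^ 2 * D ^ 2 * N) :
    ∑ v ∈ V₀, |(hyperDeg f E v : ℝ) - D| ≤ η * D * N := by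
  have hηD : 0 < η * D := mul_pos hη hD
  have h1 : ∀ v ∈ V₀, 2 * (η * D) * |(hyperDeg f E v : ℝ) - D| ≤
      (η * D) ^ 2 + ((hyperDeg f E v : ℝ) - D) ^ 2 := fun v _ => by
    rw [← sq_abs ((hyperDeg f E v : ℝ) - D)]
    nlinarith [sq_nonneg (η * D - |(hyperDeg f E v : ℝ) - D|)]
  have h2 := sum_le_sum h1
  rw [← mul_sum, sum_add_distrib, sum_const, nsmul_eq_mul] at h2
  have h3 : (#V₀ : ℝ) * (η * D) ^ 2 ≤ N * (η * D) ^ 2 :=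
    mul_le_mul_of_nonneg_right hN (by positivity)
  have h4 : 2 * (η * D) * ∑ v ∈ V₀, |(hyperDeg f E v : ℝ) - D| ≤
      2 * (η * D) * (η * D * N) := by nlinarith
  exact le_of_mul_le_mul_left h4 (by positivity)

set_option maxHeartbeats 1000000 in
lemma avoid_second_moment_at_le (hlin : IsLinearHypergraph f E) {r : ℕ} (hr : 1 ≤ r)
    (hcard : ∀ i ∈ E, #(f i) = r) {a D C : ℝ} (ha0 : 0 ≤ a) (ha1 : a ≤ 1 / 2) (hD : 0 < D)
    (v : V) (hdeg : (hyperDeg f E v : ℝ) ≤ C * D) :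
    (∑ i ∈ E with v ∈ f i, ∑ j ∈ E with v ∈ f j, (1 - a) ^ #(meeting f E (f i ∪ f j)))
      - 2 * (D * Real.exp (-(a * D * (r - 1)))) *
        (∑ i ∈ E with v ∈ f i, (1 - a) ^ #(meeting f E (f i)))
      + (D * Real.exp (-(a * D * (r - 1)))) ^ 2 * (1 - a) ^ #(meeting f E {v}) ≤
    ((hyperDeg f E v : ℝ) - D) ^ 2
      + (2 * a * (C * D) + 2 * D * a) *
        (∑ i ∈ E with v ∈ f i, ∑ u ∈ f i, |(hyperDeg f E u : ℝ) - D|)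
      + 4 * D * a ^ 2 * (∑ i ∈ E with v ∈ f i, ∑ u ∈ f i, (hyperDeg f E u : ℝ))
      + D ^ 2 * a * |(hyperDeg f E v : ℝ) - D|
      + (4 * r ^ 2 * a * (C * D) ^ 2 + C * D + D ^ 2 * a) := by
  set Δ : V → ℝ := fun u => |(hyperDeg f E u : ℝ) - D| with hΔ
  set d : ℝ := (hyperDeg f E v : ℝ) with hd
  set s : ℝ := ∑ i ∈ E with v ∈ f i, ∑ u ∈ f i, Δ u with hs
  set w : ℝ := ∑ i ∈ E with v ∈ f i, ∑ u ∈ f i, (hyperDeg f E u : ℝ) with hw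
  set b : ℝ := Real.exp (-(a * D * (r - 1))) with hb
  set z : ℝ := Real.exp (-(a * D)) with hz
  have hΔ0 : ∀ u, 0 ≤ Δ u := fun u => abs_nonneg _
  have hs0 : 0 ≤ s := sum_nonneg fun i _ => sum_nonneg fun u _ => hΔ0 u
  have hw0 : 0 ≤ w := sum_nonneg fun i _ => sum_nonneg fun u _ => Nat.cast_nonneg _
  have hd0 : 0 ≤ d := Nat.cast_nonneg _
  have hr1 : (0 : ℝ) ≤ r - 1 := by
    have : (1 : ℝ) ≤ r := by exact_mod_cast hr
    linarith
  have hb0 : 0 < b := Real.exp_pos _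
  have hb1 : b ≤ 1 := Real.exp_le_one_iff.2 (by
    have := mul_nonneg (mul_nonneg ha0 hD.le) hr1
    linarith)
  have hz0 : 0 < z := Real.exp_pos _
  have hz1 : z ≤ 1 := Real.exp_le_one_iff.2 (by
    have := mul_nonneg ha0 hD.le
    linarith)
  have hy : Real.exp (-(a * D * r)) = z * b := by
    rw [hz, hb, ← Real.exp_add]; congr 1; ring
  have hx : Real.exp (-(a * D * (2 * r - 1))) = z * b ^ 2 := by
    rw [hz, hb, sq, ← Real.exp_add, ← Real.exp_add]; congr 1; ring
  clear_value b z
  have hcd : (#(E.filter fun i => v ∈ f i) : ℝ) = d := rfl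
  have hpair : ∀ i ∈ E.filter (fun i => v ∈ f i), ∀ j ∈ E.filter (fun i => v ∈ f i),
      (1 - a) ^ #(meeting f E (f i ∪ f j)) ≤ z * b ^ 2 + a * ∑ u ∈ f i, Δ u
        + a * ∑ u ∈ f j, Δ u + 4 * r ^ 2 * a + (if i = j then 1 else 0) := by
    intro i hi j hj
    have hsi : 0 ≤ ∑ u ∈ f i, Δ u := sum_nonneg fun u _ => hΔ0 u
    have hsj : 0 ≤ ∑ u ∈ f j, Δ u := sum_nonneg fun u _ => hΔ0 u
    rw [mem_filter] at hi hj
    split_ifs with hij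
    · have h1 : (1 - a) ^ #(meeting f E (f i ∪ f j)) ≤ 1 :=
        pow_le_one₀ (by linarith) (by linarith)
      have h2 : 0 ≤ z * b ^ 2 + a * ∑ u ∈ f i, Δ u + a * ∑ u ∈ f j, Δ u + 4 * r ^ 2 * a := by
        positivity
      linarith
    · have hinter : #(f i ∩ f j) = 1 := le_antisymm (hlin i hi.1 j hj.1 hij)
        (card_pos.2 ⟨v, mem_inter.2 ⟨hi.2, hj.2⟩⟩)
      have hunion := card_union_add_card_inter (f i) (f j)
      rw [hcard i hi.1, hcard j hj.1, hinter] at hunion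
      have hu : (#(f i ∪ f j) : ℝ) = 2 * r - 1 := by
        have : (#(f i ∪ f j) : ℝ) + 1 = r + r := by exact_mod_cast hunion
        linarith
      have h1 := one_sub_pow_meeting_le hlin (D := D) ha0 (by linarith) (f i ∪ f j)
      rw [hu, hx] at h1
      have h2 : ∑ u ∈ f i ∪ f j, Δ u ≤ ∑ u ∈ f i, Δ u + ∑ u ∈ f j, Δ u := by
        rw [← sum_union_inter]
        have : 0 ≤ ∑ u ∈ f i ∩ f j, Δ u := sum_nonneg fun u _ => hΔ0 u
        linarith
      have h3 : (2 * (r : ℝ) - 1) ^ 2 ≤ 4 * r ^ 2 := by nlinarith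
      have h4 := mul_le_mul_of_nonneg_left h2 ha0
      have h5 := mul_le_mul_of_nonneg_left h3 ha0
      linarith
  have hfirst : (∑ i ∈ E with v ∈ f i, ∑ j ∈ E with v ∈ f j,
      (1 - a) ^ #(meeting f E (f i ∪ f j))) ≤
      z * b ^ 2 * d ^ 2 + 2 * a * d * s + 4 * r ^ 2 * a * d ^ 2 + d := by
    refine (sum_le_sum fun i hi => sum_le_sum fun j hj => hpair i hi j hj).trans (le_of_eq ?_)
    simp only [sum_add_distrib, sum_const, nsmul_eq_mul, ← mul_sum, hcd, ← hs]
    have hdiag : ∀ i ∈ E.filter (v ∈ f ·),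
        (∑ j ∈ E.filter (v ∈ f ·), if i = j then (1 : ℝ) else 0) = 1 := fun i hi => by
      rw [sum_ite_eq, if_pos hi]
    rw [sum_congr rfl hdiag, sum_const, nsmul_eq_mul, hcd]
    ring
  have hsecond : z * b * d - a * s - 2 * a ^ 2 * w ≤
      ∑ i ∈ E with v ∈ f i, (1 - a) ^ #(meeting f E (f i)) := by
    have h1 : ∀ i ∈ E.filter (fun i => v ∈ f i), z * b - (a * ∑ u ∈ f i, Δ u +
        2 * a ^ 2 * ∑ u ∈ f i, (hyperDeg f E u : ℝ)) ≤ (1 - a) ^ #(meeting f E (f i)) := by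
      intro i hi
      have := le_one_sub_pow_meeting (E := E) (f := f) ha0 ha1 hD.le (f i)
      rwa [hcard i (mem_filter.1 hi).1, hy] at this
    refine le_trans (le_of_eq ?_) (sum_le_sum h1)
    simp only [sum_sub_distrib, sum_add_distrib, sum_const, nsmul_eq_mul, ← mul_sum, hcd, ← hs,
      ← hw]
    ring
  have hthird : (1 - a) ^ #(meeting f E {v}) ≤ z + a * Δ v + a := by
    have := one_sub_pow_meeting_le hlin (D := D) ha0 (by linarith) {v}
    simp only [card_singleton, Nat.cast_one, mul_one, sum_singleton, one_pow] at this
    linarith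
  change _ ≤ (d - D) ^ 2 + (2 * a * (C * D) + 2 * D * a) * s + 4 * D * a ^ 2 * w
    + D ^ 2 * a * Δ v + (4 * r ^ 2 * a * (C * D) ^ 2 + C * D + D ^ 2 * a)
  have hΔv := hΔ0 v
  clear_value d s w Δ
  generalize Δ v = e at *
  generalize (∑ i ∈ E with v ∈ f i, ∑ j ∈ E with v ∈ f j,
    (1 - a) ^ #(meeting f E (f i ∪ f j))) = S₁ at *
  generalize (∑ i ∈ E with v ∈ f i, (1 - a) ^ #(meeting f E (f i))) = S₂ at *
  generalize (1 - a) ^ #(meeting f E {v}) = S₃ at *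
  have hDb : D * b ≤ D := mul_le_of_le_one_right hD.le hb1
  have hDb0 : 0 ≤ D * b := by positivity
  have e1 : 2 * (D * b) * (z * b * d - a * s - 2 * a ^ 2 * w) ≤ 2 * (D * b) *
  S₂ :=
    mul_le_mul_of_nonneg_left hsecond (by positivity)
  have e2 : (D * b) ^ 2 * S₃ ≤ (D * b) ^ 2 * (z + a * e + a) :=
    mul_le_mul_of_nonneg_left hthird (by positivity)
  have e3 : (D * b) * (a * s + 2 * a ^ 2 * w) ≤ D * (a * s + 2 * a ^ 2 * w) :=
    mul_le_mul_of_nonneg_right hDb (by positivity)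
  have e4 : (D * b) ^ 2 * (a * e + a) ≤ D ^ 2 * (a * e + a) :=
    mul_le_mul_of_nonneg_right (pow_le_pow_left₀ hDb0 hDb 2)
      (add_nonneg (mul_nonneg ha0 hΔv) ha0)
  have e5 : a * s * d ≤ a * s * (C * D) := mul_le_mul_of_nonneg_left hdeg (by positivity)
  have e6 : 4 * r ^ 2 * a * d ^ 2 ≤ 4 * r ^ 2 * a * (C * D) ^ 2 :=
    mul_le_mul_of_nonneg_left (pow_le_pow_left₀ hd0 hdeg 2) (by positivity)
  have e7 : z * b ^ 2 * (d - D) ^ 2 ≤ (d - D) ^ 2 :=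
    mul_le_of_le_one_left (sq_nonneg _) (mul_le_one₀ hz1 (by positivity) (pow_le_one₀ hb0.le hb1))
  linarith

lemma bernoulliExp_sq_dev_le {V₀ : Finset V} (hlin : IsLinearHypergraph f E)
    (hsub : ∀ i ∈ E, f i ⊆ V₀) {r : ℕ} (hr : 1 ≤ r) (hcard : ∀ i ∈ E, #(f i) = r)
    {a D C η N : ℝ} (ha0 : 0 ≤ a) (ha1 : a ≤ 1 / 2) (hD : 0 < D) (hC : 0 ≤ C)
    (hdeg : ∀ v ∈ V₀, (hyperDeg f E v : ℝ) ≤ C * D) (hη : 0 < η) (hN : (#V₀ : ℝ) ≤ N)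
    (hL2 : ∑ v ∈ V₀, ((hyperDeg f E v : ℝ) - D) ^ 2 ≤ η ^ 2 * D ^ 2 * N) :
    bernoulliExp (fun _ => a) E (fun T => ∑ v ∈ avoided f V₀ T,
      ((hyperDeg f (inside f E (avoided f V₀ T)) v : ℝ) -
        D * Real.exp (-(a * D * (r - 1)))) ^ 2) ≤
    D ^ 2 * N * (η ^ 2 + a * D * (2 * C ^ 2 * r + 2 * C * r + 1) * η) +
      D * N * (4 * r ^ 2 * (a * D) * C ^ 2 + C + 4 * (a * D) ^ 2 * C ^ 2 * r + a * D) := by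
  have hN0 : 0 ≤ N := (Nat.cast_nonneg _).trans hN
  have hΔ := sum_abs_dev_le hD hη hN hL2
  have hexp : bernoulliExp (fun _ => a) E (fun T => ∑ v ∈ avoided f V₀ T,
      ((hyperDeg f (inside f E (avoided f V₀ T)) v : ℝ) -
        D * Real.exp (-(a * D * (r - 1)))) ^ 2) =
      ∑ v ∈ V₀, ((∑ i ∈ E with v ∈ f i, ∑ j ∈ E with v ∈ f j,
        (1 - a) ^ #(meeting f E (f i ∪ f j)))
      - 2 * (D * Real.exp (-(a * D * (r - 1)))) *
        (∑ i ∈ E with v ∈ f i, (1 - a) ^ #(meeting f E (f i)))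
      + (D * Real.exp (-(a * D * (r - 1)))) ^ 2 * (1 - a) ^ #(meeting f E {v})) := by
    simp only [sum_sq_avoided_eq, bernoulliExp_sum, bernoulliExp_add, bernoulliExp_sub,
      bernoulliExp_const_mul]
    refine sum_congr rfl fun v hv => ?_
    rw [bernoulliExp_avoided (singleton_subset_iff.2 hv)]
    congr 2
    · refine sum_congr rfl fun i hi => sum_congr rfl fun j hj => ?_
      exact bernoulliExp_avoided (union_subset (hsub i (mem_filter.1 hi).1)
        (hsub j (mem_filter.1 hj).1)) a
    · congr 1
      exact sum_congr rfl fun i hi => bernoulliExp_avoided (hsub i (mem_filter.1 hi).1) a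
  have hs : ∑ v ∈ V₀, ∑ i ∈ E with v ∈ f i, ∑ u ∈ f i, |(hyperDeg f E u : ℝ) - D| ≤
      r * (C * D * (η * D * N)) := by
    rw [sum_sum_mem_eq hsub fun _ i => ∑ u ∈ f i, |(hyperDeg f E u : ℝ) - D|]
    rw [sum_congr rfl fun i hi => by rw [sum_const, nsmul_eq_mul, hcard i hi], ← mul_sum,
      sum_sum_edge_eq hsub fun u => |(hyperDeg f E u : ℝ) - D|]
    refine mul_le_mul_of_nonneg_left ?_ (Nat.cast_nonneg _)
    refine le_trans (sum_le_sum fun v hv =>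
      mul_le_mul_of_nonneg_right (hdeg v hv) (abs_nonneg _)) ?_
    rw [← mul_sum]
    exact mul_le_mul_of_nonneg_left hΔ (by positivity)
  have hw : ∑ v ∈ V₀, ∑ i ∈ E with v ∈ f i, ∑ u ∈ f i, (hyperDeg f E u : ℝ) ≤
      r * (N * (C * D) ^ 2) := by
    rw [sum_sum_mem_eq hsub fun _ i => ∑ u ∈ f i, (hyperDeg f E u : ℝ)]
    rw [sum_congr rfl fun i hi => by rw [sum_const, nsmul_eq_mul, hcard i hi], ← mul_sum,
      sum_sum_edge_eq hsub fun u => (hyperDeg f E u : ℝ)]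
    refine mul_le_mul_of_nonneg_left ?_ (Nat.cast_nonneg _)
    refine le_trans (sum_le_card_nsmul V₀ _ ((C * D) ^ 2) fun v hv => ?_) ?_
    · rw [← sq]
      exact pow_le_pow_left₀ (Nat.cast_nonneg _) (hdeg v hv) 2
    · rw [nsmul_eq_mul]
      exact mul_le_mul_of_nonneg_right hN (by positivity)
  rw [hexp]
  refine (sum_le_sum fun v hv =>
    avoid_second_moment_at_le hlin hr hcard ha0 ha1 hD v (hdeg v hv)).trans ?_
  simp only [sum_add_distrib, ← mul_sum, sum_const, nsmul_eq_mul]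
  have g1 := mul_le_mul_of_nonneg_left hs
    (show 0 ≤ 2 * a * (C * D) + 2 * D * a by positivity)
  have g2 := mul_le_mul_of_nonneg_left hw (show 0 ≤ 4 * D * a ^ 2 by positivity)
  have g3 := mul_le_mul_of_nonneg_left hΔ (show 0 ≤ D ^ 2 * a by positivity)
  have g4 := mul_le_mul_of_nonneg_right hN
    (show 0 ≤ 4 * r ^ 2 * a * (C * D) ^ 2 + C * D + D ^ 2 * a by positivity)
  linarith

lemma bernoulliExp_card_avoided_le {V₀ : Finset V} (hlin : IsLinearHypergraph f E)
    {a D η N : ℝ} (ha0 : 0 ≤ a) (ha1 : a ≤ 1 / 2) (hD : 0 < D) (hη : 0 < η)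
    (hN : (#V₀ : ℝ) ≤ N)
    (hL2 : ∑ v ∈ V₀, ((hyperDeg f E v : ℝ) - D) ^ 2 ≤ η ^ 2 * D ^ 2 * N) :
    bernoulliExp (fun _ => a) E (fun T => (#(avoided f V₀ T) : ℝ)) ≤
      Real.exp (-(a * D)) * #V₀ + a * D * η * N + a * N := by
  have h1 : ∀ T, (#(avoided f V₀ T) : ℝ) =
      ∑ v ∈ V₀, if {v} ⊆ avoided f V₀ T then (1 : ℝ) else 0 := by
    intro T
    simp only [singleton_subset_iff]
    rw [sum_boole, filter_mem_eq_inter, inter_eq_right.2 (show avoided f V₀ T ⊆ V₀ from filter_subset _ _)]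
  simp only [h1, bernoulliExp_sum]
  have hΔ := mul_le_mul_of_nonneg_left (sum_abs_dev_le hD hη hN hL2) ha0
  have h2 : ∀ v ∈ V₀, bernoulliExp (fun _ => a) E
      (fun T => if {v} ⊆ avoided f V₀ T then (1 : ℝ) else 0) ≤
      Real.exp (-(a * D)) + a * |(hyperDeg f E v : ℝ) - D| + a := by
    intro v hv
    rw [bernoulliExp_avoided (singleton_subset_iff.2 hv)]
    have := one_sub_pow_meeting_le hlin (D := D) ha0 (by linarith) {v}
    simp only [card_singleton, Nat.cast_one, mul_one, sum_singleton, one_pow] at this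
    linarith
  refine (sum_le_sum h2).trans ?_
  simp only [sum_add_distrib, ← mul_sum, sum_const, nsmul_eq_mul]
  have := mul_le_mul_of_nonneg_right hN ha0
  linarith

/-- The members of `T` whose edge is disjoint from all other edges of `T`. -/
def isolated (f : ι → Finset V) (T : Finset ι) : Finset ι :=
  {i ∈ T | ∀ j ∈ T, j ≠ i → Disjoint (f i) (f j)}

lemma bernoulliExp_waste_le {V₀ : Finset V} (hsub : ∀ i ∈ E, f i ⊆ V₀) {r : ℕ}
    (hcard : ∀ i ∈ E, #(f i) = r) {a D C N : ℝ} (ha0 : 0 ≤ a) (ha1 : a ≤ 1)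
    (hdeg : ∀ v ∈ V₀, (hyperDeg f E v : ℝ) ≤ C * D) (hN : (#V₀ : ℝ) ≤ N) :
    bernoulliExp (fun _ => a) E (fun T =>
      (#((V₀ \ avoided f V₀ T) \ (isolated f T).biUnion f) : ℝ)) ≤
      r * (a * D) ^ 2 * C ^ 2 * N := by
  set P : Finset (ι × ι) := {x ∈ E ×ˢ E | x.1 ≠ x.2 ∧ ¬ Disjoint (f x.1) (f x.2)} with hP
  have hwaste : ∀ T ⊆ E, (#((V₀ \ avoided f V₀ T) \ (isolated f T).biUnion f) : ℝ) ≤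
      r * ∑ x ∈ P, if {x.1, x.2} ⊆ T ∧ Disjoint (∅ : Finset ι) T then (1 : ℝ) else 0 := by
    intro T hT
    have h1 : (V₀ \ avoided f V₀ T) \ (isolated f T).biUnion f ⊆ (T \ isolated f T).biUnion f := by
      intro v hv
      simp only [mem_sdiff, avoided, mem_filter, mem_biUnion, not_and, not_forall, not_not,
        not_exists] at hv ⊢
      obtain ⟨i, hi, hvi⟩ := hv.1.2 hv.1.1
      exact ⟨i, ⟨hi, fun h => hv.2 i h hvi⟩, hvi⟩
    have h2 : #((T \ isolated f T).biUnion f) ≤ #(T \ isolated f T) * r :=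
      card_biUnion_le_card_mul _ _ _ fun i hi => (hcard i (hT (mem_sdiff.1 hi).1)).le
    have h3 : #(T \ isolated f T) ≤
        #(P.filter fun x => {x.1, x.2} ⊆ T ∧ Disjoint (∅ : Finset ι) T) := by
      refine card_le_card_of_surjOn Prod.fst fun i hi => ?_
      rw [mem_coe, mem_sdiff, isolated, mem_filter] at hi
      obtain ⟨hiT, h⟩ := hi
      simp only [hiT, true_and, not_forall] at h
      obtain ⟨j, hj, hji, hd⟩ := h
      refine ⟨(i, j), ?_, rfl⟩
      simp only [hP, coe_filter, mem_filter, mem_product, Set.mem_ofPred_eq]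
      exact ⟨⟨⟨hT hiT, hT hj⟩, hji.symm, hd⟩, by
        simp [insert_subset_iff, hiT, hj]⟩
    rw [sum_boole]
    calc (#((V₀ \ avoided f V₀ T) \ (isolated f T).biUnion f) : ℝ)
        ≤ (#(T \ isolated f T) * r : ℕ) := by exact_mod_cast (card_le_card h1).trans h2
      _ ≤ _ := by
        push_cast
        rw [mul_comm]
        exact mul_le_mul_of_nonneg_left (by exact_mod_cast h3) (Nat.cast_nonneg _)
  refine (bernoulliExp_mono (fun _ _ => ha0) (fun _ _ => ha1) hwaste).trans ?_
  rw [bernoulliExp_const_mul, bernoulliExp_sum]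
  have hprob : ∀ x ∈ P, bernoulliExp (fun _ => a) E
      (fun T => if {x.1, x.2} ⊆ T ∧ Disjoint (∅ : Finset ι) T then (1 : ℝ) else 0) = a ^ 2 := by
    intro x hx
    simp only [hP, mem_filter, mem_product] at hx
    rw [bernoulliExp_cylinder (by simp [insert_subset_iff, hx.1]) (empty_subset _)
      (disjoint_empty_right _)]
    simp [prod_pair hx.2.1, sq]
  rw [sum_congr rfl hprob, sum_const, nsmul_eq_mul]
  have hPcard : (#P : ℝ) ≤ N * (C * D) ^ 2 := by
    have h1 : #P ≤ ∑ v ∈ V₀, hyperDeg f E v * hyperDeg f E v := by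
      have : P ⊆ V₀.biUnion fun v => (E.filter fun i => v ∈ f i) ×ˢ (E.filter fun i => v ∈ f i) := by
        intro x hx
        simp only [hP, mem_filter, mem_product] at hx
        obtain ⟨v, hv1, hv2⟩ := not_disjoint_iff.1 hx.2.2
        simp only [mem_biUnion, mem_product, mem_filter]
        exact ⟨v, hsub _ hx.1.1 hv1, ⟨hx.1.1, hv1⟩, hx.1.2, hv2⟩
      refine (card_le_card this).trans (card_biUnion_le.trans (le_of_eq ?_))
      simp [hyperDeg]
    have h2 : (#P : ℝ) ≤ ∑ v ∈ V₀, (hyperDeg f E v : ℝ) * hyperDeg f E v := by exact_mod_cast h1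
    refine h2.trans ((sum_le_card_nsmul V₀ _ ((C * D) ^ 2) fun v hv => ?_).trans ?_)
    · rw [← sq]
      exact pow_le_pow_left₀ (Nat.cast_nonneg _) (hdeg v hv) 2
    · rw [nsmul_eq_mul]
      exact mul_le_mul_of_nonneg_right hN (by positivity)
  have := mul_le_mul_of_nonneg_left (mul_le_mul_of_nonneg_right hPcard (sq_nonneg a))
    (Nat.cast_nonneg (α := ℝ) r)
  linarith

end Nibble

section NibbleIteration

variable {ι V : Type*} [DecidableEq ι] [DecidableEq V]
variable {f : ι → Finset V} {E : Finset ι}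

lemma exists_nibble_step {V₀ : Finset V} (hlin : IsLinearHypergraph f E)
    (hsub : ∀ i ∈ E, f i ⊆ V₀) {r : ℕ} (hr : 1 ≤ r) (hcard : ∀ i ∈ E, #(f i) = r)
    {c D C η N : ℝ} (hc0 : 0 ≤ c) (hcD : 2 * c ≤ D) (hD : 0 < D) (hC : 0 ≤ C)
    (hdeg : ∀ v ∈ V₀, (hyperDeg f E v : ℝ) ≤ C * D) (hη : 0 < η) (hN : (#V₀ : ℝ) ≤ N)
    (hL2 : ∑ v ∈ V₀, ((hyperDeg f E v : ℝ) - D) ^ 2 ≤ η ^ 2 * D ^ 2 * N)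
    {κ L : ℝ} (hκ : 0 ≤ κ) (hL : 0 ≤ L) :
    ∃ T ⊆ E, κ * #(avoided f V₀ T) + #((V₀ \ avoided f V₀ T) \ (isolated f T).biUnion f) +
      L / D ^ 2 * ∑ v ∈ avoided f V₀ T,
        ((hyperDeg f (inside f E (avoided f V₀ T)) v : ℝ) - D * Real.exp (-(c * (r - 1)))) ^ 2 ≤
      κ * (Real.exp (-c) * #V₀ + c * η * N + c / D * N) + r * c ^ 2 * C ^ 2 * N +
      L * N * (η ^ 2 + c * (2 * C ^ 2 * r + 2 * C * r + 1) * η) +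
      L * N / D * (4 * r ^ 2 * c * C ^ 2 + C + 4 * c ^ 2 * C ^ 2 * r + c) := by
  have ha0 : 0 ≤ c / D := by positivity
  have ha1 : c / D ≤ 1 / 2 := by rw [div_le_iff₀ hD]; linarith
  have haD : c / D * D = c := div_mul_cancel₀ _ hD.ne'
  obtain ⟨T, hT, h⟩ := exists_le_bernoulliExp (p := fun _ : ι => c / D) (s := E)
    (fun _ _ => ha0) (fun _ _ => by linarith) (fun T =>
      κ * #(avoided f V₀ T) + #((V₀ \ avoided f V₀ T) \ (isolated f T).biUnion f) +
      L / D ^ 2 * ∑ v ∈ avoided f V₀ T,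
        ((hyperDeg f (inside f E (avoided f V₀ T)) v : ℝ) - D * Real.exp (-(c * (r - 1)))) ^ 2)
  refine ⟨T, hT, h.trans ?_⟩
  rw [bernoulliExp_add, bernoulliExp_add, bernoulliExp_const_mul, bernoulliExp_const_mul]
  have h1 := bernoulliExp_card_avoided_le hlin ha0 ha1 hD hη hN hL2
  have h2 := bernoulliExp_waste_le hsub hcard ha0 (by linarith) hdeg hN
  have h3 := bernoulliExp_sq_dev_le hlin hsub hr hcard ha0 ha1 hD hC hdeg hη hN hL2
  rw [haD] at h1 h2 h3
  have h4 := mul_le_mul_of_nonneg_left h1 hκ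
  have h5 := mul_le_mul_of_nonneg_left h3 (show 0 ≤ L / D ^ 2 by positivity)
  have h6 : L / D ^ 2 * (D ^ 2 * N * (η ^ 2 + c * (2 * C ^ 2 * r + 2 * C * r + 1) * η) +
      D * N * (4 * r ^ 2 * c * C ^ 2 + C + 4 * c ^ 2 * C ^ 2 * r + c)) =
      L * N * (η ^ 2 + c * (2 * C ^ 2 * r + 2 * C * r + 1) * η) +
      L * N / D * (4 * r ^ 2 * c * C ^ 2 + C + 4 * c ^ 2 * C ^ 2 * r + c) := by
    field_simp
  linarith

omit [DecidableEq ι] in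
lemma disjoint_of_mem_avoided {V₀ : Finset V} {T : Finset ι} {i j : ι} (hi : i ∈ T)
    (hj : f j ⊆ avoided f V₀ T) : Disjoint (f i) (f j) := by
  rw [disjoint_right]
  intro v hv
  exact (mem_filter.1 (hj hv)).2 i hi

end NibbleIteration

set_option maxHeartbeats 2000000 in
/-- Iterating the nibble `T` times in a linear, nearly regular `r`-uniform hypergraph. -/
lemma exists_matching_nibble {r : ℕ} (hr : 1 ≤ r) {c C b : ℝ} (hc : 0 < c) (hC : 0 ≤ C)
    (hb : r * c ^ 2 * C ^ 2 < b) (T : ℕ) :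
    ∃ η > 0, ∃ Dm > 0, ∀ {ι V : Type} [DecidableEq ι] [DecidableEq V] (f : ι → Finset V)
      (E : Finset ι) (V₀ : Finset V) (D N : ℝ), IsLinearHypergraph f E → (∀ i ∈ E, f i ⊆ V₀) →
      (∀ i ∈ E, #(f i) = r) →
      (∀ v ∈ V₀, (hyperDeg f E v : ℝ) ≤ C * Real.exp (-(c * (r - 1) * T)) * D) →
      Dm ≤ D → (#V₀ : ℝ) ≤ N →
      ∑ v ∈ V₀, ((hyperDeg f E v : ℝ) - D) ^ 2 ≤ η ^ 2 * D ^ 2 * N →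
      ∃ M ⊆ E, (∀ i ∈ M, ∀ j ∈ M, i ≠ j → Disjoint (f i) (f j)) ∧
        (#(V₀ \ M.biUnion f) : ℝ) ≤ Real.exp (-(c * T)) * #V₀ + T * b * N := by
  induction T with
  | zero =>
    refine ⟨1, one_pos, 1, one_pos, fun f E V₀ D N _ _ _ _ _ _ _ => ⟨∅, empty_subset _, ?_, ?_⟩⟩
    · simp
    · simp
  | succ T ih =>
    obtain ⟨η', hη', Dm', hDm', ih⟩ := ih
    have hr1 : (0 : ℝ) ≤ r - 1 := by
      have : (1 : ℝ) ≤ r := by exact_mod_cast hr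
      linarith
    have hb0 : 0 < b := lt_of_le_of_lt (by positivity) hb
    set ρ : ℝ := Real.exp (-(c * (r - 1))) with hρ
    have hρ0 : 0 < ρ := Real.exp_pos _
    set L : ℝ := (1 + b) / (η' ^ 2 * ρ ^ 2) with hL
    have hL0 : 0 < L := by positivity
    set κ : ℝ := Real.exp (-(c * T)) with hκ
    have hκ0 : 0 < κ := Real.exp_pos _
    have hκ1 : κ ≤ 1 := Real.exp_le_one_iff.2 (by
      have : 0 ≤ c * T := by positivity
      linarith)
    set K₁ : ℝ := 2 * C ^ 2 * r + 2 * C * r + 1 with hK₁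
    have hK₁0 : 0 < K₁ := by positivity
    set K₂ : ℝ := 4 * r ^ 2 * c * C ^ 2 + C + 4 * c ^ 2 * C ^ 2 * r + c with hK₂
    have hK₂0 : 0 < K₂ := by positivity
    set γ : ℝ := b - r * c ^ 2 * C ^ 2 with hγ
    have hγ0 : 0 < γ := sub_pos.2 hb
    set Q : ℝ := c + L * (1 + c * K₁) with hQ
    have hQ0 : 0 < Q := by positivity
    refine ⟨min 1 (γ / (2 * Q)), by positivity, max (Dm' / ρ) (max (2 * c) (2 * (c + L * K₂) / γ)),
      by positivity, ?_⟩
    intro ι V _ _ f E V₀ D N hlin hsub hcard hdeg hDmD hN hL2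
    obtain ⟨hD1, hD23⟩ := max_le_iff.1 hDmD
    obtain ⟨hD2, hD3⟩ := max_le_iff.1 hD23
    set η : ℝ := min 1 (γ / (2 * Q)) with hη
    have hη0 : 0 < η := by positivity
    have hη1 : η ≤ 1 := min_le_left _ _
    have hηQ : η * Q ≤ γ / 2 := by
      have : η ≤ γ / (2 * Q) := min_le_right _ _
      rw [le_div_iff₀ (by positivity)] at this
      linarith
    have hD : 0 < D := by linarith
    have hN0 : 0 ≤ N := (Nat.cast_nonneg _).trans hN
    have hexp1 : Real.exp (-(c * (r - 1) * (T + 1 : ℕ))) =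
        Real.exp (-(c * (r - 1) * T)) * ρ := by
      rw [hρ, ← Real.exp_add]; congr 1; push_cast; ring
    have hexp2 : Real.exp (-(c * (T + 1 : ℕ))) = κ * Real.exp (-c) := by
      rw [hκ, ← Real.exp_add]; congr 1; push_cast; ring
    have hdeg' : ∀ v ∈ V₀, (hyperDeg f E v : ℝ) ≤ C * D := fun v hv => by
      refine (hdeg v hv).trans (mul_le_mul_of_nonneg_right
        (mul_le_of_le_one_right hC (Real.exp_le_one_iff.2 ?_)) hD.le)
      have : 0 ≤ c * (r - 1) * (T + 1 : ℕ) := by positivity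
      linarith
    obtain ⟨S, hS, hstep⟩ := exists_nibble_step hlin hsub hr hcard hc.le hD2 hD hC hdeg' hη0 hN
      hL2 hκ0.le hL0.le
    rw [← hρ, ← hK₁, ← hK₂] at hstep
    have hbound : κ * (Real.exp (-c) * #V₀ + c * η * N + c / D * N) + r * c ^ 2 * C ^ 2 * N +
        L * N * (η ^ 2 + c * K₁ * η) + L * N / D * K₂ ≤ κ * Real.exp (-c) * #V₀ + b * N := by
      have g1 : κ * (c * η * N) ≤ c * η * N := mul_le_of_le_one_left (by positivity) hκ1
      have g2 : κ * (c / D * N) ≤ c / D * N := mul_le_of_le_one_left (by positivity) hκ1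
      have g3 : L * N * η ^ 2 ≤ L * N * η := mul_le_mul_of_nonneg_left
        (by nlinarith) (by positivity)
      have g4 : (c + L * K₂) / D ≤ γ / 2 := by
        rw [div_le_iff₀ hγ0] at hD3
        rw [div_le_iff₀ hD]
        linarith
      have g5 := mul_le_mul_of_nonneg_right g4 hN0
      have g6 := mul_le_mul_of_nonneg_right hηQ hN0
      have g7 : (c + L * K₂) / D * N = c / D * N + L * N / D * K₂ := by field_simp
      rw [hQ] at g6
      rw [hγ] at g5 g6
      linarith
    replace hstep := hstep.trans hbound
    set V' := avoided f V₀ S with hV'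
    set E' := inside f E V' with hE'
    have hV'sub : V' ⊆ V₀ := filter_subset _ _
    have hE'sub : E' ⊆ E := filter_subset _ _
    have hL2' : ∑ v ∈ V', ((hyperDeg f E' v : ℝ) - D * ρ) ^ 2 ≤ η' ^ 2 * (D * ρ) ^ 2 * N := by
      have g1 : κ * Real.exp (-c) * #V₀ ≤ N := by
        refine le_trans (mul_le_of_le_one_left (Nat.cast_nonneg _) ?_) hN
        exact mul_le_one₀ hκ1 (Real.exp_pos _).le (Real.exp_le_one_iff.2 (by linarith))
      have g2 : 0 ≤ κ * #V' := by positivity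
      have g3 : (0 : ℝ) ≤ #((V₀ \ V') \ (isolated f S).biUnion f) := Nat.cast_nonneg _
      have g4 : L / D ^ 2 * ∑ v ∈ V', ((hyperDeg f E' v : ℝ) - D * ρ) ^ 2 ≤ (1 + b) * N := by
        linarith
      have g5 : L / D ^ 2 * (η' ^ 2 * (D * ρ) ^ 2 * N) = (1 + b) * N := by
        rw [hL]; field_simp
      rw [← g5] at g4
      exact le_of_mul_le_mul_left g4 (by positivity)
    obtain ⟨M, hM, hMd, hMc⟩ := ih f E' V' (D * ρ) N
      (fun i hi j hj => hlin i (hE'sub hi) j (hE'sub hj)) (fun i hi => (mem_filter.1 hi).2)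
      (fun i hi => hcard i (hE'sub hi))
      (fun v hv => by
        have g1 : (hyperDeg f E' v : ℝ) ≤ hyperDeg f E v := by
          exact_mod_cast hyperDeg_mono hE'sub v
        have g2 := hdeg v (hV'sub hv)
        rw [hexp1] at g2
        linarith)
      (by rwa [div_le_iff₀ hρ0] at hD1)
      (le_trans (by exact_mod_cast card_le_card hV'sub) hN) hL2'
    have hiso : isolated f S ⊆ S := filter_subset _ _
    refine ⟨M ∪ isolated f S, union_subset (hM.trans hE'sub) (hiso.trans hS), ?_, ?_⟩
    · have hcross : ∀ i ∈ M, ∀ j ∈ isolated f S, Disjoint (f i) (f j) := fun i hi j hj =>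
        (disjoint_of_mem_avoided (hiso hj) (mem_filter.1 (hM hi)).2).symm
      intro i hi j hj hij
      rcases mem_union.1 hi with hi | hi <;> rcases mem_union.1 hj with hj | hj
      · exact hMd i hi j hj hij
      · exact hcross i hi j hj
      · exact (hcross j hj i hi).symm
      · exact (mem_filter.1 hi).2 j (hiso hj) hij.symm
    · have hsub' : V₀ \ (M ∪ isolated f S).biUnion f ⊆
          (V' \ M.biUnion f) ∪ ((V₀ \ V') \ (isolated f S).biUnion f) := by
        intro v hv
        rw [union_biUnion] at hv
        simp only [mem_sdiff, mem_union, not_or] at hv ⊢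
        tauto
      have g1 : (#(V₀ \ (M ∪ isolated f S).biUnion f) : ℝ) ≤
          #(V' \ M.biUnion f) + #((V₀ \ V') \ (isolated f S).biUnion f) := by
        exact_mod_cast (card_le_card hsub').trans (card_union_le _ _)
      have g2 : 0 ≤ L / D ^ 2 * ∑ v ∈ V', ((hyperDeg f E' v : ℝ) - D * ρ) ^ 2 :=
        mul_nonneg (by positivity) (sum_nonneg fun _ _ => sq_nonneg _)
      rw [hexp2]
      push_cast
      linarith

/-- A linear `r`-uniform hypergraph that is nearly `D`-regular in `L²` has a nearly perfect
matching. -/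
lemma exists_nearly_perfect_matching {r : ℕ} (hr : 1 ≤ r) {δ : ℝ} (hδ : 0 < δ) :
    ∃ η > 0, ∃ Dm > 0, ∀ {ι V : Type} [DecidableEq ι] [DecidableEq V] (f : ι → Finset V)
      (E : Finset ι) (V₀ : Finset V) (D N : ℝ), IsLinearHypergraph f E → (∀ i ∈ E, f i ⊆ V₀) →
      (∀ i ∈ E, #(f i) = r) → (∀ v ∈ V₀, (hyperDeg f E v : ℝ) ≤ 2 * D) →
      Dm ≤ D → (#V₀ : ℝ) ≤ N →
      ∑ v ∈ V₀, ((hyperDeg f E v : ℝ) - D) ^ 2 ≤ η * D ^ 2 * N →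
      ∃ M ⊆ E, (∀ i ∈ M, ∀ j ∈ M, i ≠ j → Disjoint (f i) (f j)) ∧
        (#V₀ : ℝ) - r * #M ≤ δ * N := by
  have hr1 : (0 : ℝ) ≤ r - 1 := by
    have : (1 : ℝ) ≤ r := by exact_mod_cast hr
    linarith
  obtain ⟨τ₀, hτ₀⟩ := exists_nat_gt (Real.log (2 / δ))
  set τ : ℝ := τ₀ + 1 with hτ
  have hτ1 : 0 < τ := by positivity
  have hexpτ : Real.exp (-τ) ≤ δ / 2 := by
    rw [Real.exp_neg, inv_le_comm₀ (Real.exp_pos _) (by positivity), inv_div]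
    rw [← Real.log_le_iff_le_exp (by positivity)]
    linarith
  set C : ℝ := 2 * Real.exp (τ * (r - 1)) with hC
  have hC0 : 0 < C := by positivity
  obtain ⟨T₀, hT₀⟩ := exists_nat_gt (2 * (2 * r * C ^ 2 * τ ^ 2) / δ)
  set T : ℕ := T₀ + 1 with hT
  have hT1 : (0 : ℝ) < T := by positivity
  have hr0 : (0 : ℝ) < r := by positivity
  set c : ℝ := τ / T with hc
  have hc0 : 0 < c := by positivity
  have hcT : c * T = τ := div_mul_cancel₀ _ hT1.ne'
  set b : ℝ := 2 * (r * c ^ 2 * C ^ 2) with hb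
  have hb0 : r * c ^ 2 * C ^ 2 < b := by
    have : 0 < r * c ^ 2 * C ^ 2 := by positivity
    linarith
  have hTb : T * b ≤ δ / 2 := by
    have h1 : T * b = 2 * r * C ^ 2 * τ ^ 2 / T := by
      rw [hb, hc]; field_simp
    have h2 : (T₀ : ℝ) ≤ T := by rw [hT]; push_cast; linarith
    rw [h1, div_le_iff₀ hT1]
    rw [div_lt_iff₀ hδ] at hT₀
    nlinarith
  obtain ⟨η, hη, Dm, hDm, h⟩ := exists_matching_nibble hr hc0 hC0.le hb0 T
  refine ⟨η ^ 2, by positivity, Dm, hDm, ?_⟩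
  intro ι V _ _ f E V₀ D N hlin hsub hcard hdeg hD hN hL2
  have hN0 : 0 ≤ N := (Nat.cast_nonneg _).trans hN
  have hCe : C * Real.exp (-(c * (r - 1) * T)) = 2 := by
    have : c * (r - 1) * T = τ * (r - 1) := by rw [← hcT]; ring
    rw [this, hC, mul_assoc, ← Real.exp_add, add_neg_cancel, Real.exp_zero, mul_one]
  obtain ⟨M, hM, hMd, hMc⟩ := h f E V₀ D N hlin hsub hcard (by rwa [hCe]) hD hN hL2
  refine ⟨M, hM, hMd, ?_⟩
  have h1 : #(M.biUnion f) ≤ #M * r :=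
    card_biUnion_le_card_mul _ _ _ fun i hi => (hcard i (hM hi)).le
  have h2 : #V₀ ≤ #(V₀ \ M.biUnion f) + #(M.biUnion f) := by
    refine (card_le_card fun v hv => ?_).trans (card_union_le _ _)
    simp only [mem_union, mem_sdiff]
    tauto
  have h3 : (#V₀ : ℝ) ≤ #(V₀ \ M.biUnion f) + #M * r := by exact_mod_cast h2.trans (by lia)
  rw [hcT] at hMc
  have h4 : Real.exp (-τ) * #V₀ ≤ δ / 2 * N :=
    mul_le_mul hexpτ hN (Nat.cast_nonneg _) (by positivity)
  have h5 := mul_le_mul_of_nonneg_right hTb hN0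
  linarith

section Prune

variable {ι V : Type*} [DecidableEq ι] [DecidableEq V]
variable {f : ι → Finset V} {E E₁ : Finset ι}

/-- The edges of `E₁` all of whose vertices have degree at most `2 * D` in `E`. -/
noncomputable def prune (f : ι → Finset V) (E E₁ : Finset ι) (D : ℝ) : Finset ι :=
  open Classical in {i ∈ E₁ | ∀ v ∈ f i, (hyperDeg f E v : ℝ) ≤ 2 * D}

omit [DecidableEq ι] in
lemma prune_subset (D : ℝ) : prune f E E₁ D ⊆ E₁ := filter_subset _ _

omit [DecidableEq ι] in
lemma hyperDeg_prune_eq_zero {D : ℝ} {v : V} (hv : 2 * D < hyperDeg f E v) :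
    hyperDeg f (prune f E E₁ D) v = 0 := by
  rw [hyperDeg, card_eq_zero, filter_eq_empty_iff]
  intro i hi hvi
  exact hv.not_ge ((mem_filter.1 hi).2 v hvi)

omit [DecidableEq ι] in
lemma hyperDeg_prune_le (hE : E₁ ⊆ E) {D : ℝ} (hD : 0 ≤ D) (v : V) :
    (hyperDeg f (prune f E E₁ D) v : ℝ) ≤ 2 * D := by
  rcases le_or_gt (hyperDeg f E v : ℝ) (2 * D) with hv | hv
  · exact le_trans (by exact_mod_cast hyperDeg_mono ((prune_subset D).trans hE) v) hv
  · rw [hyperDeg_prune_eq_zero hv]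
    push_cast
    linarith

lemma sum_sq_dev_prune_le {V₀ : Finset V} (hE : E₁ ⊆ E) (hsub : ∀ i ∈ E, f i ⊆ V₀) {r : ℕ}
    (hcard : ∀ i ∈ E, #(f i) = r) {D X Y : ℝ} (hD : 0 < D)
    (hX : ∑ v ∈ V₀, ((hyperDeg f E v : ℝ) - D) ^ 2 ≤ X) (hY : (#(E \ E₁) : ℝ) ≤ Y) :
    ∑ v ∈ V₀, ((hyperDeg f (prune f E E₁ D) v : ℝ) - D) ^ 2 ≤
      (2 + 8 * r) * X + 4 * D * r * Y := by
  classical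
  set P := prune f E E₁ D with hP
  have hPE : P ⊆ E := (prune_subset D).trans hE
  have hpt : ∀ v ∈ V₀, ((hyperDeg f P v : ℝ) - D) ^ 2 ≤ 2 * ((hyperDeg f E v : ℝ) - D) ^ 2 +
      4 * D * ((hyperDeg f E v : ℝ) - hyperDeg f P v) := by
    intro v _
    have h0 : (0 : ℝ) ≤ hyperDeg f P v := Nat.cast_nonneg _
    have h1 : (hyperDeg f P v : ℝ) ≤ hyperDeg f E v := by exact_mod_cast hyperDeg_mono hPE v
    rcases le_or_gt (hyperDeg f E v : ℝ) (2 * D) with hv | hv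
    · nlinarith [sq_nonneg ((hyperDeg f E v : ℝ) - D + (hyperDeg f E v - hyperDeg f P v)),
        mul_nonneg (sub_nonneg.2 h1) (sub_nonneg.2 hv), mul_nonneg (sub_nonneg.2 h1) h0]
    · rw [hP, hyperDeg_prune_eq_zero hv]
      push_cast
      nlinarith
  have hdiff : ∑ v ∈ V₀, ((hyperDeg f E v : ℝ) - hyperDeg f P v) = r * #(E \ P) := by
    have hdeg : ∀ F ⊆ E, ∑ v ∈ V₀, (hyperDeg f F v : ℝ) = r * #F := by
      intro F hF
      have h := sum_sum_mem_eq (fun i hi => hsub i (hF hi)) (fun _ _ => (1 : ℝ)) (f := f) (E := F)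
      simp only [sum_const, nsmul_eq_mul, mul_one] at h
      rw [show ∑ v ∈ V₀, (hyperDeg f F v : ℝ) = ∑ i ∈ F, (#(f i) : ℝ) from h,
        sum_congr rfl fun i hi => by rw [hcard i (hF hi)], sum_const, nsmul_eq_mul, mul_comm]
    rw [sum_sub_distrib, hdeg E subset_rfl, hdeg P hPE, cast_card_sdiff hPE]
    ring
  have hdel : (#(E \ P) : ℝ) ≤ Y + 2 / D * X := by
    have hsub' : E \ P ⊆ (E \ E₁) ∪ ({v ∈ V₀ | 2 * D < hyperDeg f E v}).biUnion
        fun v => {i ∈ E | v ∈ f i} := by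
      intro i hi
      rw [mem_sdiff] at hi
      by_cases h1 : i ∈ E₁
      · have : ¬ ∀ v ∈ f i, (hyperDeg f E v : ℝ) ≤ 2 * D := fun h =>
          hi.2 (mem_filter.2 ⟨h1, h⟩)
        push Not at this
        obtain ⟨v, hv, hv2⟩ := this
        exact mem_union_right _ (mem_biUnion.2 ⟨v, mem_filter.2 ⟨hsub i hi.1 hv, hv2⟩,
          mem_filter.2 ⟨hi.1, hv⟩⟩)
      · exact mem_union_left _ (mem_sdiff.2 ⟨hi.1, h1⟩)
    have h1 : (#(E \ P) : ℝ) ≤ #(E \ E₁) +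
        ∑ v ∈ V₀ with 2 * D < hyperDeg f E v, (hyperDeg f E v : ℝ) := by
      exact_mod_cast (card_le_card hsub').trans ((card_union_le _ _).trans
        (Nat.add_le_add_left card_biUnion_le _))
    have h2 : ∑ v ∈ V₀ with 2 * D < hyperDeg f E v, (hyperDeg f E v : ℝ) ≤
        ∑ v ∈ V₀ with 2 * D < hyperDeg f E v, 2 / D * ((hyperDeg f E v : ℝ) - D) ^ 2 := by
      refine sum_le_sum fun v hv => ?_
      have hv2 := (mem_filter.1 hv).2
      rw [div_mul_eq_mul_div, le_div_iff₀ hD]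
      nlinarith
    have h3 : ∑ v ∈ V₀ with 2 * D < hyperDeg f E v, 2 / D * ((hyperDeg f E v : ℝ) - D) ^ 2 ≤
        ∑ v ∈ V₀, 2 / D * ((hyperDeg f E v : ℝ) - D) ^ 2 :=
      sum_le_sum_of_subset_of_nonneg (filter_subset _ _) fun v _ _ => by positivity
    replace h3 := h2.trans h3
    rw [← mul_sum] at h3
    have h4 := mul_le_mul_of_nonneg_left hX (show 0 ≤ 2 / D by positivity)
    linarith
  refine (sum_le_sum hpt).trans ?_
  rw [sum_add_distrib, ← mul_sum, ← mul_sum, hdiff]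
  have h1 := mul_le_mul_of_nonneg_left hdel (show 0 ≤ 4 * D * r by positivity)
  have h2 : 4 * D * r * (Y + 2 / D * X) = 4 * D * r * Y + 8 * r * X := by field_simp; ring
  linarith

end Prune

section Copies

variable {A B : Type*} [DecidableEq B]

/-- The copy of the family `G` under the embedding `φ`. -/
def copy (G : Finset (Finset A)) (φ : A ↪ B) : Finset (Finset B) := G.image fun K => K.map φ

lemma map_mem_copy {G : Finset (Finset A)} {φ : A ↪ B} {K : Finset A} :
    K.map φ ∈ copy G φ ↔ K ∈ G := by
  rw [copy, mem_image]
  exact ⟨fun ⟨K', h, h'⟩ => map_injective φ h' ▸ h, fun h => ⟨K, h, rfl⟩⟩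

lemma card_copy (G : Finset (Finset A)) (φ : A ↪ B) : #(copy G φ) = #G :=
  card_image_of_injective _ (map_injective φ)

variable [Fintype A]

/-- The union of the ranges of the embeddings in `Ψ`. -/
def spanned (Ψ : Finset (A ↪ B)) : Finset B := Ψ.biUnion fun φ => univ.map φ

variable [Fintype B]

/-- The `J`-sets of embeddings spanning too few vertices. -/
noncomputable def crowded (A B : Type*) [Fintype A] [Fintype B] [DecidableEq B] (k J : ℕ) :
    Finset (Finset (A ↪ B)) :=
  {Ψ ∈ powersetCard J univ | #(spanned Ψ) < J * (Fintype.card A - k) + k}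

lemma card_embedding_into_le (W : Finset B) :
    #{φ : A ↪ B | univ.map φ ⊆ W} ≤ #W ^ Fintype.card A := by
  classical
  have h : #{φ : A ↪ B | univ.map φ ⊆ W} ≤ #(univ : Finset (A → W)) := by
    have hmem : ∀ φ : {φ // φ ∈ ({φ : A ↪ B | univ.map φ ⊆ W} : Finset (A ↪ B))}, ∀ a : A,
        φ.1 a ∈ W := fun φ a => (mem_filter.1 φ.2).2 (mem_map_of_mem _ (mem_univ a))
    rw [← card_attach]
    refine card_le_card_of_injOn (fun φ a => ⟨φ.1 a, hmem φ a⟩) (fun _ _ => mem_coe.2 (mem_univ _)) ?_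
    intro φ _ ψ _ h
    ext a
    exact congrArg Subtype.val (congrFun h a)
  simpa using h

lemma card_crowded_le {k J : ℕ} (hk : 1 ≤ k)
    (hB : J * (Fintype.card A - k) + k ≤ Fintype.card B + 1) :
    #(crowded A B k J) ≤ Fintype.card B ^ (J * (Fintype.card A - k) + k - 1) *
      2 ^ ((J * (Fintype.card A - k) + k - 1) ^ Fintype.card A) := by
  set m := J * (Fintype.card A - k) + k - 1 with hm
  have hsub : crowded A B k J ⊆ (powersetCard m (univ : Finset B)).biUnion
      fun W => ({φ : A ↪ B | univ.map φ ⊆ W} : Finset (A ↪ B)).powerset := by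
    intro Ψ hΨ
    have h1 := (mem_filter.1 hΨ).2
    obtain ⟨W, hW, hWc⟩ := exists_superset_card_eq (s := spanned Ψ) (n := m) (by lia) (by lia)
    refine mem_biUnion.2 ⟨W, mem_powersetCard.2 ⟨subset_univ _, hWc⟩, mem_powerset.2 ?_⟩
    intro φ hφ
    exact mem_filter.2 ⟨mem_univ _, (subset_biUnion_of_mem (fun φ : A ↪ B => univ.map φ) hφ).trans hW⟩
  refine (card_le_card hsub).trans ((card_biUnion_le_card_mul _ _ (2 ^ m ^ Fintype.card A)
    fun W hW => ?_).trans (Nat.mul_le_mul_right _ ?_))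
  · rw [card_powerset]
    refine Nat.pow_le_pow_right two_pos ?_
    rw [← (mem_powersetCard.1 hW).2]
    exact card_embedding_into_le W
  · rw [card_powersetCard, card_univ]
    exact Nat.choose_le_pow _ _

/-- The number of copies of `G` through a `k`-set does not depend on the `k`-set. -/
lemma card_copies_through_eq {k : ℕ} (G : Finset (Finset A)) {e e' : Finset B} (he : #e = k)
    (he' : #e' = k) :
    #{φ : A ↪ B | e ∈ copy G φ} = #{φ : A ↪ B | e' ∈ copy G φ} := by
  have hle : ∀ e e' : Finset B, #e = k → #e' = k →
      #{φ : A ↪ B | e ∈ copy G φ} ≤ #{φ : A ↪ B | e' ∈ copy G φ} := by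
    intro e e' he he'
    have σ₀ : {x // x ∈ e} ≃ {x // x ∈ e'} := Finset.equivOfCardEq (he.trans he'.symm)
    set σ : Equiv.Perm B := σ₀.extendSubtype with hσ
    have hmap : e.map σ.toEmbedding = e' := by
      refine eq_of_subset_of_card_le (fun x hx => ?_) (by rw [card_map, he, he'])
      obtain ⟨y, hy, rfl⟩ := mem_map.1 hx
      exact σ₀.extendSubtype_mem y hy
    refine card_le_card_of_injOn (fun φ => φ.trans σ.toEmbedding) (fun φ hφ => ?_) ?_
    · rw [mem_coe, mem_filter] at hφ ⊢
      refine ⟨mem_univ _, ?_⟩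
      obtain ⟨K, hK, rfl⟩ := mem_image.1 hφ.2
      rw [← hmap, Finset.map_map]
      exact map_mem_copy.2 hK
    · intro φ _ ψ _ h
      ext a
      exact σ.injective (DFunLike.congr_fun h a)
  exact le_antisymm (hle e e' he he') (hle e' e he' he)

lemma choose_mul_card_copies_through {k : ℕ} (G : Finset (Finset A)) (hG : ∀ K ∈ G, #K = k)
    {e : Finset B} (he : #e = k) :
    (Fintype.card B).choose k * #{φ : A ↪ B | e ∈ copy G φ} =
      #G * (Fintype.card B).descFactorial (Fintype.card A) := by
  have h := sum_card_bipartiteAbove_eq_sum_card_bipartiteBelow (s := powersetCard k (univ : Finset B))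
    (t := (univ : Finset (A ↪ B))) (fun e φ => e ∈ copy G φ)
  have h1 : ∀ e' ∈ powersetCard k (univ : Finset B),
      #(bipartiteAbove (fun e φ => e ∈ copy G φ) (univ : Finset (A ↪ B)) e') =
        #{φ : A ↪ B | e ∈ copy G φ} := fun e' he' =>
    card_copies_through_eq G (mem_powersetCard.1 he').2 he
  have h2 : ∀ φ ∈ (univ : Finset (A ↪ B)),
      #(bipartiteBelow (fun e φ => e ∈ copy G φ) (powersetCard k (univ : Finset B)) φ) = #G := by
    intro φ _
    rw [← card_copy G φ]
    congr 1
    ext e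
    rw [bipartiteBelow, mem_filter, and_iff_right_of_imp]
    intro h
    obtain ⟨K, hK, rfl⟩ := mem_image.1 h
    rw [mem_powersetCard]
    exact ⟨subset_univ _, by rw [card_map, hG K hK]⟩
  rw [sum_congr rfl h1, sum_congr rfl h2, sum_const, sum_const, card_powersetCard, card_univ,
    card_univ, Fintype.card_embedding_eq, smul_eq_mul, smul_eq_mul] at h
  rw [h, mul_comm]

end Copies

/-- With `p` of order at most `n ^ (k - q)`, the expected number of crowded families is
negligible compared with `n.choose k`. -/
lemma sum_crowded_le {A : Type*} [Fintype A] {k : ℕ} (hk : 1 ≤ k)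
    (hq : k < Fintype.card A) (m : ℕ) {K δ : ℝ} (hK : 0 < K) (hδ : 0 < δ) :
    ∃ n₀ : ℕ, ∀ n ≥ n₀, ∀ p : ℝ, 0 ≤ p → p * n ^ Fintype.card A ≤ K * n ^ k →
      ∑ J ∈ Icc 2 m, p ^ J * (#(crowded A (Fin n) k J) : ℝ) ≤ δ * n.choose k := by
  set q := Fintype.card A with hqdef
  set S : ℝ := ∑ J ∈ Icc 2 m, K ^ J * (2 : ℝ) ^ ((J * (q - k) + k - 1) ^ q) with hS
  have hS0 : 0 ≤ S := by positivity
  obtain ⟨n₁, hn₁⟩ := exists_nat_ge (S * 2 ^ k * k.factorial / δ)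
  refine ⟨max n₁ (max (m * (q - k) + k) (2 * k)), fun n hn p hp hpK => ?_⟩
  have hn1 : n₁ ≤ n := (le_max_left _ _).trans hn
  have hn2 : m * (q - k) + k ≤ n := (le_max_left _ _).trans ((le_max_right _ _).trans hn)
  have hn3 : 2 * k ≤ n := (le_max_right _ _).trans ((le_max_right _ _).trans hn)
  have hn0 : (0 : ℝ) < n := by
    have : 0 < n := by lia
    exact_mod_cast this
  have hpK' : p * (n : ℝ) ^ (q - k) ≤ K := by
    have : (n : ℝ) ^ q = n ^ (q - k) * n ^ k := by rw [← pow_add]; congr 1; lia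
    rw [this, ← mul_assoc] at hpK
    exact le_of_mul_le_mul_right hpK (by positivity)
  have hterm : ∀ J ∈ Icc 2 m, p ^ J * (#(crowded A (Fin n) k J) : ℝ) ≤
      K ^ J * (2 : ℝ) ^ ((J * (q - k) + k - 1) ^ q) * n ^ (k - 1) := by
    intro J hJ
    rw [mem_Icc] at hJ
    have hJm : J * (q - k) ≤ m * (q - k) := Nat.mul_le_mul_right _ hJ.2
    have h1 := card_crowded_le (A := A) (B := Fin n) (k := k) (J := J) hk
      (by rw [Fintype.card_fin, ← hqdef]; lia)
    rw [Fintype.card_fin, ← hqdef] at h1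
    have h2 : (#(crowded A (Fin n) k J) : ℝ) ≤
        (n : ℝ) ^ (J * (q - k) + k - 1) * 2 ^ ((J * (q - k) + k - 1) ^ q) := by exact_mod_cast h1
    have h3 : (n : ℝ) ^ (J * (q - k) + k - 1) = (n ^ (q - k)) ^ J * n ^ (k - 1) := by
      rw [← pow_mul, ← pow_add, mul_comm (q - k)]; congr 1; lia
    calc p ^ J * (#(crowded A (Fin n) k J) : ℝ)
        ≤ p ^ J * ((n : ℝ) ^ (J * (q - k) + k - 1) * 2 ^ ((J * (q - k) + k - 1) ^ q)) :=
          mul_le_mul_of_nonneg_left h2 (by positivity)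
      _ = (p * (n : ℝ) ^ (q - k)) ^ J * (2 ^ ((J * (q - k) + k - 1) ^ q) * n ^ (k - 1)) := by
          rw [h3, mul_pow]; ring
      _ ≤ K ^ J * (2 ^ ((J * (q - k) + k - 1) ^ q) * n ^ (k - 1)) :=
          mul_le_mul_of_nonneg_right (pow_le_pow_left₀ (by positivity) hpK' _) (by positivity)
      _ = _ := by ring
  refine (sum_le_sum hterm).trans ?_
  rw [← sum_mul, ← hS]
  have hchoose : (n : ℝ) ^ k ≤ 2 ^ k * k.factorial * n.choose k := by
    have h1 : (n + 1 - k) ^ k ≤ k.factorial * n.choose k := by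
      rw [← Nat.descFactorial_eq_factorial_mul_choose]
      exact Nat.pow_sub_le_descFactorial n k
    have h2 : n ^ k ≤ 2 ^ k * (n + 1 - k) ^ k := by
      rw [← mul_pow]
      exact Nat.pow_le_pow_left (by lia) k
    have h3 : n ^ k ≤ 2 ^ k * (k.factorial * n.choose k) := h2.trans (Nat.mul_le_mul_left _ h1)
    rw [mul_assoc]
    exact_mod_cast h3
  have h1 : S * 2 ^ k * k.factorial ≤ δ * n := by
    have h2 : (n₁ : ℝ) ≤ n := by exact_mod_cast hn1
    rw [div_le_iff₀ hδ] at hn₁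
    nlinarith
  have h2 : (n : ℝ) ^ k = n * n ^ (k - 1) := by rw [← pow_succ']; congr 1; lia
  have h3 : S * (n : ℝ) ^ (k - 1) * n ≤ δ * n.choose k * n := by
    calc S * (n : ℝ) ^ (k - 1) * n = S * n ^ k := by rw [h2]; ring
      _ ≤ S * (2 ^ k * k.factorial * n.choose k) := mul_le_mul_of_nonneg_left hchoose hS0
      _ = S * 2 ^ k * k.factorial * n.choose k := by ring
      _ ≤ δ * n * n.choose k := mul_le_mul_of_nonneg_right h1 (Nat.cast_nonneg _)
      _ = _ := by ring
  exact le_of_mul_le_mul_right h3 hn0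

section RandomCopies

variable {A B : Type*} [DecidableEq B] [Fintype A]

lemma spanned_pair (φ ψ : A ↪ B) : spanned {φ, ψ} = univ.map φ ∪ univ.map ψ := by
  classical
  ext x
  simp [spanned]

lemma card_eq_of_mem_copy {k : ℕ} {G : Finset (Finset A)} (hG : ∀ K ∈ G, #K = k) {φ : A ↪ B}
    {e : Finset B} (he : e ∈ copy G φ) : #e = k ∧ e ⊆ univ.map φ := by
  obtain ⟨K, hK, rfl⟩ := mem_image.1 he
  exact ⟨by rw [card_map, hG K hK], map_subset_map.2 (subset_univ _)⟩

/-- If two embeddings share at most `k` vertices, then a `k`-set common to both copies is the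
whole intersection. -/
lemma eq_inter_of_mem_copy {k : ℕ} {G₁ G₂ : Finset (Finset A)} (hG₁ : ∀ K ∈ G₁, #K = k)
    (hG₂ : ∀ K ∈ G₂, #K = k) {φ ψ : A ↪ B} (h : #(univ.map φ ∩ univ.map ψ) ≤ k) {e : Finset B}
    (he₁ : e ∈ copy G₁ φ) (he₂ : e ∈ copy G₂ ψ) : e = univ.map φ ∩ univ.map ψ :=
  eq_of_subset_of_card_le
    (subset_inter (card_eq_of_mem_copy hG₁ he₁).2 (card_eq_of_mem_copy hG₂ he₂).2)
    (by rwa [(card_eq_of_mem_copy hG₁ he₁).1])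

lemma card_inter_le_of_le_card_spanned {k : ℕ} (hq : k ≤ Fintype.card A) {φ ψ : A ↪ B}
    (h : 2 * (Fintype.card A - k) + k ≤ #(spanned {φ, ψ})) :
    #(univ.map φ ∩ univ.map ψ) ≤ k := by
  rw [spanned_pair] at h
  have := card_union_add_card_inter (univ.map φ) (univ.map ψ)
  rw [card_map, card_map, card_univ] at this
  lia

variable [Fintype B]

/-- The embeddings chosen by `T` whose `k`-sets chosen by `T` are exactly the copy of `G`; here
`G'` is the family of `k`-sets not in `G`. -/
noncomputable def goodCopies (G G' : Finset (Finset A)) (T : Finset (Finset B ⊕ (A ↪ B))) :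
    Finset (A ↪ B) :=
  {φ | (copy G φ).disjSum {φ} ⊆ T ∧ Disjoint ((copy G' φ).disjSum ∅) T}

variable {k : ℕ} {G G' : Finset (Finset A)} {d p : ℝ}

lemma bernoulliExp_pattern {U₁ U₂ : Finset (Finset B)} {Ψ : Finset (A ↪ B)}
    (h₁ : U₁ ⊆ powersetCard k univ) (h₂ : U₂ ⊆ powersetCard k univ) (h : Disjoint U₁ U₂) :
    bernoulliExp (Sum.elim (fun _ => 1 - d) (fun _ => p))
      ((powersetCard k (univ : Finset B)).disjSum (univ : Finset (A ↪ B)))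
      (fun T => if U₁.disjSum Ψ ⊆ T ∧ Disjoint (U₂.disjSum ∅) T then 1 else 0) =
      (1 - d) ^ #U₁ * p ^ #Ψ * d ^ #U₂ := by
  rw [bernoulliExp_cylinder (disjSum_mono h₁ (subset_univ _)) (disjSum_mono h₂ (empty_subset _))]
  · simp [prod_disjSum]
  · rw [disjoint_left]
    rintro (e | φ) hx hy
    · exact disjoint_left.1 h (inl_mem_disjSum.1 hx) (inl_mem_disjSum.1 hy)
    · simp at hy

lemma copy_subset_powersetCard (hG : ∀ K ∈ G, #K = k) (φ : A ↪ B) :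
    copy G φ ⊆ powersetCard k univ := fun _ he =>
  mem_powersetCard.2 ⟨subset_univ _, (card_eq_of_mem_copy hG he).1⟩

lemma bernoulliExp_good (hG : ∀ K ∈ G, #K = k) (hG' : ∀ K ∈ G', #K = k) (hGG : Disjoint G G')
    (φ : A ↪ B) :
    bernoulliExp (Sum.elim (fun _ => 1 - d) (fun _ => p))
      ((powersetCard k (univ : Finset B)).disjSum (univ : Finset (A ↪ B)))
      (fun T => if φ ∈ goodCopies G G' T then 1 else 0) = p * ((1 - d) ^ #G * d ^ #G') := by
  have h : Disjoint (copy G φ) (copy G' φ) := by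
    rw [disjoint_left]
    rintro e h₁ h₂
    obtain ⟨K, hK, rfl⟩ := mem_image.1 h₁
    exact disjoint_left.1 hGG hK (map_mem_copy.1 h₂)
  simp only [goodCopies, mem_filter, mem_univ, true_and]
  rw [bernoulliExp_pattern (copy_subset_powersetCard hG φ) (copy_subset_powersetCard hG' φ) h,
    card_copy, card_copy, card_singleton]
  ring

lemma bernoulliExp_all_good_le (hd0 : 0 ≤ d) (hd1 : d ≤ 1) (hp0 : 0 ≤ p) (hp1 : p ≤ 1)
    (Ψ : Finset (A ↪ B)) :
    bernoulliExp (Sum.elim (fun _ => 1 - d) (fun _ => p))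
      ((powersetCard k (univ : Finset B)).disjSum (univ : Finset (A ↪ B)))
      (fun T => if Ψ ⊆ goodCopies G G' T then 1 else 0) ≤ p ^ #Ψ := by
  have h := bernoulliExp_pattern (k := k) (d := d) (p := p) (Ψ := Ψ)
    (empty_subset (powersetCard k (univ : Finset B))) (empty_subset _) (disjoint_empty_left _)
  simp only [card_empty, pow_zero, one_mul, mul_one] at h
  rw [← h]
  refine bernoulliExp_mono ?_ ?_ fun T _ => ?_
  · rintro (e | φ) _
    · exact sub_nonneg.2 hd1
    · exact hp0
  · rintro (e | φ) _
    · simpa using hd0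
    · exact hp1
  · by_cases hΨ : Ψ ⊆ goodCopies G G' T
    · rw [if_pos hΨ, if_pos]
      refine ⟨?_, by simp⟩
      rintro (e | φ) hx
      · simp at hx
      · have := (mem_filter.1 (hΨ (inr_mem_disjSum.1 hx))).2.1
        exact this (by simp)
    · rw [if_neg hΨ]
      split_ifs <;> norm_num

set_option maxHeartbeats 1000000 in
lemma bernoulliExp_pair_good_le (hq : k ≤ Fintype.card A) (hG : ∀ K ∈ G, #K = k)
    (hG' : ∀ K ∈ G', #K = k) (hGG : Disjoint G G') (hd0 : 0 < d) (hd1 : d < 1) (hp0 : 0 ≤ p)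
    (hp1 : p ≤ 1) {φ ψ : A ↪ B} {e : Finset B} (heφ : e ∈ copy G φ) (heψ : e ∈ copy G ψ) :
    bernoulliExp (Sum.elim (fun _ => 1 - d) (fun _ => p))
      ((powersetCard k (univ : Finset B)).disjSum (univ : Finset (A ↪ B)))
      (fun T => if φ ∈ goodCopies G G' T ∧ ψ ∈ goodCopies G G' T then 1 else 0) ≤
      (if φ = ψ then p * ((1 - d) ^ #G * d ^ #G') else 0) +
        (p * ((1 - d) ^ #G * d ^ #G')) ^ 2 / (1 - d) +
        (if {φ, ψ} ∈ crowded A B k 2 then p ^ 2 else 0) := by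
  have hd1' : 0 < 1 - d := sub_pos.2 hd1
  have hmid : 0 ≤ (p * ((1 - d) ^ #G * d ^ #G')) ^ 2 / (1 - d) := by positivity
  by_cases hφψ : φ = ψ
  · subst hφψ
    simp only [and_self, if_true]
    rw [bernoulliExp_good hG hG' hGG]
    have : (0 : ℝ) ≤ if {φ, φ} ∈ crowded A B k 2 then p ^ 2 else 0 := by
      split_ifs <;> positivity
    linarith
  rw [if_neg hφψ, zero_add]
  have hcard2 : #({φ, ψ} : Finset (A ↪ B)) = 2 := card_pair hφψ
  by_cases hcr : {φ, ψ} ∈ crowded A B k 2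
  · rw [if_pos hcr]
    have h := bernoulliExp_all_good_le (k := k) (G := G) (G' := G') hd0.le hd1.le hp0 hp1 {φ, ψ}
    rw [hcard2] at h
    simp only [insert_subset_iff, singleton_subset_iff] at h
    linarith
  rw [if_neg hcr, add_zero]
  have hspan : 2 * (Fintype.card A - k) + k ≤ #(spanned {φ, ψ}) := by
    by_contra! hlt
    exact hcr (mem_filter.2 ⟨mem_powersetCard.2 ⟨subset_univ _, hcard2⟩, hlt⟩)
  have hinter := card_inter_le_of_le_card_spanned hq hspan
  have he := eq_inter_of_mem_copy hG hG hinter heφ heψ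
  have h1 : copy G φ ∩ copy G ψ ⊆ {e} := fun x hx => by
    rw [mem_inter] at hx
    rw [mem_singleton, he]
    exact eq_inter_of_mem_copy hG hG hinter hx.1 hx.2
  have hself : ∀ χ : A ↪ B, Disjoint (copy G χ) (copy G' χ) := fun χ => by
    rw [disjoint_left]
    rintro x h₁ h₂
    obtain ⟨K, hK, rfl⟩ := mem_image.1 h₁
    exact disjoint_left.1 hGG hK (map_mem_copy.1 h₂)
  have h2 : Disjoint (copy G' φ) (copy G' ψ) := by
    rw [disjoint_left]
    intro x hx hx'
    have := eq_inter_of_mem_copy hG' hG' hinter hx hx'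
    rw [← he] at this
    exact disjoint_left.1 (hself φ) heφ (this ▸ hx)
  have h3 : Disjoint (copy G φ) (copy G' ψ) := by
    rw [disjoint_left]
    intro x hx hx'
    have := eq_inter_of_mem_copy hG hG' hinter hx hx'
    rw [← he] at this
    exact disjoint_left.1 (hself ψ) heψ (this ▸ hx')
  have h4 : Disjoint (copy G ψ) (copy G' φ) := by
    rw [disjoint_left]
    intro x hx hx'
    have := eq_inter_of_mem_copy hG' hG hinter hx' hx
    rw [← he] at this
    exact disjoint_left.1 (hself φ) heφ (this ▸ hx')
  have hdisj : Disjoint (copy G φ ∪ copy G ψ) (copy G' φ ∪ copy G' ψ) := by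
    rw [disjoint_union_left, disjoint_union_right, disjoint_union_right]
    exact ⟨⟨hself φ, h3⟩, h4, hself ψ⟩
  have hpat := bernoulliExp_pattern (k := k) (d := d) (p := p) (Ψ := {φ, ψ})
    (union_subset (copy_subset_powersetCard hG φ) (copy_subset_powersetCard hG ψ))
    (union_subset (copy_subset_powersetCard hG' φ) (copy_subset_powersetCard hG' ψ)) hdisj
  have hcongr : ∀ T : Finset (Finset B ⊕ (A ↪ B)),
      ((copy G φ ∪ copy G ψ).disjSum {φ, ψ} ⊆ T ∧
        Disjoint ((copy G' φ ∪ copy G' ψ).disjSum ∅) T) ↔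
      (φ ∈ goodCopies G G' T ∧ ψ ∈ goodCopies G G' T) := by
    intro T
    have e1 : (copy G φ ∪ copy G ψ).disjSum {φ, ψ} =
        (copy G φ).disjSum {φ} ∪ (copy G ψ).disjSum {ψ} := by
      ext (x | x) <;> simp
    have e2 : (copy G' φ ∪ copy G' ψ).disjSum (∅ : Finset (A ↪ B)) =
        (copy G' φ).disjSum ∅ ∪ (copy G' ψ).disjSum ∅ := by
      ext (x | x) <;> simp
    rw [e1, e2, union_subset_iff, disjoint_union_left]
    simp only [goodCopies, mem_filter, mem_univ, true_and]
    tauto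
  simp only [hcongr] at hpat
  rw [hpat, hcard2, card_union_of_disjoint h2, card_copy, card_copy]
  have hcu : 2 * #G ≤ #(copy G φ ∪ copy G ψ) + 1 := by
    have g1 := card_union_add_card_inter (copy G φ) (copy G ψ)
    have g2 := card_le_card h1
    rw [card_copy, card_copy] at g1
    rw [card_singleton] at g2
    lia
  rw [le_div_iff₀ hd1']
  have hpow : (1 - d) ^ (#(copy G φ ∪ copy G ψ) + 1) ≤ (1 - d) ^ (2 * #G) :=
    pow_le_pow_of_le_one hd1'.le (by linarith) hcu
  calc (1 - d) ^ #(copy G φ ∪ copy G ψ) * p ^ 2 * d ^ (#G' + #G') * (1 - d)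
      = (1 - d) ^ (#(copy G φ ∪ copy G ψ) + 1) * (p ^ 2 * d ^ (#G' + #G')) := by ring
    _ ≤ (1 - d) ^ (2 * #G) * (p ^ 2 * d ^ (#G' + #G')) :=
        mul_le_mul_of_nonneg_right hpow (by positivity)
    _ = _ := by ring

omit [DecidableEq B] [Fintype A] [Fintype B] in
lemma sum_pairs_sub_le {ι : Type*} [DecidableEq ι] {I : Finset ι} {x w : ι → ι → ℝ} {y : ι → ℝ}
    {a d D : ℝ} (hd : 0 < 1 - d)
    (hx : ∀ i ∈ I, ∀ j ∈ I, x i j ≤ (if i = j then a else 0) + a ^ 2 / (1 - d) + w i j)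
    (hy : ∀ i ∈ I, y i = a) (hI : a * #I = D * (1 - d)) :
    (∑ i ∈ I, ∑ j ∈ I, x i j) - 2 * D * (∑ i ∈ I, y i) + D ^ 2 * (1 - d) ≤
      D * (1 - d) + ∑ i ∈ I, ∑ j ∈ I, w i j := by
  have h1 : (∑ i ∈ I, ∑ j ∈ I, x i j) ≤
      #I * a + #I * (#I * (a ^ 2 / (1 - d))) + ∑ i ∈ I, ∑ j ∈ I, w i j := by
    refine (sum_le_sum fun i hi => sum_le_sum fun j hj => hx i hi j hj).trans (le_of_eq ?_)
    have hdiag : ∀ i ∈ I, (∑ j ∈ I, if i = j then a else 0) = a := fun i hi => by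
      rw [sum_ite_eq, if_pos hi]
    simp only [sum_add_distrib]
    rw [sum_congr rfl hdiag]
    simp only [sum_const, nsmul_eq_mul]
  have h2 : ∑ i ∈ I, y i = D * (1 - d) := by
    rw [sum_congr rfl hy, sum_const, nsmul_eq_mul, ← hI, mul_comm]
  have h3 : (#I : ℝ) * (#I * (a ^ 2 / (1 - d))) = D ^ 2 * (1 - d) := by
    calc (#I : ℝ) * (#I * (a ^ 2 / (1 - d))) = (a * #I) ^ 2 / (1 - d) := by ring
      _ = _ := by rw [hI]; field_simp
  rw [h3] at h1
  rw [h2]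
  linarith

set_option maxHeartbeats 1000000 in
/-- Expected squared deviation of the copy degrees over the chosen `k`-sets. -/
lemma bernoulliExp_copies_dev_le (hq : k ≤ Fintype.card A) (hG : ∀ K ∈ G, #K = k)
    (hG' : ∀ K ∈ G', #K = k) (hGG : Disjoint G G') (hd0 : 0 < d) (hd1 : d < 1) (hp0 : 0 ≤ p)
    (hp1 : p ≤ 1) {D : ℝ}
    (hD : ∀ e ∈ powersetCard k (univ : Finset B),
      p * ((1 - d) ^ #G * d ^ #G') * #{φ : A ↪ B | e ∈ copy G φ} = D * (1 - d)) :
    bernoulliExp (Sum.elim (fun _ => 1 - d) (fun _ => p))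
      ((powersetCard k (univ : Finset B)).disjSum (univ : Finset (A ↪ B)))
      (fun T => ∑ e ∈ powersetCard k (univ : Finset B) with Sum.inl e ∈ T,
        ((hyperDeg (copy G) (goodCopies G G' T) e : ℝ) - D) ^ 2) ≤
      (Fintype.card B).choose k * (D * (1 - d)) + 4 * #G * (p ^ 2 * #(crowded A B k 2)) := by
  set θ : ℝ := (1 - d) ^ #G * d ^ #G' with hθ
  set U := powersetCard k (univ : Finset B) with hU
  have hd1' : 0 < 1 - d := sub_pos.2 hd1
  have hUc : (#U : ℝ) = (Fintype.card B).choose k := by rw [hU, card_powersetCard, card_univ]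
  have hdeg : ∀ T e, (hyperDeg (copy G) (goodCopies G G' T) e : ℝ) =
      ∑ φ : A ↪ B with e ∈ copy G φ, if φ ∈ goodCopies G G' T then (1 : ℝ) else 0 := by
    intro T e
    rw [sum_boole, hyperDeg, filter_filter]
    congr 2
    ext φ
    simp [and_comm]
  have hdegsq : ∀ T e, (hyperDeg (copy G) (goodCopies G G' T) e : ℝ) ^ 2 =
      ∑ φ : A ↪ B with e ∈ copy G φ, ∑ ψ : A ↪ B with e ∈ copy G ψ,
        if φ ∈ goodCopies G G' T ∧ ψ ∈ goodCopies G G' T then (1 : ℝ) else 0 := by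
    intro T e
    rw [hdeg, sq, sum_mul_sum]
    refine sum_congr rfl fun φ _ => sum_congr rfl fun ψ _ => ?_
    by_cases h1 : φ ∈ goodCopies G G' T <;> by_cases h2 : ψ ∈ goodCopies G G' T <;> simp [h1, h2]
  have hexpand : ∀ T, ∑ e ∈ U with Sum.inl e ∈ T,
      ((hyperDeg (copy G) (goodCopies G G' T) e : ℝ) - D) ^ 2 =
      ∑ e ∈ U, ((∑ φ : A ↪ B with e ∈ copy G φ, ∑ ψ : A ↪ B with e ∈ copy G ψ,
        if φ ∈ goodCopies G G' T ∧ ψ ∈ goodCopies G G' T then (1 : ℝ) else 0)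
        - 2 * D * (∑ φ : A ↪ B with e ∈ copy G φ,
          if φ ∈ goodCopies G G' T then (1 : ℝ) else 0)
        + D ^ 2 * (if ({e} : Finset (Finset B)).disjSum (∅ : Finset (A ↪ B)) ⊆ T ∧
          Disjoint ((∅ : Finset (Finset B)).disjSum ∅) T then 1 else 0)) := by
    intro T
    rw [sum_filter]
    refine sum_congr rfl fun e _ => ?_
    rw [← hdegsq, ← hdeg]
    have hiff : (({e} : Finset (Finset B)).disjSum (∅ : Finset (A ↪ B)) ⊆ T ∧
        Disjoint ((∅ : Finset (Finset B)).disjSum ∅) T) ↔ Sum.inl e ∈ T := by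
      constructor
      · exact fun h => h.1 (by simp)
      · refine fun h => ⟨?_, by simp⟩
        rintro (x | x) hx
        · rw [inl_mem_disjSum, mem_singleton] at hx
          rwa [hx]
        · simp at hx
    rw [if_congr hiff rfl rfl]
    split_ifs with h
    · ring
    · have h0 : hyperDeg (copy G) (goodCopies G G' T) e = 0 := by
        rw [hyperDeg, card_eq_zero, filter_eq_empty_iff]
        intro φ hφ he
        exact h ((mem_filter.1 hφ).2.1 (inl_mem_disjSum.2 he))
      rw [h0]
      simp
  simp only [hexpand, bernoulliExp_sum, bernoulliExp_add, bernoulliExp_sub,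
    bernoulliExp_const_mul]
  have hterm : ∀ e ∈ U,
      (∑ φ : A ↪ B with e ∈ copy G φ, ∑ ψ : A ↪ B with e ∈ copy G ψ,
        bernoulliExp (Sum.elim (fun _ => 1 - d) (fun _ => p)) (U.disjSum univ) (fun T =>
          if φ ∈ goodCopies G G' T ∧ ψ ∈ goodCopies G G' T then (1 : ℝ) else 0))
        - 2 * D * (∑ φ : A ↪ B with e ∈ copy G φ,
          bernoulliExp (Sum.elim (fun _ => 1 - d) (fun _ => p)) (U.disjSum univ) (fun T =>
            if φ ∈ goodCopies G G' T then (1 : ℝ) else 0))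
        + D ^ 2 * bernoulliExp (Sum.elim (fun _ => 1 - d) (fun _ => p)) (U.disjSum univ)
          (fun T => if ({e} : Finset (Finset B)).disjSum (∅ : Finset (A ↪ B)) ⊆ T ∧
          Disjoint ((∅ : Finset (Finset B)).disjSum ∅) T then 1 else 0) ≤
      D * (1 - d) + ∑ φ : A ↪ B with e ∈ copy G φ, ∑ ψ : A ↪ B with e ∈ copy G ψ,
        if {φ, ψ} ∈ crowded A B k 2 then p ^ 2 else 0 := by
    intro e he
    have hal := bernoulliExp_pattern (k := k) (d := d) (p := p) (U₁ := {e})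
      (U₂ := ∅) (Ψ := (∅ : Finset (A ↪ B))) (singleton_subset_iff.2 he) (empty_subset _)
      (disjoint_empty_right _)
    rw [card_singleton, card_empty, card_empty, pow_one, pow_zero, pow_zero, mul_one,
      mul_one] at hal
    rw [hU, hal]
    exact sum_pairs_sub_le hd1' (fun φ hφ ψ hψ =>
      bernoulliExp_pair_good_le hq hG hG' hGG hd0 hd1 hp0 hp1 (mem_filter.1 hφ).2
        (mem_filter.1 hψ).2) (fun φ _ => bernoulliExp_good hG hG' hGG φ) (hD e he)
  refine (sum_le_sum hterm).trans ?_
  rw [sum_add_distrib, sum_const, nsmul_eq_mul, hUc]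
  refine add_le_add_right ?_ _
  have hswap : ∑ e ∈ U, ∑ φ : A ↪ B with e ∈ copy G φ, ∑ ψ : A ↪ B with e ∈ copy G ψ,
      (if {φ, ψ} ∈ crowded A B k 2 then p ^ 2 else 0) ≤
      ∑ Ψ ∈ crowded A B k 2, ∑ φ ∈ Ψ, ∑ ψ ∈ Ψ, #G * p ^ 2 := by
    have hin : ∀ φ ψ : A ↪ B, (if {φ, ψ} ∈ crowded A B k 2 then p ^ 2 else 0) ≤
        ∑ Ψ ∈ crowded A B k 2, if φ ∈ Ψ then (if ψ ∈ Ψ then p ^ 2 else 0) else 0 := by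
      intro φ ψ
      have hnn : ∀ Ψ ∈ crowded A B k 2,
          0 ≤ if φ ∈ Ψ then (if ψ ∈ Ψ then p ^ 2 else 0) else (0 : ℝ) := fun Ψ _ => by
        split_ifs <;> positivity
      split_ifs with h
      · simpa using single_le_sum hnn h
      · exact sum_nonneg hnn
    calc _ ≤ ∑ e ∈ U, ∑ φ : A ↪ B with e ∈ copy G φ, ∑ ψ : A ↪ B, ∑ Ψ ∈ crowded A B k 2,
          (if φ ∈ Ψ then (if ψ ∈ Ψ then p ^ 2 else 0) else 0) := by
          refine sum_le_sum fun e _ => sum_le_sum fun φ _ => ?_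
          refine (sum_le_sum fun ψ _ => hin φ ψ).trans ?_
          refine sum_le_sum_of_subset_of_nonneg (subset_univ _) fun ψ _ _ =>
            sum_nonneg fun Ψ _ => ?_
          split_ifs <;> positivity
      _ = ∑ φ : A ↪ B, ∑ e ∈ copy G φ, ∑ ψ : A ↪ B, ∑ Ψ ∈ crowded A B k 2,
          (if φ ∈ Ψ then (if ψ ∈ Ψ then p ^ 2 else 0) else 0) := by
          refine sum_comm' fun e φ => ?_
          simp only [mem_filter, mem_univ, true_and, and_true, and_iff_right_iff_imp]
          exact fun h => copy_subset_powersetCard hG φ h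
      _ = ∑ φ : A ↪ B, ∑ ψ : A ↪ B, ∑ Ψ ∈ crowded A B k 2,
          (if φ ∈ Ψ then (if ψ ∈ Ψ then #G * p ^ 2 else 0) else 0) := by
          refine sum_congr rfl fun φ _ => ?_
          rw [sum_const, card_copy, nsmul_eq_mul, mul_sum]
          refine sum_congr rfl fun ψ _ => ?_
          rw [mul_sum]
          refine sum_congr rfl fun Ψ _ => ?_
          split_ifs <;> simp
      _ = ∑ Ψ ∈ crowded A B k 2, ∑ φ : A ↪ B, ∑ ψ : A ↪ B,
          (if φ ∈ Ψ then (if ψ ∈ Ψ then #G * p ^ 2 else 0) else 0) := by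
          rw [sum_comm]
          rw [sum_congr rfl fun φ _ => sum_comm, sum_comm]
          refine sum_congr rfl fun Ψ _ => sum_comm
      _ ≤ _ := by
          refine sum_le_sum fun Ψ _ => le_of_eq ?_
          have hφ : ∀ φ : A ↪ B, ∑ ψ : A ↪ B,
              (if φ ∈ Ψ then (if ψ ∈ Ψ then #G * p ^ 2 else 0) else 0) =
              if φ ∈ Ψ then ∑ ψ ∈ Ψ, #G * p ^ 2 else 0 := fun φ => by
            split_ifs
            · rw [sum_ite_mem, univ_inter]
            · exact sum_const_zero
          rw [sum_congr rfl fun φ _ => hφ φ, sum_ite_mem, univ_inter]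
  refine hswap.trans (le_of_eq ?_)
  have hc : ∀ Ψ ∈ crowded A B k 2, #Ψ = 2 := fun Ψ hΨ =>
    (mem_powersetCard.1 (mem_filter.1 hΨ).1).2
  have h4 : ∀ Ψ ∈ crowded A B k 2, (∑ φ ∈ Ψ, ∑ ψ ∈ Ψ, #G * p ^ 2) = 4 * #G * p ^ 2 := by
    intro Ψ hΨ
    simp only [sum_const, hc Ψ hΨ, nsmul_eq_mul]
    push_cast
    ring
  rw [sum_congr rfl h4, sum_const, nsmul_eq_mul]
  ring

end RandomCopies

lemma exists_hitting_set {ι : Type*} [DecidableEq ι] (S : Finset (Finset ι))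
    (hS : ∀ Ψ ∈ S, Ψ.Nonempty) : ∃ R : Finset ι, #R ≤ #S ∧ ∀ Ψ ∈ S, ∃ i ∈ Ψ, i ∈ R := by
  choose x hx using fun Ψ : {Ψ // Ψ ∈ S} => hS Ψ.1 Ψ.2
  refine ⟨S.attach.image x, card_image_le.trans_eq card_attach, fun Ψ hΨ =>
    ⟨x ⟨Ψ, hΨ⟩, hx _, mem_image_of_mem _ (mem_attach _ _)⟩⟩

lemma three_bounds_of_weighted_sum {d D N X₁ X₂ X₃ E₂ E₃ : ℝ} (hd : 0 < d) (hD : 0 < D)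
    (hN : 0 < N) (hX₁ : 0 ≤ N - X₁) (hX₂ : 0 ≤ X₂) (hX₃ : 0 ≤ X₃) (hE₂ : E₂ ≤ 2 * D * N)
    (hE₃ : E₃ ≤ N)
    (h : 1 / (d * N) * (N - X₁) + 1 / (2 * D * N) * X₂ + 1 / N * X₃ ≤
      1 / (d * N) * (N - (1 - d) * N) + 1 / (2 * D * N) * E₂ + 1 / N * E₃) :
    (1 - 3 * d) * N ≤ X₁ ∧ X₂ ≤ 6 * D * N ∧ X₃ ≤ 3 * N := by
  have hsum : 1 / (d * N) * (N - X₁) + 1 / (2 * D * N) * X₂ + 1 / N * X₃ ≤ 3 := by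
    have h1 : 1 / (d * N) * (N - (1 - d) * N) = 1 := by field_simp; ring
    have h2 : 1 / (2 * D * N) * E₂ ≤ 1 := by
      rw [one_div_mul_eq_div]
      exact (div_le_one (by positivity)).2 hE₂
    have h3 : 1 / N * E₃ ≤ 1 := by
      rw [one_div_mul_eq_div]
      exact (div_le_one hN).2 hE₃
    linarith
  have hY1 : 0 ≤ 1 / (d * N) * (N - X₁) := by positivity
  have hY2 : 0 ≤ 1 / (2 * D * N) * X₂ := by positivity
  have hY3 : 0 ≤ 1 / N * X₃ := by positivity
  refine ⟨?_, ?_, ?_⟩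
  · have h : 1 / (d * N) * (N - X₁) ≤ 3 := by linarith
    rw [one_div_mul_eq_div, div_le_iff₀ (by positivity)] at h
    linarith
  · have h : 1 / (2 * D * N) * X₂ ≤ 3 := by linarith
    rw [one_div_mul_eq_div, div_le_iff₀ (by positivity)] at h
    linarith
  · have h : 1 / N * X₃ ≤ 3 := by linarith
    rw [one_div_mul_eq_div, div_le_iff₀ (by positivity)] at h
    linarith

set_option maxHeartbeats 1000000 in
/-- The outcome of the random choice: few dead `k`-sets, copy degrees concentrated around `D`,
few crowded families. -/
lemma exists_random_copies {A : Type*} [Fintype A] {k : ℕ} (hk : 1 ≤ k)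
    (hq : k < Fintype.card A) {G G' : Finset (Finset A)} (hG : ∀ K ∈ G, #K = k)
    (hG' : ∀ K ∈ G', #K = k) (hGG : Disjoint G G') (hne : G.Nonempty) {d : ℝ} (hd0 : 0 < d)
    (hd1 : d < 1) {D : ℝ} (hD : 1 ≤ D) {m : ℕ} (hm : 2 ≤ m) :
    ∃ n₀ : ℕ, ∀ n ≥ n₀, ∃ T : Finset (Finset (Fin n) ⊕ (A ↪ Fin n)),
      (1 - 3 * d) * n.choose k ≤ (#{e ∈ powersetCard k (univ : Finset (Fin n)) | Sum.inl e ∈ T} : ℝ) ∧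
      ∑ e ∈ powersetCard k (univ : Finset (Fin n)) with Sum.inl e ∈ T,
        ((hyperDeg (copy G) (goodCopies G G' T) e : ℝ) - D) ^ 2 ≤ 6 * D * n.choose k ∧
      ∑ J ∈ Icc 2 m, (#{Ψ ∈ crowded A (Fin n) k J | Ψ ⊆ goodCopies G G' T} : ℝ) ≤
        3 * n.choose k := by
  have hg : (0 : ℝ) < #G := by exact_mod_cast hne.card_pos
  have hg1 : (1 : ℝ) ≤ #G := by exact_mod_cast hne.card_pos
  have hd1' : 0 < 1 - d := sub_pos.2 hd1
  set q := Fintype.card A with hqdef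
  set θ : ℝ := (1 - d) ^ #G * d ^ #G' with hθ
  have hθ0 : 0 < θ := by positivity
  set C : ℝ := D * (1 - d) * 2 ^ q / (θ * #G) with hC
  have hD0 : 0 < D := by linarith
  have hC0 : 0 < C := by positivity
  obtain ⟨n₁, hn₁⟩ := sum_crowded_le hk hq m hC0 (show (0 : ℝ) < 1 / (4 * #G) by positivity)
  obtain ⟨n₂, hn₂⟩ := exists_nat_ge C
  refine ⟨max n₁ (max n₂ (2 * q)), fun n hn => ?_⟩
  have hn1 : n₁ ≤ n := (le_max_left _ _).trans hn
  have hn2 : n₂ ≤ n := (le_max_left _ _).trans ((le_max_right _ _).trans hn)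
  have hn3 : 2 * q ≤ n := (le_max_right _ _).trans ((le_max_right _ _).trans hn)
  have hCn : C ≤ n := hn₂.trans (by exact_mod_cast hn2)
  have hn0 : (0 : ℝ) < n := by
    have : 0 < n := by lia
    exact_mod_cast this
  set N : ℝ := (n.choose k : ℝ) with hN
  have hN0 : 0 < N := by
    have : 0 < n.choose k := Nat.choose_pos (by lia)
    exact Nat.cast_pos.2 this
  set F : ℝ := (n.descFactorial q : ℝ) with hF
  have hF0 : 0 < F := by
    have : 0 < n.descFactorial q := Nat.pos_of_ne_zero fun h => by
      rw [Nat.descFactorial_eq_zero_iff_lt] at h; lia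
    exact Nat.cast_pos.2 this
  set p : ℝ := D * (1 - d) * N / (θ * #G * F) with hp
  have hp0 : 0 ≤ p := by positivity
  have hpn : p * n ^ q ≤ C * n ^ k := by
    have h1 : (n : ℝ) ^ q ≤ 2 ^ q * F := by
      have h2 : n ^ q ≤ 2 ^ q * (n + 1 - q) ^ q := by
        rw [← mul_pow]
        exact Nat.pow_le_pow_left (by lia) q
      have h3 : n ^ q ≤ 2 ^ q * n.descFactorial q :=
        h2.trans (Nat.mul_le_mul_left _ (Nat.pow_sub_le_descFactorial n q))
      rw [hF]
      exact_mod_cast h3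
    have h2 : N ≤ n ^ k := by
      rw [hN]
      exact_mod_cast Nat.choose_le_pow n k
    calc p * n ^ q ≤ p * (2 ^ q * F) := mul_le_mul_of_nonneg_left h1 hp0
      _ = C * N := by rw [hp, hC]; field_simp
      _ ≤ C * n ^ k := mul_le_mul_of_nonneg_left h2 hC0.le
  have hp1 : p ≤ 1 := by
    have h1 : (n : ℝ) ^ q = n ^ (q - k - 1) * n * n ^ k := by
      rw [← pow_succ, ← pow_add]; congr 1; lia
    have h2 : (1 : ℝ) ≤ n ^ (q - k - 1) := one_le_pow₀ (by
      have : 1 ≤ n := by lia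
      exact_mod_cast this)
    rw [h1, ← mul_assoc] at hpn
    have h3 : p * (n ^ (q - k - 1) * n) ≤ C := le_of_mul_le_mul_right hpn (by positivity)
    have h4 : p * n ≤ p * (n ^ (q - k - 1) * n) :=
      mul_le_mul_of_nonneg_left (le_mul_of_one_le_left hn0.le h2) hp0
    have h5 : p * n ≤ 1 * n := by linarith
    exact le_of_mul_le_mul_right h5 hn0
  have hcrowd := hn₁ n hn1 p hp0 hpn
  rw [← hN] at hcrowd
  set U := powersetCard k (univ : Finset (Fin n)) with hU
  have hUc : (#U : ℝ) = N := by rw [hU, card_powersetCard, card_univ, Fintype.card_fin]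
  have hreg : ∀ e ∈ U, p * θ * #{φ : A ↪ Fin n | e ∈ copy G φ} = D * (1 - d) := by
    intro e he
    have h1 := choose_mul_card_copies_through G hG (mem_powersetCard.1 he).2
    rw [Fintype.card_fin] at h1
    have h2 : N * (#{φ : A ↪ Fin n | e ∈ copy G φ} : ℝ) = #G * F := by
      rw [hN, hF]
      exact_mod_cast h1
    calc p * θ * (#{φ : A ↪ Fin n | e ∈ copy G φ} : ℝ)
        = D * (1 - d) * (N * #{φ : A ↪ Fin n | e ∈ copy G φ}) / (#G * F) := by
          rw [hp]; field_simp
      _ = D * (1 - d) := by rw [h2]; field_simp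
  have hdev := bernoulliExp_copies_dev_le hq.le hG hG' hGG hd0 hd1 hp0 hp1 hreg
  rw [Fintype.card_fin, ← hN, ← hU] at hdev
  have hcr2 : p ^ 2 * (#(crowded A (Fin n) k 2) : ℝ) ≤ 1 / (4 * #G) * N :=
    le_trans (single_le_sum (f := fun J => p ^ J * (#(crowded A (Fin n) k J) : ℝ))
      (fun J _ => by positivity) (mem_Icc.2 ⟨le_rfl, hm⟩)) hcrowd
  set P : Finset (Fin n) ⊕ (A ↪ Fin n) → ℝ := Sum.elim (fun _ => 1 - d) (fun _ => p) with hP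
  have hP0 : ∀ x ∈ U.disjSum (univ : Finset (A ↪ Fin n)), 0 ≤ P x := by
    rintro (e | φ) _
    · exact hd1'.le
    · exact hp0
  have hP1 : ∀ x ∈ U.disjSum (univ : Finset (A ↪ Fin n)), P x ≤ 1 := by
    rintro (e | φ) _
    · simpa [hP] using hd0.le
    · exact hp1
  have halive : bernoulliExp P (U.disjSum univ)
      (fun T => (#{e ∈ U | Sum.inl e ∈ T} : ℝ)) = (1 - d) * N := by
    have h1 : ∀ T : Finset (Finset (Fin n) ⊕ (A ↪ Fin n)), (#{e ∈ U | Sum.inl e ∈ T} : ℝ) =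
        ∑ e ∈ U, if ({e} : Finset (Finset (Fin n))).disjSum (∅ : Finset (A ↪ Fin n)) ⊆ T ∧
          Disjoint ((∅ : Finset (Finset (Fin n))).disjSum ∅) T then (1 : ℝ) else 0 := by
      intro T
      rw [sum_boole]
      congr 2
      refine filter_congr fun e _ => ?_
      constructor
      · refine fun h => ⟨?_, by simp⟩
        rintro (x | x) hx
        · rw [inl_mem_disjSum, mem_singleton] at hx
          rwa [hx]
        · simp at hx
      · exact fun h => h.1 (by simp)
    simp only [h1, bernoulliExp_sum]
    have h2 : ∀ e ∈ U, bernoulliExp P (U.disjSum univ)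
        (fun T => if ({e} : Finset (Finset (Fin n))).disjSum (∅ : Finset (A ↪ Fin n)) ⊆ T ∧
          Disjoint ((∅ : Finset (Finset (Fin n))).disjSum ∅) T then (1 : ℝ) else 0) = 1 - d := by
      intro e he
      rw [hU, hP, bernoulliExp_pattern (singleton_subset_iff.2 he) (empty_subset _)
        (disjoint_empty_right _)]
      simp
    rw [sum_congr rfl h2, sum_const, nsmul_eq_mul, hUc, mul_comm]
  have hcrexp : bernoulliExp P (U.disjSum univ) (fun T => ∑ J ∈ Icc 2 m,
      (#{Ψ ∈ crowded A (Fin n) k J | Ψ ⊆ goodCopies G G' T} : ℝ)) ≤ N := by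
    rw [bernoulliExp_sum]
    have h1 : ∀ J ∈ Icc 2 m, bernoulliExp P (U.disjSum univ) (fun T =>
        (#{Ψ ∈ crowded A (Fin n) k J | Ψ ⊆ goodCopies G G' T} : ℝ)) ≤
        p ^ J * (#(crowded A (Fin n) k J) : ℝ) := by
      intro J _
      simp only [← sum_boole, bernoulliExp_sum]
      refine (sum_le_card_nsmul _ _ (p ^ J) fun Ψ hΨ => ?_).trans_eq ?_
      · have := bernoulliExp_all_good_le (k := k) (G := G) (G' := G') hd0.le hd1.le hp0 hp1 Ψ
        rwa [(mem_powersetCard.1 (mem_filter.1 hΨ).1).2] at this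
      · rw [nsmul_eq_mul, mul_comm]
    refine (sum_le_sum h1).trans (hcrowd.trans (mul_le_of_le_one_left hN0.le ?_))
    rw [div_le_one (by positivity)]
    linarith
  obtain ⟨T, -, hT⟩ := exists_le_bernoulliExp hP0 hP1 (fun T =>
    1 / (d * N) * (N - #{e ∈ U | Sum.inl e ∈ T}) +
    1 / (2 * D * N) * ∑ e ∈ U with Sum.inl e ∈ T,
        ((hyperDeg (copy G) (goodCopies G G' T) e : ℝ) - D) ^ 2 +
    1 / N * ∑ J ∈ Icc 2 m, (#{Ψ ∈ crowded A (Fin n) k J | Ψ ⊆ goodCopies G G' T} : ℝ))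
  rw [bernoulliExp_add, bernoulliExp_add, bernoulliExp_const_mul, bernoulliExp_const_mul,
    bernoulliExp_const_mul, bernoulliExp_sub, bernoulliExp_const, halive] at hT
  refine ⟨T, ?_⟩
  have hX1 : (0 : ℝ) ≤ N - #{e ∈ U | Sum.inl e ∈ T} := by
    rw [← hUc, sub_nonneg]
    exact_mod_cast card_filter_le _ _
  have hX2 : (0 : ℝ) ≤ ∑ e ∈ U with Sum.inl e ∈ T,
      ((hyperDeg (copy G) (goodCopies G G' T) e : ℝ) - D) ^ 2 := sum_nonneg fun _ _ => sq_nonneg _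
  have hX3 : (0 : ℝ) ≤ ∑ J ∈ Icc 2 m,
      (#{Ψ ∈ crowded A (Fin n) k J | Ψ ⊆ goodCopies G G' T} : ℝ) :=
    sum_nonneg fun _ _ => Nat.cast_nonneg _
  refine three_bounds_of_weighted_sum hd0 hD0 hN0 hX1 hX2 hX3 ?_ hcrexp hT
  have h1 : 4 * #G * (1 / (4 * #G) * N) = N := by field_simp
  have h2 := mul_le_mul_of_nonneg_left hcr2 (show (0 : ℝ) ≤ 4 * #G by positivity)
  have h3 : N * (D * (1 - d)) ≤ N * D := mul_le_mul_of_nonneg_left (by nlinarith) hN0.le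
  refine hdev.trans ?_
  nlinarith

/-- A sparse family of induced copies of `G` inside a dense family of `k`-sets, covering almost
all of these `k`-sets almost equally often. -/
lemma exists_sparse_copies {A : Type*} [Fintype A] {k : ℕ} (hk : 1 ≤ k)
    (hq : k < Fintype.card A) {G : Finset (Finset A)} (hG : ∀ K ∈ G, #K = k)
    (hne : G.Nonempty) {d : ℝ} (hd0 : 0 < d) (hd1 : d < 1) {D : ℝ} (hD : 1 ≤ D) (m : ℕ) :
    ∃ n₀ : ℕ, ∀ n ≥ n₀, ∃ alive ⊆ powersetCard k (univ : Finset (Fin n)),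
      ∃ Φ : Finset (A ↪ Fin n), (1 - 3 * d) * n.choose k ≤ (#alive : ℝ) ∧
        (∀ φ ∈ Φ, ∀ K : Finset A, #K = k → (K.map φ ∈ alive ↔ K ∈ G)) ∧
        (∀ Ψ ⊆ Φ, Ψ.Nonempty → #Ψ ≤ m → #Ψ * (Fintype.card A - k) + k ≤ #(spanned Ψ)) ∧
        (∀ e, (hyperDeg (copy G) Φ e : ℝ) ≤ 2 * D) ∧
        ∑ e ∈ alive, ((hyperDeg (copy G) Φ e : ℝ) - D) ^ 2 ≤
          (12 + 60 * #G) * D * n.choose k := by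
  classical
  set G' := powersetCard k (univ : Finset A) \ G with hG'def
  have hG' : ∀ K ∈ G', #K = k := fun K hK => (mem_powersetCard.1 (mem_sdiff.1 hK).1).2
  obtain ⟨n₀, h⟩ := exists_random_copies hk hq hG hG' disjoint_sdiff hne hd0 hd1 hD
    (le_max_right m 2)
  refine ⟨n₀, fun n hn => ?_⟩
  obtain ⟨T, hT1, hT2, hT3⟩ := h n hn
  set alive := {e ∈ powersetCard k (univ : Finset (Fin n)) | Sum.inl e ∈ T} with halive
  set E := goodCopies G G' T with hE
  have hcolor : ∀ φ ∈ E, ∀ K : Finset A, #K = k → (K.map φ ∈ alive ↔ K ∈ G) := by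
    intro φ hφ K hK
    have hφ' := (mem_filter.1 hφ).2
    constructor
    · intro hal
      by_contra hKG
      have hKG' : K ∈ G' := mem_sdiff.2 ⟨mem_powersetCard.2 ⟨subset_univ _, hK⟩, hKG⟩
      exact disjoint_left.1 hφ'.2 (inl_mem_disjSum.2 (map_mem_copy.2 hKG')) (mem_filter.1 hal).2
    · intro hKG
      exact mem_filter.2 ⟨mem_powersetCard.2 ⟨subset_univ _, by rw [card_map, hK]⟩,
        hφ'.1 (inl_mem_disjSum.2 (map_mem_copy.2 hKG))⟩
  set S := ((Icc 2 (max m 2)).biUnion fun J => {Ψ ∈ crowded A (Fin n) k J | Ψ ⊆ E}) with hS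
  have hScard : (#S : ℝ) ≤ 3 * n.choose k := by
    refine le_trans ?_ hT3
    exact_mod_cast card_biUnion_le
  obtain ⟨R, hRc, hR⟩ := exists_hitting_set S (by
    intro Ψ hΨ
    obtain ⟨J, hJ, hΨ'⟩ := mem_biUnion.1 hΨ
    have h1 := (mem_powersetCard.1 (mem_filter.1 (mem_filter.1 hΨ').1).1).2
    rw [← card_pos, h1]
    have := (mem_Icc.1 hJ).1
    lia)
  have hED : (#(E \ (E \ R)) : ℝ) ≤ 3 * n.choose k := by
    refine le_trans ?_ hScard
    rw [sdiff_sdiff_right_self]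
    exact_mod_cast (card_le_card inter_subset_right).trans hRc
  have hD0 : 0 < D := by linarith
  have hsub : ∀ φ ∈ E, copy G φ ⊆ alive := by
    intro φ hφ e he
    obtain ⟨K, hK, rfl⟩ := mem_image.1 he
    exact (hcolor φ hφ K (hG K hK)).2 hK
  refine ⟨alive, filter_subset _ _, prune (copy G) E (E \ R) D, hT1, ?_, ?_, ?_, ?_⟩
  · exact fun φ hφ => hcolor φ (sdiff_subset (prune_subset D hφ))
  · intro Ψ hΨ hΨne hΨm
    by_contra! hlt
    have hΨE := hΨ.trans (prune_subset D)
    rcases Nat.lt_or_ge (#Ψ) 2 with h1 | h1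
    · have h2 : #Ψ = 1 := by
        have := hΨne.card_pos
        lia
      obtain ⟨φ, rfl⟩ := card_eq_one.1 h2
      rw [spanned, singleton_biUnion, card_map, card_univ, card_singleton] at hlt
      lia
    · have hmem : Ψ ∈ S := mem_biUnion.2 ⟨#Ψ, mem_Icc.2 ⟨h1, hΨm.trans (le_max_left _ _)⟩,
        mem_filter.2 ⟨mem_filter.2 ⟨mem_powersetCard.2 ⟨subset_univ _, rfl⟩, hlt⟩,
          hΨE.trans sdiff_subset⟩⟩
      obtain ⟨φ, hφ, hφR⟩ := hR Ψ hmem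
      exact (mem_sdiff.1 (hΨE hφ)).2 hφR
  · exact hyperDeg_prune_le sdiff_subset hD0.le
  · refine (sum_sq_dev_prune_le sdiff_subset hsub (fun φ _ => card_copy G φ) hD0 hT2 hED).trans
      (le_of_eq ?_)
    ring

/-- Any `J ≤ m` edges of `H` span at least `J * a + k` vertices. -/
def IsSpread {V : Type*} [DecidableEq V] (a k m : ℕ) (H : Finset (Finset V)) : Prop :=
  ∀ J ⊆ H, J.Nonempty → #J ≤ m → #J * a + k ≤ #(J.sup id)

lemma card_sup_id_le {V : Type*} [DecidableEq V] {J : Finset (Finset V)} {r : ℕ}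
    (hJ : ∀ e ∈ J, #e = r) : #(J.sup id) ≤ #J * r := by
  rw [sup_eq_biUnion]
  exact card_biUnion_le_card_mul _ _ _ fun e he => (hJ e he).le

lemma card_le_sum_inter {V : Type*} [DecidableEq V] {J : Finset (Finset V)} {A : Finset V}
    (hA : A ⊆ J.sup id) : #A ≤ ∑ B ∈ J, #(A ∩ B) := by
  rw [sup_eq_biUnion] at hA
  calc #A = #(A ∩ J.biUnion id) := by rw [inter_eq_left.2 hA]
    _ = #(J.biUnion fun B => A ∩ B) := by rw [inter_biUnion]; rfl
    _ ≤ _ := card_biUnion_le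

section

variable {V : Type*} [DecidableEq V] {t k : ℕ} {H : Finset (Finset V)}
  {S : Finset V → Finset V}

lemma IsSpread.card_inter_le (ht : 2 ≤ t) (hcard : ∀ e ∈ H, #e = t * k)
    (hH : IsSpread ((t - 1) * k) k (2 * t + 2) H) {A B : Finset V} (hA : A ∈ H) (hB : B ∈ H)
    (hAB : A ≠ B) : #(A ∩ B) ≤ k := by
  have h1 := hH {A, B} (by simp [insert_subset_iff, hA, hB]) (by simp)
    (by rw [card_pair hAB]; lia)
  rw [card_pair hAB, sup_insert, sup_singleton, id, id, sup_eq_union] at h1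
  have h2 := card_union_add_card_inter A B
  rw [hcard A hA, hcard B hB] at h2
  obtain ⟨u, rfl⟩ := Nat.exists_eq_add_of_le' (by lia : 1 ≤ t)
  rw [Nat.add_sub_cancel] at h1
  nlinarith

/-- An edge with a vertex private to it among the edges with the same host is not covered by
`t` others. -/
lemma IsSpread.not_subset_sup (ht : 2 ≤ t) (hcard : ∀ e ∈ H, #e = t * k)
    (hH : IsSpread ((t - 1) * k) k (2 * t + 2) H) (hS : ∀ e ∈ H, e ⊆ S e)
    (hcross : ∀ A ∈ H, ∀ B ∈ H, S A ≠ S B → #(A ∩ S B) < k)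
    (hpriv : ∀ A ∈ H, ∃ x ∈ A, ∀ B ∈ H, B ≠ A → S B = S A → x ∉ B)
    {A : Finset V} (hA : A ∈ H) {J : Finset (Finset V)} (hJ : J ⊆ H) (hAJ : A ∉ J)
    (hJt : #J ≤ t) : ¬ A ⊆ J.sup id := by
  intro hsub
  have hne : ∀ B ∈ J, A ≠ B := fun B hB h => hAJ (h ▸ hB)
  obtain ⟨x, hxA, hx⟩ := hpriv A hA
  obtain ⟨B, hB, hxB⟩ := mem_sup.1 (hsub hxA)
  have hSB : S A ≠ S B := fun h => hx B (hJ hB) (hne B hB).symm h.symm hxB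
  have h1 : ∑ C ∈ J, #(A ∩ C) < ∑ _C ∈ J, k :=
    sum_lt_sum (fun C hC => hH.card_inter_le ht hcard hA (hJ hC) (hne C hC))
      ⟨B, hB, (card_le_card (inter_subset_inter_left (hS B (hJ hB)))).trans_lt
        (hcross A hA B (hJ hB) hSB)⟩
  have h2 := card_le_sum_inter hsub
  rw [sum_const, smul_eq_mul] at h1
  rw [hcard A hA] at h2
  have h3 : #J * k ≤ t * k := Nat.mul_le_mul_right k hJt
  lia

/-- Two families of `t + 1` edges differing in one edge have different unions. -/
lemma IsSpread.insert_sup_ne (ht : 2 ≤ t) (hk : 1 ≤ k) (hcard : ∀ e ∈ H, #e = t * k)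
    (hH : IsSpread ((t - 1) * k) k (2 * t + 2) H) (hS : ∀ e ∈ H, e ⊆ S e)
    (hcross : ∀ A ∈ H, ∀ B ∈ H, S A ≠ S B → #(A ∩ S B) < k)
    (hpriv : ∀ A ∈ H, ∃ x ∈ A, ∀ B ∈ H, B ≠ A → S B = S A → x ∉ B)
    {A B : Finset V} (hA : A ∈ H) (hB : B ∈ H) (hAB : A ≠ B) {J : Finset (Finset V)}
    (hJ : J ⊆ H) (hAJ : A ∉ J) (hBJ : B ∉ J) (hJt : #J = t) :
    A ∪ J.sup id ≠ B ∪ J.sup id := by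
  intro heq
  have hW : A ∪ J.sup id ⊆ J.sup id ∪ (A ∩ B) \ J.sup id := by
    intro x hx
    have hx' := heq ▸ hx
    simp only [mem_union, mem_sdiff, mem_inter] at hx hx' ⊢
    tauto
  have h1 := (card_le_card hW).trans (card_union_le _ _)
  have h2 := card_sup_id_le fun e he => hcard e (hJ he)
  have h3 : #((A ∩ B) \ J.sup id) ≤ #(A ∩ B) := card_le_card sdiff_subset
  have h4 := hH.card_inter_le ht hcard hA hB hAB
  have hABJ : A ∉ insert B J := by simp [hAB, hAJ]
  have h5 : #(insert A (insert B J)) = t + 2 := by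
    rw [card_insert_of_notMem hABJ, card_insert_of_notMem hBJ, hJt]
  have h6 := hH (insert A (insert B J))
    (insert_subset hA (insert_subset hB hJ)) (insert_nonempty _ _) (by lia)
  rw [h5, sup_insert, sup_insert, id, id, sup_eq_union, sup_eq_union, ← heq,
    ← union_assoc, union_self] at h6
  rw [hJt] at h2
  have ht2 : t = 2 := by
    obtain ⟨u, rfl⟩ := Nat.exists_eq_add_of_le' ht
    rw [show u + 2 - 1 = u + 1 by lia] at h6
    have : u * k = 0 := by nlinarith
    rcases Nat.mul_eq_zero.1 this with h | h <;> lia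
  subst ht2
  have h7 : #(A ∩ B) = k := by lia
  have h8 : A ∩ B ⊆ (A ∩ B) \ J.sup id :=
    (eq_of_subset_of_card_le sdiff_subset (by lia)).ge
  have hSAB : S A = S B := by
    by_contra h
    have h9 : #(A ∩ B) ≤ #(A ∩ S B) := card_le_card (inter_subset_inter_left (hS B hB))
    have := hcross A hA B hB h
    lia
  have hu := card_union_add_card_inter A B
  rw [hcard A hA, hcard B hB, h7] at hu
  have hsym : (A ∪ B) \ (A ∩ B) ⊆ J.sup id := by
    intro x hx
    have h9 : x ∈ A ∪ J.sup id ↔ x ∈ B ∪ J.sup id := by rw [heq]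
    simp only [mem_union, mem_sdiff, mem_inter] at hx h9 ⊢
    tauto
  have hle := card_le_sum_inter hsym
  have hsymc : #((A ∪ B) \ (A ∩ B)) = 2 * k := by
    rw [card_sdiff_of_subset (inter_subset_left.trans subset_union_left)]
    lia
  obtain ⟨x, hxA, hx⟩ := hpriv A hA
  have hxB : x ∉ B := hx B hB hAB.symm hSAB.symm
  obtain ⟨C, hC, hxC⟩ := mem_sup.1 (hsym (mem_sdiff.2 ⟨mem_union_left _ hxA,
    fun h => hxB (mem_inter.1 h).2⟩))
  have hneA : ∀ C ∈ J, C ≠ A := fun C hC h => hAJ (h ▸ hC)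
  have hneB : ∀ C ∈ J, C ≠ B := fun C hC h => hBJ (h ▸ hC)
  have hSC : S C ≠ S A := fun h => hx C (hJ hC) (hneA C hC) h hxC
  have hlt : ∑ C ∈ J, #((A ∪ B) \ (A ∩ B) ∩ C) < ∑ _C ∈ J, k := by
    refine sum_lt_sum (fun E hE => ?_) ⟨C, hC, ?_⟩
    · have hEAB : E ∉ ({A, B} : Finset (Finset V)) := by simp [hneA E hE, hneB E hE]
      have h10 : #({E, A, B} : Finset (Finset V)) = 3 := by
        rw [card_insert_of_notMem hEAB, card_pair hAB]
      have h11 := hH {E, A, B} (by simp [insert_subset_iff, hA, hB, hJ hE]) (by simp)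
        (by lia)
      rw [h10, sup_insert, sup_insert, sup_singleton, id, id, id, sup_eq_union,
        sup_eq_union] at h11
      have h12 := card_union_add_card_inter E (A ∪ B)
      rw [hcard E (hJ hE)] at h12
      have h13 : #((A ∪ B) \ (A ∩ B) ∩ E) ≤ #(E ∩ (A ∪ B)) := by
        rw [inter_comm E]
        exact card_le_card (inter_subset_inter_right sdiff_subset)
      lia
    · refine (card_le_card ?_).trans_lt (hcross C (hJ hC) A hA hSC)
      rw [inter_comm C]
      exact inter_subset_inter_right
        (sdiff_subset.trans (union_subset (hS A hA) (hSAB ▸ hS B hB)))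
  rw [sum_const, smul_eq_mul, hJt] at hlt
  lia

/-- A spread `t * k`-graph whose edges sit in hosts, with a private vertex for each edge inside
its host and small intersections with the other hosts, is `(t + 1)`-union-free. -/
theorem IsSpread.isUnionFree (ht : 2 ≤ t) (hk : 1 ≤ k) (hcard : ∀ e ∈ H, #e = t * k)
    (hH : IsSpread ((t - 1) * k) k (2 * t + 2) H) (hS : ∀ e ∈ H, e ⊆ S e)
    (hcross : ∀ A ∈ H, ∀ B ∈ H, S A ≠ S B → #(A ∩ S B) < k)
    (hpriv : ∀ A ∈ H, ∃ x ∈ A, ∀ B ∈ H, B ≠ A → S B = S A → x ∉ B) :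
    IsUnionFree (t + 1) H := by
  have hcf : ∀ X ⊆ H, ∀ Y ⊆ H, #Y ≤ t + 1 → X.sup id = Y.sup id → ¬ X ⊆ Y →
      #Y = t + 1 := by
    intro X hX Y hY hYt heq hXY
    obtain ⟨A, hA, hAY⟩ := not_subset.1 hXY
    by_contra h
    exact hH.not_subset_sup ht hcard hS hcross hpriv (hX hA) hY hAY (by lia)
      ((le_sup (f := id) hA).trans heq.le)
  intro X hX Y hY _ _ hXt hYt hne heq
  have hcards : #X = t + 1 ∧ #Y = t + 1 := by
    by_cases hXY : X ⊆ Y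
    · have hYX : ¬ Y ⊆ X := fun h => hne (hXY.antisymm h)
      have h1 := hcf Y hY X hX hXt heq.symm hYX
      exact absurd (eq_of_subset_of_card_le hXY (by lia)) hne
    · have h1 := hcf X hX Y hY hYt heq hXY
      have hYX : ¬ Y ⊆ X := fun h => hne (eq_of_subset_of_card_le h (by lia)).symm
      exact ⟨hcf Y hY X hX hXt heq.symm hYX, h1⟩
  obtain ⟨hXc, hYc⟩ := hcards
  set C := X ∩ Y with hC
  have hXs : X = X \ Y ∪ C := (sdiff_union_inter X Y).symm
  have hYs : Y = Y \ X ∪ C := by rw [hC, inter_comm, sdiff_union_inter]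
  have hsX : #(X \ Y) + #C = t + 1 := by rw [hC, card_sdiff_add_card_inter, hXc]
  have hsY : #(Y \ X) + #C = t + 1 := by rw [hC, inter_comm, card_sdiff_add_card_inter, hYc]
  have hu := card_union_add_card_inter X Y
  have hs0 : 1 ≤ #(X \ Y) := by
    rw [Nat.one_le_iff_ne_zero, Ne, card_eq_zero, sdiff_eq_empty_iff_subset]
    exact fun h => hne (eq_of_subset_of_card_le h (by lia))
  have hle := card_sup_id_le fun e he => hcard e (hX he)
  have hge := hH (X ∪ Y) (union_subset hX hY)
    ((card_pos.1 (by lia : 0 < #X)).mono subset_union_left) (by lia)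
  rw [sup_union, ← heq, sup_idem] at hge
  obtain ⟨s, hs⟩ : ∃ s, #(X \ Y) = s + 1 := ⟨_, (Nat.sub_add_cancel hs0).symm⟩
  have hun : #(X ∪ Y) = t + 2 + s := by lia
  rw [hun] at hge
  rw [hXc] at hle
  have hsle : s = 0 ∨ (s = 1 ∧ t = 2) := by
    obtain ⟨u, rfl⟩ := Nat.exists_eq_add_of_le' ht
    rw [show u + 2 - 1 = u + 1 by lia] at hge
    have h1 : s * (u + 1) * k ≤ 1 * k := by nlinarith
    have h2 := Nat.le_of_mul_le_mul_right h1 hk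
    rcases Nat.eq_zero_or_pos s with h | h
    · exact Or.inl h
    · right
      constructor <;> nlinarith
  rcases hsle with rfl | ⟨rfl, rfl⟩
  · obtain ⟨A, hA⟩ := card_eq_one.1 hs
    obtain ⟨B, hB⟩ := card_eq_one.1 (by lia : #(Y \ X) = 1)
    have hAm := mem_sdiff.1 (hA.ge (mem_singleton_self A))
    have hBm := mem_sdiff.1 (hB.ge (mem_singleton_self B))
    refine hH.insert_sup_ne ht hk hcard hS hcross hpriv (hX hAm.1) (hY hBm.1)
      (fun h => hAm.2 (h ▸ hBm.1)) (inter_subset_left.trans hX)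
      (fun h => hAm.2 (mem_inter.1 h).2) (fun h => hBm.2 (mem_inter.1 h).1)
      (by lia : #C = t) ?_
    have hXsup : X.sup id = A ∪ C.sup id := by
      rw [hXs, sup_union, hA, sup_singleton]; rfl
    have hYsup : Y.sup id = B ∪ C.sup id := by
      rw [hYs, sup_union, hB, sup_singleton]; rfl
    rw [← hXsup, ← hYsup, heq]
  · obtain ⟨E, hE⟩ := card_eq_one.1 (by lia : #C = 1)
    have hEX : E ∈ X := (mem_inter.1 (hE.ge (mem_singleton_self E))).1
    have hEc := hcard E (hX hEX)
    have hWc : #(X.sup id) = 6 * k := by lia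
    have hEW : E ⊆ X.sup id := le_sup (f := id) hEX
    have hdisj : ∀ Z : Finset (Finset V), Z ⊆ H → #Z = 2 → Z.sup id ∪ E = X.sup id →
        Z.sup id ⊆ X.sup id \ E := by
      intro Z hZ hZc hZE
      have h1 := card_union_add_card_inter (Z.sup id) E
      have h2 := card_sup_id_le fun e he => hcard e (hZ he)
      rw [hZE, hWc, hEc] at h1
      rw [hZc] at h2
      have h3 : Disjoint (Z.sup id) E := by
        rw [disjoint_iff_inter_eq_empty, ← card_eq_zero]
        lia
      rw [← hZE, union_sdiff_right, sdiff_eq_self_of_disjoint h3]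
    have h1 := hdisj (X \ Y) (sdiff_subset.trans hX) hs (by
      conv_rhs => rw [hXs, sup_union, hE, sup_singleton]
      rfl)
    have h2 := hdisj (Y \ X) (sdiff_subset.trans hY) (by lia) (by
      conv_rhs => rw [heq, hYs, sup_union, hE, sup_singleton]
      rfl)
    have hdj : Disjoint (X \ Y) (Y \ X) := disjoint_sdiff_sdiff
    have h3 : #(X \ Y ∪ Y \ X) = 4 := by rw [card_union_of_disjoint hdj]; lia
    have h4 := hH (X \ Y ∪ Y \ X)
      (union_subset (sdiff_subset.trans hX) (sdiff_subset.trans hY))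
      (card_pos.1 (by lia)) (by lia)
    rw [h3, sup_union] at h4
    have h5 := card_le_card (union_subset h1 h2)
    rw [card_sdiff_of_subset hEW, hWc, hEc] at h5
    rw [sup_eq_union] at h4
    lia

end

section Gluing

variable {A V : Type*} [DecidableEq V]

/-- The union of the copies of `F` under the embeddings in `Ψ`. -/
def gluedCopies (F : Finset (Finset A)) (Ψ : Finset (A ↪ V)) : Finset (Finset V) :=
  Ψ.biUnion (copy F)

variable {F : Finset (Finset A)} {Ψ : Finset (A ↪ V)} {k m a r : ℕ}

lemma mem_gluedCopies {e : Finset V} :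
    e ∈ gluedCopies F Ψ ↔ ∃ φ ∈ Ψ, ∃ f ∈ F, f.map φ = e := by
  simp [gluedCopies, copy]

variable [Fintype A]

lemma disjoint_copy_of_card_inter_le (hr : k < r) (hF : ∀ f ∈ F, #f = r) {φ ψ : A ↪ V}
    (h : #((univ : Finset A).map φ ∩ (univ : Finset A).map ψ) ≤ k) :
    Disjoint (copy F φ) (copy F ψ) := by
  refine disjoint_left.2 fun e he he' => ?_
  have h1 := card_eq_of_mem_copy hF he
  have h2 := card_eq_of_mem_copy hF he'
  have := card_le_card (subset_inter h1.2 h2.2)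
  lia

lemma card_gluedCopies (hr : k < r) (hF : ∀ f ∈ F, #f = r)
    (hΨ : ∀ φ ∈ Ψ, ∀ ψ ∈ Ψ, φ ≠ ψ → #((univ : Finset A).map φ ∩ (univ : Finset A).map ψ) ≤ k) :
    #(gluedCopies F Ψ) = #Ψ * #F := by
  rw [gluedCopies, card_biUnion fun φ hφ ψ hψ h =>
    disjoint_copy_of_card_inter_le hr hF (hΨ φ hφ ψ hψ h)]
  simp [card_copy]

variable [DecidableEq A]

/-- Gluing spread copies of a spread hypergraph gives a spread hypergraph. -/
lemma isSpread_gluedCopies (hkA : k ≤ Fintype.card A) (hr : k < r) (hF : ∀ f ∈ F, #f = r)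
    (hFs : IsSpread a k m F)
    (hΨ : ∀ φ ∈ Ψ, ∀ ψ ∈ Ψ, φ ≠ ψ → #((univ : Finset A).map φ ∩ (univ : Finset A).map ψ) ≤ k)
    (hΨs : ∀ Ψ' ⊆ Ψ, Ψ'.Nonempty → #Ψ' ≤ m →
      #Ψ' * (Fintype.card A - k) + k ≤ #(spanned Ψ')) :
    IsSpread a k m (gluedCopies F Ψ) := by
  intro J hJ hJne hJm
  let part : (A ↪ V) → Finset (Finset A) := fun φ => {f ∈ F | f.map φ ∈ J}
  set Ψ' := {φ ∈ Ψ | (part φ).Nonempty} with hΨ'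
  have hpartF : ∀ φ, part φ ⊆ F := fun φ => filter_subset _ _
  have hJeq : Ψ'.biUnion (fun φ => copy (part φ) φ) = J := by
    ext e
    constructor
    · intro he
      obtain ⟨φ, -, he'⟩ := mem_biUnion.1 he
      obtain ⟨f, hf, rfl⟩ := mem_image.1 he'
      exact (mem_filter.1 hf).2
    · intro he
      obtain ⟨φ, hφ, f, hf, rfl⟩ := mem_gluedCopies.1 (hJ he)
      have hfp : f ∈ part φ := mem_filter.2 ⟨hf, he⟩
      exact mem_biUnion.2 ⟨φ, mem_filter.2 ⟨hφ, f, hfp⟩, map_mem_copy.2 hfp⟩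
  have hJc : #J = ∑ φ ∈ Ψ', #(part φ) := by
    have hdisj : ∀ φ ∈ Ψ', ∀ ψ ∈ Ψ', φ ≠ ψ →
        Disjoint (copy (part φ) φ) (copy (part ψ) ψ) := fun φ hφ ψ hψ h =>
      (disjoint_copy_of_card_inter_le hr hF
        (hΨ φ (mem_filter.1 hφ).1 ψ (mem_filter.1 hψ).1 h)).mono
        (image_subset_image (hpartF φ)) (image_subset_image (hpartF ψ))
    rw [← hJeq, card_biUnion hdisj]
    exact sum_congr rfl fun φ _ => card_copy _ _
  have hΨ'J : #Ψ' ≤ #J := by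
    rw [hJc, card_eq_sum_ones]
    exact sum_le_sum fun φ hφ => (mem_filter.1 hφ).2.card_pos
  have hΨ'ne : Ψ'.Nonempty := by
    rw [← hJeq] at hJne
    exact nonempty_iff_ne_empty.2 fun h => by simp [h] at hJne
  have hspan := hΨs Ψ' (filter_subset _ _) hΨ'ne (hΨ'J.trans hJm)
  have hsub : spanned Ψ' ⊆
      J.sup id ∪ Ψ'.biUnion fun φ => (univ \ (part φ).sup id).map φ := by
    intro v hv
    obtain ⟨φ, hφ, hvφ⟩ := mem_biUnion.1 hv
    obtain ⟨x, -, rfl⟩ := mem_map.1 hvφ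
    by_cases hx : x ∈ (part φ).sup id
    · obtain ⟨f, hf, hxf⟩ := mem_sup.1 hx
      exact mem_union_left _ (mem_sup.2 ⟨f.map φ, (mem_filter.1 hf).2, mem_map_of_mem φ hxf⟩)
    · exact mem_union_right _ (mem_biUnion.2 ⟨φ, hφ,
        mem_map_of_mem φ (mem_sdiff.2 ⟨mem_univ x, hx⟩)⟩)
  have hcard := (card_le_card hsub).trans
    ((card_union_le _ _).trans (Nat.add_le_add_left card_biUnion_le _))
  have hmiss : ∑ φ ∈ Ψ', (#((univ \ (part φ).sup id).map φ) + (#(part φ) * a + k)) ≤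
      ∑ _φ ∈ Ψ', Fintype.card A := by
    refine sum_le_sum fun φ hφ => ?_
    have h1 : #(part φ) ≤ m := by
      refine le_trans ?_ hJm
      rw [hJc]
      exact single_le_sum (f := fun φ => #(part φ)) (fun _ _ => Nat.zero_le _) hφ
    have h2 := hFs (part φ) (hpartF φ) (mem_filter.1 hφ).2 h1
    have h3 := card_sdiff_add_card_inter univ ((part φ).sup id)
    rw [univ_inter, card_univ] at h3
    rw [card_map]
    lia
  rw [sum_add_distrib, sum_add_distrib, ← sum_mul, ← hJc, sum_const, sum_const, smul_eq_mul,
    smul_eq_mul] at hmiss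
  have h4 : #Ψ' * (Fintype.card A - k) + #Ψ' * k = #Ψ' * Fintype.card A := by
    rw [← mul_add, Nat.sub_add_cancel hkA]
  lia

/-- Embeddings whose copies of the `k`-shadow of `F` are pairwise disjoint and induced in
`alive` glue together a union-free hypergraph. -/
theorem isUnionFree_gluedCopies {t : ℕ} (ht : 2 ≤ t) (hk : 2 ≤ k) {r : ℕ} (hr : r = t * k)
    (hrA : r ≤ Fintype.card A) (hF : ∀ f ∈ F, #f = r)
    (hFs : IsSpread ((t - 1) * k) k (2 * t + 2) F)
    (hFp : ∀ f ∈ F, ∃ x ∈ f, ∀ g ∈ F, g ≠ f → x ∉ g) {alive : Finset (Finset V)}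
    (halive : ∀ φ ∈ Ψ, ∀ K : Finset A, #K = k → (K.map φ ∈ alive ↔ K ∈ kShadow k F))
    (hΨs : ∀ Ψ' ⊆ Ψ, Ψ'.Nonempty → #Ψ' ≤ 2 * t + 2 →
      #Ψ' * (Fintype.card A - k) + k ≤ #(spanned Ψ'))
    (hdisj : ∀ φ ∈ Ψ, ∀ ψ ∈ Ψ, φ ≠ ψ →
      Disjoint (copy (kShadow k F) φ) (copy (kShadow k F) ψ)) :
    IsUnionFree (t + 1) (gluedCopies F Ψ) ∧ #(gluedCopies F Ψ) = #Ψ * #F ∧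
      ∀ e ∈ gluedCopies F Ψ, #e = t * k := by
  subst hr
  have hkr : k < t * k := by nlinarith
  have hΨ : ∀ φ ∈ Ψ, ∀ ψ ∈ Ψ, φ ≠ ψ →
      #((univ : Finset A).map φ ∩ (univ : Finset A).map ψ) ≤ k := by
    intro φ hφ ψ hψ h
    refine card_inter_le_of_le_card_spanned (hkr.le.trans hrA) ?_
    have := hΨs {φ, ψ} (by simp [insert_subset_iff, hφ, hψ]) (by simp)
      (by rw [card_pair h]; lia)
    rwa [card_pair h] at this
  have hcard : ∀ e ∈ gluedCopies F Ψ, #e = t * k := by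
    intro e he
    obtain ⟨φ, -, f, hf, rfl⟩ := mem_gluedCopies.1 he
    rw [card_map, hF f hf]
  refine ⟨?_, card_gluedCopies hkr hF hΨ, hcard⟩
  have hhost : ∀ e : Finset V, ∃ s : Finset V, e ∈ gluedCopies F Ψ →
      ∃ φ ∈ Ψ, (∃ f ∈ F, f.map φ = e) ∧ s = univ.map φ := by
    intro e
    by_cases he : e ∈ gluedCopies F Ψ
    · obtain ⟨φ, hφ, h⟩ := mem_gluedCopies.1 he
      exact ⟨_, fun _ => ⟨φ, hφ, h, rfl⟩⟩
    · exact ⟨∅, fun h => absurd h he⟩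
  choose S hS using hhost
  refine (isSpread_gluedCopies (hkr.le.trans hrA) hkr hF hFs hΨ hΨs).isUnionFree (S := S) ht
    (by lia) hcard ?_ ?_ ?_
  · intro e he
    obtain ⟨φ, hφ, ⟨f, hf, rfl⟩, hs⟩ := hS e he
    rw [hs]
    exact map_subset_map.2 (subset_univ f)
  · intro e he e' he' hne
    obtain ⟨φ, hφ, ⟨f, hf, rfl⟩, hs⟩ := hS e he
    obtain ⟨ψ, hψ, -, hs'⟩ := hS e' he'
    rw [hs, hs'] at hne
    rw [hs']
    by_contra! hle
    obtain ⟨K, hK, hKc⟩ := exists_subset_card_eq hle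
    obtain ⟨K₁, hK₁, rfl⟩ := subset_map_iff.1 (hK.trans inter_subset_left)
    obtain ⟨K₂, -, hK₂⟩ := subset_map_iff.1 (hK.trans inter_subset_right)
    rw [card_map] at hKc
    have hK₂c : #K₂ = k := by rw [← card_map ψ, ← hK₂, card_map, hKc]
    have hK₁s : K₁ ∈ kShadow k F := mem_sup.2 ⟨f, hf, mem_powersetCard.2 ⟨hK₁, hKc⟩⟩
    have hK₂s : K₂ ∈ kShadow k F :=
      (halive ψ hψ K₂ hK₂c).1 (hK₂ ▸ (halive φ hφ K₁ hKc).2 hK₁s)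
    refine disjoint_left.1 (hdisj φ hφ ψ hψ fun h => hne (h ▸ rfl)) (map_mem_copy.2 hK₁s) ?_
    rw [hK₂]
    exact map_mem_copy.2 hK₂s
  · intro e he
    obtain ⟨φ, hφ, ⟨f, hf, rfl⟩, hs⟩ := hS e he
    obtain ⟨x, hx, hxp⟩ := hFp f hf
    refine ⟨φ x, mem_map_of_mem φ hx, fun e' he' hne hss hxe' => ?_⟩
    obtain ⟨ψ, hψ, ⟨g, hg, rfl⟩, hs'⟩ := hS e' he'
    rw [hs, hs'] at hss
    have hψφ : ψ = φ := by
      by_contra h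
      have := hΨ ψ hψ φ hφ h
      rw [hss, inter_self, card_map, card_univ] at this
      lia
    subst hψφ
    exact hxp g hg (fun h => hne (h ▸ rfl)) ((mem_map' ψ).1 hxe')

end Gluing

lemma exists_many_spread_embeddings {s k : ℕ} (hk : 1 ≤ k) (hs : k < s) {L : ℝ} (hL : 0 ≤ L)
    (m : ℕ) : ∃ y : ℕ, k ≤ y ∧ ∃ 𝒮 : Finset (Fin s ↪ Fin y), L * y.choose k ≤ (#𝒮 : ℝ) ∧
      ∀ Ψ ⊆ 𝒮, Ψ.Nonempty → #Ψ ≤ m → #Ψ * (s - k) + k ≤ #(spanned Ψ) := by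
  set G := powersetCard k (univ : Finset (Fin s)) with hG
  have hGk : ∀ K ∈ G, #K = k := fun K hK => (mem_powersetCard.1 hK).2
  have hGne : G.Nonempty := powersetCard_nonempty.2 (by simpa using hs.le)
  have hg : (0 : ℝ) < #G := by exact_mod_cast hGne.card_pos
  set D : ℝ := 4 * (6 + 30 * #G + #G * L) with hD
  have hD1 : 1 ≤ D := by
    have : 0 ≤ #G * L := by positivity
    linarith
  obtain ⟨n₀, h⟩ := exists_sparse_copies hk (by simpa using hs) hGk hGne
    (show (0 : ℝ) < 1 / 6 by norm_num) (by norm_num) hD1 m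
  obtain ⟨alive, -, 𝒮, hal, -, hsp, -, hdev⟩ := h (max n₀ k) (le_max_left _ _)
  refine ⟨max n₀ k, le_max_right _ _, 𝒮, ?_, by simpa using hsp⟩
  set N : ℝ := ((max n₀ k).choose k : ℝ) with hN
  have hdeg : (∑ e ∈ alive, hyperDeg (copy G) 𝒮 e : ℝ) ≤ #G * #𝒮 := by
    rw [← Nat.cast_sum, sum_hyperDeg_eq]
    have : ∑ φ ∈ 𝒮, #(copy G φ ∩ alive) ≤ ∑ _φ ∈ 𝒮, #G :=
      sum_le_sum fun φ _ => (card_le_card inter_subset_left).trans_eq (card_copy G φ)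
    rw [sum_const, smul_eq_mul, mul_comm] at this
    exact_mod_cast this
  have hlow : ∀ e ∈ alive,
      D / 2 - ((hyperDeg (copy G) 𝒮 e : ℝ) - D) ^ 2 / (2 * D) ≤ hyperDeg (copy G) 𝒮 e := by
    intro e _
    have h1 : D / 2 - ((hyperDeg (copy G) 𝒮 e : ℝ) - D) ^ 2 / (2 * D) =
        hyperDeg (copy G) 𝒮 e - (hyperDeg (copy G) 𝒮 e : ℝ) ^ 2 / (2 * D) := by
      field_simp
      ring
    rw [h1]
    exact sub_le_self _ (by positivity)
  have hsum := (sum_le_sum hlow).trans hdeg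
  rw [sum_sub_distrib, sum_const, nsmul_eq_mul, ← sum_div] at hsum
  have h2 : (∑ e ∈ alive, ((hyperDeg (copy G) 𝒮 e : ℝ) - D) ^ 2) / (2 * D) ≤
      (6 + 30 * #G) * N := by
    rw [div_le_iff₀ (by linarith)]
    refine hdev.trans (le_of_eq ?_)
    ring
  have h3 : 1 / 2 * N * (D / 2) ≤ #alive * (D / 2) :=
    mul_le_mul_of_nonneg_right (le_trans (le_of_eq (by ring)) hal) (by linarith)
  have h4 : #G * (L * N) ≤ #G * (#𝒮 : ℝ) := by
    have : 1 / 2 * N * (D / 2) = (6 + 30 * #G) * N + #G * (L * N) := by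
      rw [hD]
      ring
    linarith
  exact le_of_mul_le_mul_left h4 hg

section Augmented

variable {s y : ℕ}

/-- The range of `σ` together with a vertex private to `σ`. -/
def augmentedRange (σ : Fin s ↪ Fin y) : Finset (Fin y ⊕ (Fin s ↪ Fin y)) :=
  (univ.map σ).disjSum {σ}

lemma card_augmentedRange (σ : Fin s ↪ Fin y) : #(augmentedRange σ) = s + 1 := by
  simp [augmentedRange, card_disjSum]

lemma inr_mem_augmentedRange {σ τ : Fin s ↪ Fin y} :
    Sum.inr τ ∈ augmentedRange σ ↔ τ = σ := by
  simp [augmentedRange]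

lemma augmentedRange_injective :
    Function.Injective (augmentedRange : (Fin s ↪ Fin y) → _) := fun σ τ h => by
  rw [← inr_mem_augmentedRange, ← h, inr_mem_augmentedRange]

lemma sup_image_augmentedRange (Ψ : Finset (Fin s ↪ Fin y)) :
    (Ψ.image augmentedRange).sup id = (spanned Ψ).disjSum Ψ := by
  ext (x | σ)
  · simp [mem_sup, augmentedRange, spanned]
  · simp [mem_sup, inr_mem_augmentedRange]

lemma isSpread_image_augmentedRange {k m : ℕ} (hks : k ≤ s) {𝒮 : Finset (Fin s ↪ Fin y)}
    (h𝒮 : ∀ Ψ ⊆ 𝒮, Ψ.Nonempty → #Ψ ≤ m → #Ψ * (s - k) + k ≤ #(spanned Ψ)) :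
    IsSpread (s + 1 - k) k m (𝒮.image augmentedRange) := by
  intro J hJ hJne hJm
  obtain ⟨Ψ, hΨ, rfl⟩ := subset_image_iff.1 hJ
  rw [card_image_of_injective _ augmentedRange_injective] at hJm ⊢
  have h := h𝒮 Ψ (by exact_mod_cast hΨ) hJne.of_image hJm
  rw [sup_image_augmentedRange, card_disjSum, Nat.sub_add_comm hks, mul_add, mul_one]
  lia

lemma card_kShadow_augmentedRange_le {k : ℕ} (𝒮 : Finset (Fin s ↪ Fin y)) :
    #(kShadow k (𝒮.image augmentedRange)) ≤ y.choose k + #𝒮 * s.choose (k - 1) := by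
  have hsub : kShadow k (𝒮.image augmentedRange) ⊆
      (powersetCard k (univ : Finset (Fin y))).image (fun K => K.map .inl) ∪
        𝒮.biUnion fun σ => (powersetCard (k - 1) ((univ.map σ).map .inl)).image
          (insert (Sum.inr σ)) := by
    intro K hK
    obtain ⟨f, hf, hKf⟩ := mem_sup.1 hK
    obtain ⟨σ, hσ, rfl⟩ := mem_image.1 hf
    obtain ⟨hKσ, hKc⟩ := mem_powersetCard.1 hKf
    have herase : K.erase (Sum.inr σ) ⊆ (univ.map σ).map .inl := by
      rintro (x | τ) hx
      · have := hKσ (mem_of_mem_erase hx)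
        simpa [augmentedRange] using this
      · have h1 := inr_mem_augmentedRange.1 (hKσ (mem_of_mem_erase hx))
        exact absurd (h1 ▸ rfl) (ne_of_mem_erase hx)
    by_cases hmem : Sum.inr σ ∈ K
    · refine mem_union_right _ (mem_biUnion.2 ⟨σ, hσ, mem_image.2 ⟨K.erase (Sum.inr σ),
        mem_powersetCard.2 ⟨herase, by rw [card_erase_of_mem hmem, hKc]⟩, insert_erase hmem⟩⟩)
    · rw [erase_eq_of_notMem hmem] at herase
      obtain ⟨K', -, rfl⟩ := subset_map_iff.1 herase
      rw [card_map] at hKc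
      exact mem_union_left _ (mem_image.2 ⟨K', mem_powersetCard.2 ⟨subset_univ _, hKc⟩, rfl⟩)
  refine (card_le_card hsub).trans ((card_union_le _ _).trans (Nat.add_le_add ?_ ?_))
  · exact card_image_le.trans_eq (by simp)
  · exact card_biUnion_le_card_mul _ _ _ fun σ _ => card_image_le.trans_eq (by simp)

end Augmented

/-- A spread `t * k`-graph whose edges have private vertices and whose `k`-shadow is not much
larger than the number of pairs of an edge and a `k`-subset through its private vertex. -/
theorem exists_spread_small_kShadow {t k : ℕ} (ht : 2 ≤ t) (hk : 2 ≤ k) {γ : ℝ} (hγ : 0 < γ) :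
    ∃ (A : Type) (_ : Fintype A) (_ : DecidableEq A) (F : Finset (Finset A)),
      t * k ≤ Fintype.card A ∧ F.Nonempty ∧ (∀ f ∈ F, #f = t * k) ∧
      IsSpread ((t - 1) * k) k (2 * t + 2) F ∧
      (∀ f ∈ F, ∃ x ∈ f, ∀ g ∈ F, g ≠ f → x ∉ g) ∧
      (#(kShadow k F) : ℝ) ≤ (1 + γ) * (t * k - 1).choose (k - 1) * #F := by
  have hkt : 2 * k ≤ t * k := Nat.mul_le_mul_right k ht
  obtain ⟨s, hs⟩ : ∃ s, t * k = s + 1 := ⟨t * k - 1, by lia⟩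
  obtain ⟨y, hy, 𝒮, h𝒮, hsp⟩ := exists_many_spread_embeddings (s := s) (k := k) (by lia) (by lia)
    (show 0 ≤ 1 / γ by positivity) (2 * t + 2)
  have hY : (0 : ℝ) < y.choose k := by exact_mod_cast Nat.choose_pos hy
  have h𝒮0 : (0 : ℝ) < #𝒮 := lt_of_lt_of_le (by positivity) h𝒮
  have h𝒮ne : 𝒮.Nonempty := card_pos.1 (by exact_mod_cast h𝒮0)
  have hF : ∀ f ∈ 𝒮.image augmentedRange, #f = t * k := by
    intro f hf
    obtain ⟨σ, -, rfl⟩ := mem_image.1 hf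
    rw [card_augmentedRange, hs]
  refine ⟨Fin y ⊕ (Fin s ↪ Fin y), inferInstance, inferInstance, 𝒮.image augmentedRange,
    ?_, h𝒮ne.image _, hF, ?_, ?_, ?_⟩
  · obtain ⟨σ, hσ⟩ := h𝒮ne
    rw [← hF _ (mem_image_of_mem _ hσ)]
    exact card_le_univ _
  · have h := isSpread_image_augmentedRange (by lia) hsp
    rwa [show s + 1 - k = (t - 1) * k by rw [Nat.sub_mul, one_mul, hs]] at h
  · intro f hf
    obtain ⟨σ, -, rfl⟩ := mem_image.1 hf
    refine ⟨Sum.inr σ, inr_mem_augmentedRange.2 rfl, fun g hg hne h => ?_⟩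
    obtain ⟨τ, -, rfl⟩ := mem_image.1 hg
    exact hne (inr_mem_augmentedRange.1 h ▸ rfl)
  · rw [card_image_of_injective _ augmentedRange_injective, hs, Nat.add_sub_cancel]
    have h1 : (#(kShadow k (𝒮.image augmentedRange)) : ℝ) ≤
        y.choose k + #𝒮 * s.choose (k - 1) := by
      exact_mod_cast card_kShadow_augmentedRange_le 𝒮
    have h2 : (1 : ℝ) ≤ s.choose (k - 1) := by
      exact_mod_cast Nat.choose_pos (by lia)
    have h3 : (y.choose k : ℝ) ≤ γ * #𝒮 := by
      rw [one_div_mul_eq_div, div_le_iff₀ hγ] at h𝒮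
      linarith
    have h4 : γ * #𝒮 * 1 ≤ γ * #𝒮 * s.choose (k - 1) :=
      mul_le_mul_of_nonneg_left h2 (by positivity)
    linarith

/-- For large `n`, almost all `k`-subsets of `Fin n` are covered by disjoint induced copies of the
`k`-shadow of `F`, and gluing copies of `F` accordingly gives a union-free hypergraph. -/
theorem exists_unionFree_of_spread {A : Type} [Fintype A] [DecidableEq A] {t k : ℕ} (ht : 2 ≤ t)
    (hk : 2 ≤ k) {F : Finset (Finset A)} (hA : t * k ≤ Fintype.card A) (hFne : F.Nonempty)
    (hF : ∀ f ∈ F, #f = t * k) (hFs : IsSpread ((t - 1) * k) k (2 * t + 2) F)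
    (hFp : ∀ f ∈ F, ∃ x ∈ f, ∀ g ∈ F, g ≠ f → x ∉ g) {γ : ℝ} (hγ : 0 < γ) :
    ∃ n₀ : ℕ, ∀ n ≥ n₀, ∃ H : Finset (Finset (Fin n)), (∀ e ∈ H, #e = t * k) ∧
      IsUnionFree (t + 1) H ∧ (1 - γ) * n.choose k * #F ≤ (#(kShadow k F) * #H : ℝ) := by
  classical
  have hkt : k < t * k := by nlinarith
  set G := kShadow k F with hG
  have hGk : ∀ K ∈ G, #K = k := by
    intro K hK
    obtain ⟨f, -, hKf⟩ := mem_sup.1 hK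
    exact (mem_powersetCard.1 hKf).2
  have hGne : G.Nonempty := by
    obtain ⟨f, hf⟩ := hFne
    obtain ⟨K, hK⟩ := powersetCard_nonempty.2 (hkt.le.trans (hF f hf).ge)
    exact ⟨K, mem_sup.2 ⟨f, hf, hK⟩⟩
  obtain ⟨η, hη, Dm, -, hmatch⟩ :=
    exists_nearly_perfect_matching hGne.card_pos (show 0 < γ / 2 by positivity)
  set D : ℝ := max 1 (max Dm ((12 + 60 * #G) / η)) with hD
  have hD1 : 1 ≤ D := le_max_left _ _
  have hDm : Dm ≤ D := (le_max_left _ _).trans (le_max_right _ _)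
  have hDη : (12 + 60 * #G : ℝ) ≤ η * D := by
    have : (12 + 60 * #G : ℝ) / η ≤ D := (le_max_right _ _).trans (le_max_right _ _)
    rwa [div_le_iff₀' hη] at this
  have hd0 : 0 < min (γ / 6) (1 / 2) := by positivity
  obtain ⟨n₀, h⟩ := exists_sparse_copies (by lia : 1 ≤ k) (hkt.trans_le hA) hGk hGne hd0
    ((min_le_right _ _).trans_lt (by norm_num)) hD1 (2 * t + 2)
  refine ⟨n₀, fun n hn => ?_⟩
  obtain ⟨alive, halive, Φ, hal, hcol, hsp, hdeg, hdev⟩ := h n hn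
  have hlin : IsLinearHypergraph (copy G) Φ := by
    intro φ hφ ψ hψ hne
    have h1 := hsp {φ, ψ} (by simp [insert_subset_iff, hφ, hψ]) (by simp)
      (by rw [card_pair hne]; lia)
    rw [card_pair hne] at h1
    have h2 := card_inter_le_of_le_card_spanned (hkt.le.trans hA) h1
    refine card_le_one.2 fun e he e' he' => ?_
    rw [mem_inter] at he he'
    rw [eq_inter_of_mem_copy hGk hGk h2 he.1 he.2, eq_inter_of_mem_copy hGk hGk h2 he'.1 he'.2]
  have hsub : ∀ φ ∈ Φ, copy G φ ⊆ alive := by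
    intro φ hφ e he
    obtain ⟨K, hK, rfl⟩ := mem_image.1 he
    exact (hcol φ hφ K (hGk K hK)).2 hK
  have halN : (#alive : ℝ) ≤ n.choose k := by
    have := card_le_card halive
    rw [card_powersetCard, card_univ, Fintype.card_fin] at this
    exact_mod_cast this
  obtain ⟨M, hM, hdisj, hMc⟩ := hmatch (copy G) Φ alive D (n.choose k) hlin hsub
    (fun φ _ => card_copy G φ) (fun e _ => hdeg e) hDm halN (hdev.trans (by
      have : (12 + 60 * #G : ℝ) * (D * n.choose k) ≤ η * D * (D * n.choose k) :=
        mul_le_mul_of_nonneg_right hDη (by positivity)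
      linarith))
  obtain ⟨hH, hHc, hHr⟩ := isUnionFree_gluedCopies (Ψ := M) ht hk rfl hA hF hFs hFp
    (fun φ hφ => hcol φ (hM hφ)) (fun Ψ' hΨ' => hsp Ψ' (hΨ'.trans hM)) hdisj
  refine ⟨gluedCopies F M, hHr, hH, ?_⟩
  have hcov : (1 - γ) * n.choose k ≤ (#G * #M : ℝ) := by
    have : min (γ / 6) (1 / 2) * (n.choose k : ℝ) ≤ γ / 6 * n.choose k :=
      mul_le_mul_of_nonneg_right (min_le_left _ _) (by positivity)
    linarith
  rw [hHc, Nat.cast_mul, ← mul_assoc]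
  exact mul_le_mul_of_nonneg_right hcov (by positivity)

lemma le_maxUnionFree {t n r : ℕ} {H : Finset (Finset (Fin n))} (hr : ∀ e ∈ H, #e = r)
    (hH : IsUnionFree t H) : #H ≤ maxUnionFree t n r := by
  refine le_csSup ⟨Fintype.card (Finset (Fin n)), ?_⟩ ⟨H, hr, hH, rfl⟩
  rintro _ ⟨J, -, -, rfl⟩
  exact card_le_univ J

/-- For all `t ≥ 2`, `k ≥ 2` and `ε > 0`, for all large enough `n` there is an `n`-vertex
`(t+1)`-union-free `tk`-graph with at least `(1-ε) · C(n,k) / C(tk-1, k-1)` edges, i.e.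
`U_{t+1}(n, tk) ≥ (1-ε) · C(n,k) / C(tk-1, k-1)`. -/
theorem unionFree_lower_bound (t k : ℕ) (ht : 2 ≤ t) (hk : 2 ≤ k)
    (ε : ℝ) (hε : 0 < ε) :
    ∃ n0 : ℕ, ∀ n : ℕ, n0 ≤ n →
      (∃ H : Finset (Finset (Fin n)), (∀ e ∈ H, e.card = t * k) ∧
        IsUnionFree (t + 1) H ∧
        (1 - ε) * (n.choose k : ℝ) / ((t * k - 1).choose (k - 1) : ℝ) ≤ (H.card : ℝ)) ∧
      (1 - ε) * (n.choose k : ℝ) / ((t * k - 1).choose (k - 1) : ℝ) ≤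
        (maxUnionFree (t + 1) n (t * k) : ℝ) := by
  obtain ⟨A, _, _, F, hA, hFne, hF, hFs, hFp, hG⟩ :=
    exists_spread_small_kShadow ht hk (show 0 < ε / 4 by positivity)
  obtain ⟨n₀, h⟩ := exists_unionFree_of_spread ht hk hA hFne hF hFs hFp
    (show 0 < ε / 4 by positivity)
  refine ⟨n₀, fun n hn => ?_⟩
  obtain ⟨H, hHr, hH, hHc⟩ := h n hn
  have hle : (1 - ε) * (n.choose k : ℝ) / ((t * k - 1).choose (k - 1) : ℝ) ≤ (#H : ℝ) := by
    set c : ℝ := ((t * k - 1).choose (k - 1) : ℝ) with hc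
    have hc0 : 0 < c := by
      have : k ≤ t * k := Nat.le_mul_of_pos_left k (by lia)
      exact Nat.cast_pos.2 (Nat.choose_pos (by lia))
    have hF0 : (0 : ℝ) < #F := Nat.cast_pos.2 hFne.card_pos
    have h1 : (1 - ε / 4) * n.choose k * #F ≤ (1 + ε / 4) * (c * #H) * #F :=
      hHc.trans ((mul_le_mul_of_nonneg_right hG (by positivity)).trans_eq (by ring))
    have h2 := le_of_mul_le_mul_right h1 hF0
    have h3 : (1 + ε / 4) * ((1 - ε) * n.choose k) ≤ (1 - ε / 4) * n.choose k := by
      rw [← mul_assoc]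
      exact mul_le_mul_of_nonneg_right (by nlinarith) (by positivity)
    have h4 := le_of_mul_le_mul_left (h3.trans h2) (by positivity)
    rwa [div_le_iff₀' hc0]
  exact ⟨⟨H, hHr, hH, hle⟩, hle.trans (Nat.cast_le.2 (le_maxUnionFree hHr hH))⟩
end

section
/- For all fixed integers r > k ≥ 2 and e ≥ 2, there exists a constant c = c(r, k, e) > 0, independent of m, such that for every sufficiently large m there exists an r-graph G ⊆ C([m], r) with at least c · m^{k + 1/(e−1)} edges which is (ℓr − (ℓ−1)k − 1, ℓ)-free for all 2 ≤ ℓ ≤ e. -/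
open Finset

variable {α : Type*} {β : Type*}

theorem sum_powerset_weight_superset [DecidableEq α] (V T : Finset α) (hT : T ⊆ V) (p : ℝ) :
    ∑ S ∈ V.powerset, (if T ⊆ S then p ^ S.card * (1 - p) ^ (V \ S).card else 0) =
      p ^ T.card := by
  have h := Finset.prod_add (fun _ : α => p) (fun v => if v ∈ T then 0 else 1 - p) V
  have hl : ∏ v ∈ V, (p + if v ∈ T then 0 else 1 - p) = p ^ T.card := by
    have h1 : ∀ v ∈ V, (p + if v ∈ T then 0 else 1 - p) = if v ∈ T then p else 1 := by
      intro v _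
      split_ifs <;> ring
    rw [Finset.prod_congr rfl h1, Finset.prod_ite_mem, Finset.inter_eq_right.mpr hT,
      Finset.prod_const]
  rw [← hl, h]
  refine Finset.sum_congr rfl fun S hS => ?_
  rw [Finset.prod_const]
  split_ifs with hTS
  · congr 1
    rw [← Finset.prod_const]
    refine Finset.prod_congr rfl fun v hv => ?_
    rw [if_neg fun hvT => (Finset.mem_sdiff.mp hv).2 (hTS hvT)]
  · obtain ⟨v, hvT, hvS⟩ := Finset.not_subset.mp hTS
    have h0 : ∏ v ∈ V \ S, (if v ∈ T then 0 else 1 - p) = 0 :=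
      Finset.prod_eq_zero (Finset.mem_sdiff.mpr ⟨hT hvT, hvS⟩) (if_pos hvT)
    rw [h0, mul_zero]

/-- First moment method: a random subset of `V`, with every element kept with probability `p`,
has the expected size minus the expected number of members of `B` inside it. -/
theorem exists_subset_card_sub_card_filter_ge [DecidableEq α] (V : Finset α)
    (B : Finset (Finset α)) (hB : ∀ T ∈ B, T ⊆ V) (p : ℝ) (hp0 : 0 ≤ p) (hp1 : p ≤ 1) :
    ∃ S ⊆ V, p * V.card - ∑ T ∈ B, p ^ T.card ≤
      (S.card : ℝ) - ((B.filter (· ⊆ S)).card : ℝ) := by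
  set w : Finset α → ℝ := fun S => p ^ S.card * (1 - p) ^ (V \ S).card with hw
  have hw0 : ∀ S, 0 ≤ w S := fun S =>
    mul_nonneg (pow_nonneg hp0 _) (pow_nonneg (sub_nonneg.mpr hp1) _)
  have htot : ∑ S ∈ V.powerset, w S = 1 := by
    simpa using sum_powerset_weight_superset V ∅ (Finset.empty_subset _) p
  have hcard : ∑ S ∈ V.powerset, w S * S.card = p * V.card := by
    have h1 : ∀ S ∈ V.powerset, w S * (S.card : ℝ) =
        ∑ v ∈ V, if {v} ⊆ S then w S else 0 := by
      intro S hS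
      simp only [Finset.singleton_subset_iff]
      rw [Finset.sum_ite_mem, Finset.inter_eq_right.mpr (Finset.mem_powerset.mp hS),
        Finset.sum_const, nsmul_eq_mul, mul_comm]
    rw [Finset.sum_congr rfl h1, Finset.sum_comm]
    rw [Finset.sum_congr rfl fun v hv =>
      sum_powerset_weight_superset V {v} (Finset.singleton_subset_iff.mpr hv) p]
    simp [mul_comm]
  have hbad : ∑ S ∈ V.powerset, w S * ((B.filter (· ⊆ S)).card : ℝ) =
      ∑ T ∈ B, p ^ T.card := by
    have h1 : ∀ S ∈ V.powerset, w S * ((B.filter (· ⊆ S)).card : ℝ) =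
        ∑ T ∈ B, if T ⊆ S then w S else 0 := by
      intro S _
      rw [← Finset.sum_filter, Finset.sum_const, nsmul_eq_mul, mul_comm]
    rw [Finset.sum_congr rfl h1, Finset.sum_comm]
    exact Finset.sum_congr rfl fun T hT => sum_powerset_weight_superset V T (hB T hT) p
  by_contra! hcon
  set E := p * V.card - ∑ T ∈ B, p ^ T.card with hE
  have hsum : ∑ S ∈ V.powerset, w S * (E - ((S.card : ℝ) - ((B.filter (· ⊆ S)).card : ℝ))) = 0 := by
    simp only [mul_sub, Finset.sum_sub_distrib]
    rw [← Finset.sum_mul, htot, hcard, hbad, hE]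
    ring
  have hz := (Finset.sum_eq_zero_iff_of_nonneg fun S hS => mul_nonneg (hw0 S)
    (sub_nonneg.mpr (hcon S (Finset.mem_powerset.mp hS)).le)).mp hsum
  have hwz : ∑ S ∈ V.powerset, w S = 0 := Finset.sum_eq_zero fun S hS =>
    (mul_eq_zero.mp (hz S hS)).resolve_right
      (sub_pos.mpr (hcon S (Finset.mem_powerset.mp hS))).ne'
  rw [htot] at hwz
  exact one_ne_zero hwz

/-- Deletion method: there is a large subset of `V` containing no member of `B`. -/
theorem exists_subset_avoiding [DecidableEq α] (V : Finset α) (B : Finset (Finset α))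
    (hB : ∀ T ∈ B, T ⊆ V) (hne : ∀ T ∈ B, T.Nonempty) (p : ℝ) (hp0 : 0 ≤ p) (hp1 : p ≤ 1) :
    ∃ G ⊆ V, (∀ T ∈ B, ¬ T ⊆ G) ∧ p * V.card - ∑ T ∈ B, p ^ T.card ≤ (G.card : ℝ) := by
  obtain ⟨S, hSV, hS⟩ := exists_subset_card_sub_card_filter_ge V B hB p hp0 hp1
  rcases isEmpty_or_nonempty α with hα | hα
  · refine ⟨S, hSV, fun T hT _ => (hne T hT).elim fun x _ => isEmptyElim x, ?_⟩
    have h0 : (0 : ℝ) ≤ ((B.filter (· ⊆ S)).card : ℝ) := Nat.cast_nonneg _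
    linarith
  choose! f hf using hne
  refine ⟨S \ (B.filter (· ⊆ S)).image f, Finset.sdiff_subset.trans hSV, ?_, ?_⟩
  · intro T hT hTG
    have hTS : T ⊆ S := hTG.trans Finset.sdiff_subset
    exact (Finset.mem_sdiff.mp (hTG (hf T hT))).2
      (Finset.mem_image_of_mem f (Finset.mem_filter.mpr ⟨hT, hTS⟩))
  · refine hS.trans ?_
    have h1 := Finset.le_card_sdiff ((B.filter (· ⊆ S)).image f) S
    have h2 : ((B.filter (· ⊆ S)).image f).card ≤ (B.filter (· ⊆ S)).card :=
      Finset.card_image_le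
    have h3 : S.card ≤ (S \ (B.filter (· ⊆ S)).image f).card + (B.filter (· ⊆ S)).card := by
      omega
    have h4 : (S.card : ℝ) ≤ ((S \ (B.filter (· ⊆ S)).image f).card : ℝ) +
        ((B.filter (· ⊆ S)).card : ℝ) := by exact_mod_cast h3
    linarith

/-- The number of `ℓ`-edge families spanning at most `v` vertices is `O(m ^ v)`. -/
theorem card_filter_sup_card_le (m v ℓ : ℕ) (hv : v ≤ m) (V : Finset (Finset (Fin m))) :
    ((V.powersetCard ℓ).filter fun T => (T.sup id).card ≤ v).card ≤
      (2 ^ v).choose ℓ * m ^ v := by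
  have hsub : ((V.powersetCard ℓ).filter fun T => (T.sup id).card ≤ v) ⊆
      ((Finset.univ : Finset (Fin m)).powersetCard v).biUnion
        fun U => U.powerset.powersetCard ℓ := by
    intro T hT
    rw [Finset.mem_filter, Finset.mem_powersetCard] at hT
    obtain ⟨⟨-, hTℓ⟩, hTv⟩ := hT
    obtain ⟨U, hTU, -, hU⟩ := Finset.exists_subsuperset_card_eq
      (Finset.subset_univ (T.sup id)) hTv (by simpa using hv)
    refine Finset.mem_biUnion.mpr ⟨U, Finset.mem_powersetCard.mpr ⟨Finset.subset_univ _, hU⟩,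
      Finset.mem_powersetCard.mpr ⟨fun A hA => Finset.mem_powerset.mpr ?_, hTℓ⟩⟩
    exact (Finset.le_sup (f := id) hA).trans hTU
  refine (Finset.card_le_card hsub).trans ?_
  refine (Finset.card_biUnion_le_card_mul _ _ ((2 ^ v).choose ℓ) ?_).trans ?_
  · intro U hU
    rw [Finset.card_powersetCard, Finset.card_powerset, (Finset.mem_powersetCard.mp hU).2]
  · rw [Finset.card_powersetCard, Finset.card_univ, Fintype.card_fin, mul_comm]
    exact Nat.mul_le_mul_left _ (Nat.choose_le_pow m v)

theorem pow_div_le_choose (m r : ℕ) (hm : 2 * r ≤ m) :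
    1 / (2 ^ r * (r.factorial : ℝ)) * (m : ℝ) ^ r ≤ (m.choose r : ℝ) := by
  have h : (((m + 1 - r : ℕ) : ℝ) ^ r / (r.factorial : ℝ)) ≤ (m.choose r : ℝ) :=
    Nat.pow_le_choose r m
  have h2 : (m : ℝ) / 2 ≤ ((m + 1 - r : ℕ) : ℝ) := by
    have h3 : m ≤ 2 * (m + 1 - r) := by omega
    have h4 : (m : ℝ) ≤ 2 * ((m + 1 - r : ℕ) : ℝ) := by exact_mod_cast h3
    linarith
  refine le_trans ?_ h
  calc 1 / (2 ^ r * (r.factorial : ℝ)) * (m : ℝ) ^ r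
      = ((m : ℝ) / 2) ^ r / (r.factorial : ℝ) := by
        rw [div_pow]
        field_simp
    _ ≤ _ := by gcongr

/-- Comparison of the expected number of bad `ℓ`-edge families with the expected number of edges,
for edge probability `a * (t / m ^ (r - k))` with `t ^ (e - 1) = m`. -/
theorem prob_pow_mul_pow_le (r k e ℓ : ℕ) (hr : k < r) (hℓ : 2 ≤ ℓ) (hℓe : ℓ ≤ e)
    (x t a : ℝ) (hx : 1 ≤ x) (ht : 1 ≤ t) (hte : t ^ (e - 1) = x) (ha0 : 0 ≤ a) (ha1 : a ≤ 1) :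
    (a * (t / x ^ (r - k))) ^ ℓ * x ^ (ℓ * r - (ℓ - 1) * k - 1) ≤ a * (a * (t * x ^ k)) := by
  obtain ⟨d, rfl⟩ : ∃ d, r = k + d := ⟨r - k, by omega⟩
  obtain ⟨s, rfl⟩ : ∃ s, ℓ = s + 1 := ⟨ℓ - 1, by omega⟩
  have hd : 1 ≤ d := by omega
  have hs : 1 ≤ s := by omega
  have hx0 : 0 < x := by linarith
  have hsd : 1 ≤ (s + 1) * d := Nat.mul_pos (by omega) (by omega)
  have hv : (s + 1) * (k + d) - (s + 1 - 1) * k - 1 + 1 = k + d * (s + 1) := by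
    have h1 : (s + 1) * (k + d) = s * k + (k + (s + 1) * d) := by ring
    rw [h1, Nat.add_sub_cancel, Nat.add_sub_cancel_left, mul_comm d]
    omega
  set v := (s + 1) * (k + d) - (s + 1 - 1) * k - 1 with hvdef
  have hts : t ^ s ≤ x := hte ▸ pow_le_pow_right₀ ht (by omega)
  have has : a ^ s ≤ a := by simpa using pow_le_pow_of_le_one ha0 ha1 hs
  rw [Nat.add_sub_cancel_left]
  refine le_of_mul_le_mul_right ?_ hx0
  calc (a * (t / x ^ d)) ^ (s + 1) * x ^ v * x
      = (a * (t / x ^ d)) ^ (s + 1) * x ^ (v + 1) := by ring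
    _ = a ^ s * (a * (t * x ^ k)) * t ^ s := by
        rw [hv, mul_pow, div_pow, pow_add x k, pow_mul x d]
        field_simp
        ring
    _ ≤ a * (a * (t * x ^ k)) * x := by gcongr

/-- For all `r > k ≥ 2` and `e ≥ 2`, there is `c > 0` such that for every large enough `m`
there is an `r`-graph `G` on `[m]` with at least `c · m^(k + 1/(e-1))` edges that is
`(ℓr - (ℓ-1)k - 1, ℓ)`-free for all `2 ≤ ℓ ≤ e`. -/
theorem exists_ell_minus_free_graph (r k e : ℕ) (hk : 2 ≤ k) (hr : k < r) (he : 2 ≤ e) :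
    ∃ c : ℝ, 0 < c ∧ ∃ m0 : ℕ, ∀ m : ℕ, m0 ≤ m →
      ∃ G : Finset (Finset (Fin m)),
        (∀ A ∈ G, A.card = r) ∧
        (∀ ℓ : ℕ, 2 ≤ ℓ → ℓ ≤ e → IsVEFree (ℓ * r - (ℓ - 1) * k - 1) ℓ G) ∧
        c * (m : ℝ) ^ ((k : ℝ) + 1 / ((e : ℝ) - 1)) ≤ (G.card : ℝ) := by
  set v : ℕ → ℕ := fun ℓ => ℓ * r - (ℓ - 1) * k - 1 with hv
  set C : ℕ → ℕ := fun ℓ => (2 ^ v ℓ).choose ℓ with hC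
  set K : ℝ := ∑ ℓ ∈ Finset.Icc 2 e, (C ℓ : ℝ) with hK
  have hK0 : 0 ≤ K := Finset.sum_nonneg fun _ _ => by positivity
  set d : ℝ := 1 / (2 ^ r * (r.factorial : ℝ)) with hd
  have hd0 : 0 < d := by positivity
  set a : ℝ := min 1 (d / (2 * (K + 1))) with ha
  have ha0 : 0 < a := lt_min one_pos (by positivity)
  have ha1 : a ≤ 1 := min_le_left _ _
  have haK : a * K ≤ d / 2 := by
    have h1 : a * (2 * (K + 1)) ≤ d := (le_div_iff₀ (by positivity)).mp (min_le_right _ _)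
    nlinarith
  refine ⟨d / 2 * a, by positivity, 2 * r + e * r, fun m hm => ?_⟩
  have hm1 : 1 ≤ m := by omega
  have hx : (1 : ℝ) ≤ m := by exact_mod_cast hm1
  have hx0 : (0 : ℝ) < m := by linarith
  have he1 : ((e - 1 : ℕ) : ℝ) = (e : ℝ) - 1 := by
    rw [Nat.cast_sub (by omega), Nat.cast_one]
  have he0 : (0 : ℝ) < (e : ℝ) - 1 := by
    rw [← he1]
    exact_mod_cast (by omega : 0 < e - 1)
  set t : ℝ := (m : ℝ) ^ (1 / ((e : ℝ) - 1)) with ht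
  have ht1 : 1 ≤ t := Real.one_le_rpow hx (by positivity)
  have hte : t ^ (e - 1) = m := by
    rw [ht, ← Real.rpow_natCast, ← Real.rpow_mul hx0.le, he1, one_div_mul_cancel he0.ne',
      Real.rpow_one]
  have htm : t ≤ (m : ℝ) ^ (r - k) :=
    calc t ≤ t ^ (e - 1) := le_self_pow₀ ht1 (by omega)
      _ = m := hte
      _ ≤ (m : ℝ) ^ (r - k) := le_self_pow₀ hx (by omega)
  have hy1 : t / (m : ℝ) ^ (r - k) ≤ 1 := (div_le_one (by positivity)).mpr htm
  set p : ℝ := a * (t / (m : ℝ) ^ (r - k)) with hp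
  have hp0 : 0 ≤ p := by positivity
  have hp1 : p ≤ 1 := mul_le_one₀ ha1 (by positivity) hy1
  have hpr : p * (m : ℝ) ^ r = a * (t * (m : ℝ) ^ k) := by
    have h1 : (m : ℝ) ^ r = (m : ℝ) ^ (r - k) * (m : ℝ) ^ k := by
      rw [← pow_add, Nat.sub_add_cancel hr.le]
    rw [hp, h1]
    field_simp
  set V : Finset (Finset (Fin m)) := (Finset.univ : Finset (Fin m)).powersetCard r with hV
  set bad : ℕ → Finset (Finset (Finset (Fin m))) := fun ℓ =>
    (V.powersetCard ℓ).filter fun T => (T.sup id).card ≤ v ℓ with hbad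
  have hmem : ∀ ℓ, ∀ T ∈ bad ℓ, T ⊆ V ∧ T.card = ℓ := fun ℓ T hT =>
    Finset.mem_powersetCard.mp (Finset.mem_filter.mp hT).1
  obtain ⟨G, hGV, hG, hGcard⟩ := exists_subset_avoiding V ((Finset.Icc 2 e).biUnion bad)
    (fun T hT => by
      obtain ⟨ℓ, -, hT⟩ := Finset.mem_biUnion.mp hT
      exact (hmem ℓ T hT).1)
    (fun T hT => by
      obtain ⟨ℓ, hℓ, hT⟩ := Finset.mem_biUnion.mp hT
      have h2 := (Finset.mem_Icc.mp hℓ).1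
      exact Finset.card_pos.mp (by rw [(hmem ℓ T hT).2]; omega))
    p hp0 hp1
  refine ⟨G, fun A hA => (Finset.mem_powersetCard.mp (hGV hA)).2, ?_, ?_⟩
  · intro ℓ hℓ hℓe 𝒜 h𝒜 hcard
    by_contra hlt
    refine hG 𝒜 (Finset.mem_biUnion.mpr ⟨ℓ, Finset.mem_Icc.mpr ⟨hℓ, hℓe⟩,
      Finset.mem_filter.mpr ⟨Finset.mem_powersetCard.mpr ⟨h𝒜.trans hGV, hcard⟩, ?_⟩⟩) h𝒜
    exact Nat.lt_succ_iff.mp (not_le.mp hlt)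
  · have hsum : ∑ T ∈ (Finset.Icc 2 e).biUnion bad, p ^ T.card ≤
        K * (a * (a * (t * (m : ℝ) ^ k))) := by
      rw [Finset.sum_biUnion fun i _ j _ hij => Finset.disjoint_left.mpr fun T hi hj =>
        hij ((hmem i T hi).2.symm.trans (hmem j T hj).2), hK, Finset.sum_mul]
      refine Finset.sum_le_sum fun ℓ hℓ => ?_
      obtain ⟨hℓ2, hℓe⟩ := Finset.mem_Icc.mp hℓ
      have hvm : v ℓ ≤ m := by
        have h1 : ℓ * r ≤ e * r := Nat.mul_le_mul_right r hℓe
        have h2 : v ℓ ≤ ℓ * r := (Nat.sub_le _ _).trans (Nat.sub_le _ _)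
        omega
      have hc : ((bad ℓ).card : ℝ) ≤ (C ℓ : ℝ) * (m : ℝ) ^ v ℓ := by
        exact_mod_cast card_filter_sup_card_le m (v ℓ) ℓ hvm V
      have hpℓ : ∑ T ∈ bad ℓ, p ^ T.card = ((bad ℓ).card : ℝ) * p ^ ℓ := by
        rw [← nsmul_eq_mul, ← Finset.sum_const]
        exact Finset.sum_congr rfl fun T hT => by rw [(hmem ℓ T hT).2]
      rw [hpℓ]
      calc ((bad ℓ).card : ℝ) * p ^ ℓ
          ≤ (C ℓ : ℝ) * (m : ℝ) ^ v ℓ * p ^ ℓ := by gcongr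
        _ = (C ℓ : ℝ) * (p ^ ℓ * (m : ℝ) ^ v ℓ) := by ring
        _ ≤ (C ℓ : ℝ) * (a * (a * (t * (m : ℝ) ^ k))) :=
          mul_le_mul_of_nonneg_left
            (prob_pow_mul_pow_le r k e ℓ hr hℓ2 hℓe m t a hx ht1 hte ha0.le ha1)
            (by positivity)
    have hVcard : d * (m : ℝ) ^ r ≤ (V.card : ℝ) := by
      rw [hV, Finset.card_powersetCard, Finset.card_univ, Fintype.card_fin]
      exact pow_div_le_choose m r (by omega)
    have hmain : d * (a * (t * (m : ℝ) ^ k)) ≤ p * V.card := by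
      rw [← hpr]
      calc d * (p * (m : ℝ) ^ r) = p * (d * (m : ℝ) ^ r) := by ring
        _ ≤ _ := by gcongr
    have hexp : (m : ℝ) ^ ((k : ℝ) + 1 / ((e : ℝ) - 1)) = t * (m : ℝ) ^ k := by
      rw [Real.rpow_add hx0, Real.rpow_natCast, mul_comm]
    rw [hexp]
    refine le_trans ?_ hGcard
    have hKa : K * (a * (a * (t * (m : ℝ) ^ k))) ≤ d / 2 * (a * (t * (m : ℝ) ^ k)) := by
      calc K * (a * (a * (t * (m : ℝ) ^ k))) = a * K * (a * (t * (m : ℝ) ^ k)) := by ring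
        _ ≤ _ := by gcongr
    linarith
end
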